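/- Let M be a compact topological n-manifold. Then there exists a constant r (depending on M alone) such that for every prime p, every elementary abelian p-group G acting continuously and effectively on M has rank at most r. -/

import Mathlib

namespace MannSu

universe u v w

section RelLen

variable {k : Type v} [Field k] {V : Type u} [AddCommGroup V] [Module k V]
  {W : Type w} [AddCommGroup W] [Module k W]

theorem length_submodule_mono {P Q : Submodule k V} (h : P ≤ Q) :
    Module.length k P ≤ Module.length k Q :=
  Module.length_le_of_injective (Submodule.inclusion h) (Submodule.inclusion_injective h)

theorem length_map_le (f : V →ₗ[k] W) (P : Submodule k V) :
    Module.length k (P.map f) ≤ Module.length k P :=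
  Module.length_le_of_surjective (f.submoduleMap P) (f.submoduleMap_surjective P)

theorem length_eq_map_add (f : V →ₗ[k] W) (P : Submodule k V) :
    Module.length k P =
      Module.length k ↥(P ⊓ LinearMap.ker f) + Module.length k (P.map f) :=
  Module.length_eq_add_of_exact (Submodule.inclusion inf_le_left) (f.submoduleMap P)
    (Submodule.inclusion_injective _) (f.submoduleMap_surjective P) (by
      intro x
      constructor
      · intro hx
        have : f x = 0 := congrArg Subtype.val hx
        exact ⟨⟨x, x.2, this⟩, rfl⟩
      · rintro ⟨y, rfl⟩
        exact Subtype.ext y.2.2)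

theorem length_map_eq_of_disjoint (f : V →ₗ[k] W) (P : Submodule k V)
    (h : P ⊓ LinearMap.ker f = ⊥) : Module.length k (P.map f) = Module.length k P := by
  rw [length_eq_map_add f P, h]
  simp

/-- The dimension of `f(P)` is at most that of `g(P)` plus that of `f(P ∩ ker g)`. -/
theorem length_map_le_add {V' : Type*} [AddCommGroup V'] [Module k V'] (f : V →ₗ[k] W)
    (g : V →ₗ[k] V') (P : Submodule k V) :
    Module.length k (P.map f) ≤
      Module.length k (P.map g) + Module.length k ((P ⊓ LinearMap.ker g).map f) := by
  set S := P.map (f.prod g) with hS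
  have h1 : P.map f = S.map (LinearMap.fst k W V') := by
    rw [hS, ← Submodule.map_comp, LinearMap.fst_prod]
  have h2 : P.map g = S.map (LinearMap.snd k W V') := by
    rw [hS, ← Submodule.map_comp, LinearMap.snd_prod]
  have h3 : (P ⊓ LinearMap.ker g).map f =
      (S ⊓ LinearMap.ker (LinearMap.snd k W V')).map (LinearMap.fst k W V') := by
    ext x
    simp only [Submodule.mem_map, Submodule.mem_inf, LinearMap.mem_ker, hS]
    constructor
    · rintro ⟨y, ⟨hy, hgy⟩, rfl⟩
      exact ⟨(f y, g y), ⟨⟨y, hy, rfl⟩, hgy⟩, rfl⟩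
    · rintro ⟨_, ⟨⟨y, hy, rfl⟩, hgy⟩, rfl⟩
      exact ⟨y, ⟨hy, hgy⟩, rfl⟩
  have h4 := length_map_eq_of_disjoint (LinearMap.fst k W V')
    (S ⊓ LinearMap.ker (LinearMap.snd k W V')) (by
      rw [eq_bot_iff]
      rintro ⟨a, b⟩ ⟨⟨_, hb⟩, ha⟩
      exact Prod.ext ha hb)
  rw [h3, h4, h2, h1, add_comm, ← length_eq_map_add]
  exact length_map_le _ _

/-- The dimension of `P / (P ∩ Q)`. -/
noncomputable def relLen (P Q : Submodule k V) : ℕ∞ := Module.length k (P.map Q.mkQ)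

theorem relLen_mono {P P' : Submodule k V} (Q : Submodule k V) (h : P ≤ P') :
    relLen P Q ≤ relLen P' Q :=
  length_submodule_mono (Submodule.map_mono h)

theorem relLen_le_add (P Q R : Submodule k V) :
    relLen P Q ≤ relLen P R + relLen (P ⊓ R) Q := by
  have := length_map_le_add Q.mkQ R.mkQ P
  rwa [Submodule.ker_mkQ] at this

theorem relLen_eq_zero_iff {P Q : Submodule k V} : relLen P Q = 0 ↔ P ≤ Q := by
  rw [relLen, Module.length_eq_zero_iff, Submodule.subsingleton_iff_eq_bot,
    ← LinearMap.le_ker_iff_map, Submodule.ker_mkQ]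

theorem relLen_eq_zero {P Q : Submodule k V} (h : P ≤ Q) : relLen P Q = 0 :=
  relLen_eq_zero_iff.2 h

theorem relLen_le_of_inf_le {P Q R : Submodule k V} (h : P ⊓ R ≤ Q) :
    relLen P Q ≤ relLen P R := by
  have := relLen_le_add P Q R
  rwa [relLen_eq_zero h, add_zero] at this

theorem relLen_anti (P : Submodule k V) {Q Q' : Submodule k V} (h : Q ≤ Q') :
    relLen P Q' ≤ relLen P Q :=
  relLen_le_of_inf_le (inf_le_right.trans h)

theorem length_map_eq_relLen_ker (f : V →ₗ[k] W) (P : Submodule k V) :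
    Module.length k (P.map f) = relLen P (LinearMap.ker f) := by
  apply le_antisymm
  · have := length_map_le_add f (LinearMap.ker f).mkQ P
    rw [Submodule.ker_mkQ] at this
    have h0 : (P ⊓ LinearMap.ker f).map f = ⊥ := by
      rw [← LinearMap.le_ker_iff_map]; exact inf_le_right
    rwa [h0, Module.length_bot, add_zero] at this
  · have := length_map_le_add (LinearMap.ker f).mkQ f P
    have h0 : (P ⊓ LinearMap.ker f).map (LinearMap.ker f).mkQ = ⊥ := by
      rw [← LinearMap.le_ker_iff_map, Submodule.ker_mkQ]; exact inf_le_right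
    rwa [h0, Module.length_bot, add_zero] at this

theorem relLen_map (f : V →ₗ[k] W) (P : Submodule k V) (Q : Submodule k W) :
    relLen (P.map f) Q = relLen P (Q.comap f) := by
  rw [relLen, ← Submodule.map_comp, length_map_eq_relLen_ker, LinearMap.ker_comp,
    Submodule.ker_mkQ]

/-- Comparison of subquotients along a linear map. -/
theorem relLen_le_map (f : V →ₗ[k] W) {P Q : Submodule k V} {R : Submodule k W}
    (h : P ⊓ R.comap f ≤ Q) : relLen P Q ≤ relLen (P.map f) R := by
  rw [relLen_map]
  exact relLen_le_of_inf_le h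

theorem relLen_map_le (f : V →ₗ[k] W) {P Q : Submodule k V} {R : Submodule k W}
    (h : Q ≤ R.comap f) : relLen (P.map f) R ≤ relLen P Q := by
  rw [relLen_map]
  exact relLen_anti _ h

theorem relLen_sup_le (P P' Q : Submodule k V) :
    relLen (P ⊔ P') Q ≤ relLen P Q + relLen P' Q := by
  rw [relLen, relLen, relLen, Submodule.map_sup, ← Module.length_prod]
  have h := LinearMap.range_coprod (P.map Q.mkQ).subtype (P'.map Q.mkQ).subtype
  rw [Submodule.range_subtype, Submodule.range_subtype] at h
  rw [← h]
  exact Module.length_le_of_surjective _ (LinearMap.surjective_rangeRestrict _)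

theorem relLen_sup_right {P P' Q : Submodule k V} (h : P' ≤ Q) :
    relLen (P ⊔ P') Q = relLen P Q := by
  refine le_antisymm ((relLen_sup_le P P' Q).trans ?_) (relLen_mono Q le_sup_left)
  rw [relLen_eq_zero h, add_zero]

theorem relLen_prod (P Q : Submodule k V) (P' Q' : Submodule k W) :
    relLen (P.prod P') (Q.prod Q') = relLen P Q + relLen P' Q' := by
  have h : Q.prod Q' = LinearMap.ker (Q.mkQ.prodMap Q'.mkQ) := by
    rw [LinearMap.ker_prodMap, Submodule.ker_mkQ, Submodule.ker_mkQ]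
  rw [h, ← length_map_eq_relLen_ker]
  set S := (P.prod P').map (Q.mkQ.prodMap Q'.mkQ) with hS
  have hS' : S = (P.map Q.mkQ).prod (P'.map Q'.mkQ) := by
    ext ⟨a, b⟩
    simp only [hS, Submodule.mem_map, Submodule.mem_prod, LinearMap.prodMap_apply, Prod.exists,
      Prod.mk.injEq]
    constructor
    · rintro ⟨x, y, ⟨hx, hy⟩, rfl, rfl⟩
      exact ⟨⟨x, hx, rfl⟩, ⟨y, hy, rfl⟩⟩
    · rintro ⟨⟨x, hx, rfl⟩, ⟨y, hy, rfl⟩⟩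
      exact ⟨x, y, ⟨hx, hy⟩, rfl, rfl⟩
  rw [hS', relLen, relLen, ← Module.length_prod]
  have h := LinearMap.range_prodMap (P.map Q.mkQ).subtype (P'.map Q'.mkQ).subtype
  rw [Submodule.range_subtype, Submodule.range_subtype] at h
  rw [← h]
  exact (LinearEquiv.ofInjective _ (Prod.map_injective.2
    ⟨Subtype.val_injective, Subtype.val_injective⟩)).length_eq.symm

end RelLen

end MannSu

namespace MannSu

universe u v w

/-- A module with a differential and a commuting action of `G` by operators of order `p`. -/
structure Amb (k : Type v) [Field k] (p : ℕ) (G : Type w) [CommGroup G] where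
  V : Type u
  [grp : AddCommGroup V]
  [mod : Module k V]
  d : V →ₗ[k] V
  ρ : G →* Module.End k V
  dd : ∀ x, d (d x) = 0
  comm : ∀ g x, d (ρ g x) = ρ g (d x)
  pow : ∀ g, ρ g ^ p = 1

attribute [instance] Amb.grp Amb.mod

variable {k : Type v} [Field k] {p : ℕ} {G : Type w} [CommGroup G]

namespace Amb

variable (D : Amb.{u} k p G)

/-- A graded subcomplex stable under the group; index `j + 1` is homological degree `j`. -/
structure IsSub (A : ℕ → Submodule k D.V) : Prop where
  zero : A 0 = ⊥
  d_mem : ∀ {j x}, x ∈ A (j + 1) → D.d x ∈ A j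
  ρ_mem : ∀ {j x} (g : G), x ∈ A j → D.ρ g x ∈ A j

/-- Relative cycles. -/
def Z (A B : ℕ → Submodule k D.V) (j : ℕ) : Submodule k D.V := A j ⊓ (B (j - 1)).comap D.d

/-- Relative boundaries. -/
def Bd (A B : ℕ → Submodule k D.V) (j : ℕ) : Submodule k D.V := B j ⊔ (A (j + 1)).map D.d

/-- Dimension of the relative homology of `A / B`. -/
noncomputable def H (A B : ℕ → Submodule k D.V) (j : ℕ) : ℕ∞ := relLen (D.Z A B j) (D.Bd A B j)

variable {D} {A B C : ℕ → Submodule k D.V}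

theorem mem_Z {j : ℕ} {x : D.V} : x ∈ D.Z A B j ↔ x ∈ A j ∧ D.d x ∈ B (j - 1) := Iff.rfl

theorem mem_Bd {j : ℕ} {x : D.V} :
    x ∈ D.Bd A B j ↔ ∃ y ∈ A (j + 1), x - D.d y ∈ B j := by
  rw [Bd, Submodule.mem_sup]
  constructor
  · rintro ⟨b, hb, _, ⟨y, hy, rfl⟩, rfl⟩
    exact ⟨y, hy, by simpa using hb⟩
  · rintro ⟨y, hy, h⟩
    exact ⟨_, h, _, ⟨y, hy, rfl⟩, by simp⟩

theorem H_eq_zero_iff {j : ℕ} :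
    D.H A B j = 0 ↔ ∀ z ∈ A j, D.d z ∈ B (j - 1) → ∃ y ∈ A (j + 1), z - D.d y ∈ B j := by
  rw [H, relLen_eq_zero_iff]
  constructor
  · intro h z hz hz'
    exact mem_Bd.1 (h ⟨hz, hz'⟩)
  · rintro h z ⟨hz, hz'⟩
    exact mem_Bd.2 (h z hz hz')

theorem H_zero (hA : D.IsSub A) : D.H A B 0 = 0 := by
  rw [H_eq_zero_iff]
  intro z hz _
  rw [hA.zero, Submodule.mem_bot] at hz
  subst hz
  exact ⟨0, zero_mem _, by simp⟩

theorem H_self (j : ℕ) : D.H A A j = 0 := by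
  rw [H_eq_zero_iff]
  intro z hz _
  exact ⟨0, zero_mem _, by simpa⟩

theorem IsSub.d_mem' (hA : D.IsSub A) {j : ℕ} {x : D.V} (hx : x ∈ A j) : D.d x ∈ A (j - 1) := by
  cases j with
  | zero => rw [hA.zero, Submodule.mem_bot] at hx; simp [hx]
  | succ j => exact hA.d_mem hx

/-- Middle term of the long exact sequence of a triple `C ≤ B ≤ A`. -/
theorem H_triple_mid (hBA : B ≤ A) (hCB : C ≤ B) (j : ℕ) :
    D.H A C j ≤ D.H A B j + D.H B C j := by
  refine (relLen_le_add _ _ (D.Bd A B j)).trans (add_le_add ?_ ?_)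
  · exact relLen_mono _ fun x hx => ⟨hx.1, hCB _ hx.2⟩
  · have h : D.Z A C j ⊓ D.Bd A B j ≤ D.Z B C j ⊔ (A (j + 1)).map D.d := by
      rintro x ⟨⟨_, hx⟩, hx'⟩
      obtain ⟨y, hy, h⟩ := mem_Bd.1 hx'
      refine Submodule.mem_sup.2 ⟨_, ⟨h, ?_⟩, _, ⟨y, hy, rfl⟩, sub_add_cancel _ _⟩
      simpa [D.dd] using hx
    refine (relLen_mono _ h).trans ?_
    rw [relLen_sup_right le_sup_right]
    exact relLen_anti _ (sup_le_sup_left (Submodule.map_mono (hBA _)) _)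

theorem H_triple_quot (hBA : B ≤ A) (hCB : C ≤ B) (j : ℕ) :
    D.H A B (j + 1) ≤ D.H A C (j + 1) + D.H B C j := by
  rw [add_comm (D.H A C (j + 1))]
  refine (relLen_le_add _ _ ((D.Bd B C j).comap D.d)).trans (add_le_add ?_ ?_)
  · rw [← relLen_map]
    refine relLen_mono _ ?_
    rintro _ ⟨x, hx, rfl⟩
    exact ⟨hx.2, by simp [D.dd]⟩
  · have h : D.Z A B (j + 1) ⊓ (D.Bd B C j).comap D.d ≤ D.Z A C (j + 1) ⊔ B (j + 1) := by
      rintro x ⟨⟨hx, _⟩, hx'⟩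
      obtain ⟨y, hy, h⟩ := mem_Bd.1 hx'
      refine Submodule.mem_sup.2 ⟨x - y, ⟨sub_mem hx (hBA _ hy), ?_⟩, y, hy, sub_add_cancel _ _⟩
      simpa using h
    refine (relLen_mono _ h).trans ?_
    rw [relLen_sup_right le_sup_left]
    exact relLen_anti _ (sup_le_sup_right (hCB _) _)

theorem H_triple_sub (hBA : B ≤ A) (hCB : C ≤ B) (j : ℕ) :
    D.H B C j ≤ D.H A C j + D.H A B (j + 1) := by
  refine (relLen_le_add _ _ (D.Bd A C j)).trans (add_le_add ?_ ?_)
  · exact relLen_mono _ fun x hx => ⟨hBA _ hx.1, hx.2⟩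
  · have h : D.Z B C j ⊓ D.Bd A C j ≤ (D.Z A B (j + 1)).map D.d ⊔ C j := by
      rintro x ⟨⟨hx, _⟩, hx'⟩
      obtain ⟨y, hy, h⟩ := mem_Bd.1 hx'
      refine Submodule.mem_sup.2 ⟨_, ⟨y, ⟨hy, ?_⟩, rfl⟩, _, h, by simp⟩
      have := sub_mem hx (hCB _ h)
      simpa using this
    refine (relLen_mono _ h).trans ?_
    rw [relLen_sup_right le_sup_left]
    refine relLen_map_le _ ?_
    intro x hx
    obtain ⟨y, _, h⟩ := mem_Bd.1 hx
    exact mem_Bd.2 ⟨_, h, by simp [D.dd]⟩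

theorem H_le_of_hom {D' : Amb.{u} k p G} (f : D.V →ₗ[k] D'.V)
    (hd : ∀ x, f (D.d x) = D'.d (f x)) {A' B' : ℕ → Submodule k D'.V} (hB' : D'.IsSub B')
    (hA : ∀ j, ∀ x ∈ A j, f x ∈ A' j) (hB : ∀ j, ∀ x ∈ A j, f x ∈ B' j ↔ x ∈ B j)
    (hAd : ∀ j, ∀ x ∈ A j, D.d x ∈ A (j - 1))
    (hs : ∀ j, ∀ x ∈ A' j, ∃ y ∈ A j, x - f y ∈ B' j) (j : ℕ) :
    D.H A B j ≤ D'.H A' B' j := by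
  refine (relLen_le_map f (R := D'.Bd A' B' j) ?_).trans (relLen_mono _ ?_)
  · rintro z ⟨⟨hz, _⟩, hz'⟩
    obtain ⟨y, hy, h⟩ := mem_Bd.1 hz'
    obtain ⟨x, hx, hxy⟩ := hs _ _ hy
    refine mem_Bd.2 ⟨x, hx, (hB _ _ (sub_mem hz (hAd _ _ hx))).1 ?_⟩
    have := add_mem h (hB'.d_mem hxy)
    simpa [hd] using this
  · rintro _ ⟨z, ⟨hz, hz'⟩, rfl⟩
    refine ⟨hA _ _ hz, ?_⟩
    change D'.d (f z) ∈ B' (j - 1)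
    rw [← hd]
    exact (hB _ _ (hAd _ _ hz)).2 hz'

variable (D) in
/-- The norm operator of `g`. -/
noncomputable def nm (g : G) : Module.End k D.V := ∑ i ∈ Finset.range p, D.ρ g ^ i

variable (D) in
/-- Alternately the norm operator and `g - 1`. -/
noncomputable def th (g : G) (n : ℕ) : Module.End k D.V := if Even n then D.nm g else D.ρ g - 1

theorem th_add_two (g : G) (n : ℕ) : D.th g (n + 2) = D.th g n := by
  simp [th, Nat.even_add_one]

theorem nm_mul_sub (g : G) : D.nm g * (D.ρ g - 1) = 0 := by
  rw [nm, geom_sum_mul, D.pow, sub_self]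

theorem sub_mul_nm (g : G) : (D.ρ g - 1) * D.nm g = 0 := by
  rw [nm, mul_geom_sum, D.pow, sub_self]

theorem th_th (g : G) (n : ℕ) (x : D.V) : D.th g n (D.th g (n + 1) x) = 0 := by
  rw [← Module.End.mul_apply]
  by_cases h : Even n <;> simp [th, h, Nat.even_add_one, nm_mul_sub, sub_mul_nm]

theorem nm_apply (g : G) (x : D.V) : D.nm g x = ∑ i ∈ Finset.range p, D.ρ (g ^ i) x := by
  simp [nm]

theorem d_nm (g : G) (x : D.V) : D.d (D.nm g x) = D.nm g (D.d x) := by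
  simp only [nm_apply, map_sum, D.comm]

theorem d_th (g : G) (n : ℕ) (x : D.V) : D.d (D.th g n x) = D.th g n (D.d x) := by
  unfold th
  split_ifs
  · exact d_nm g x
  · simp [D.comm]

theorem ρ_comm (g h : G) (x : D.V) : D.ρ g (D.ρ h x) = D.ρ h (D.ρ g x) := by
  rw [← Module.End.mul_apply, ← map_mul, mul_comm, map_mul, Module.End.mul_apply]

theorem ρ_nm (g h : G) (x : D.V) : D.ρ h (D.nm g x) = D.nm g (D.ρ h x) := by
  simp only [nm_apply, map_sum, ρ_comm h]

theorem ρ_th (g h : G) (n : ℕ) (x : D.V) : D.ρ h (D.th g n x) = D.th g n (D.ρ h x) := by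
  unfold th
  split_ifs
  · exact ρ_nm g h x
  · simp [ρ_comm h]

theorem nm_mem {A : Submodule k D.V} (g : G) (hA : ∀ g, ∀ x ∈ A, D.ρ g x ∈ A) {x : D.V}
    (hx : x ∈ A) : D.nm g x ∈ A := by
  rw [nm_apply]
  exact sum_mem fun i _ => hA _ _ hx

theorem IsSub.th_mem (hA : D.IsSub A) (g : G) (n : ℕ) {j : ℕ} {x : D.V} (hx : x ∈ A j) :
    D.th g n x ∈ A j := by
  unfold th
  split_ifs
  · exact nm_mem g (fun g x hx => hA.ρ_mem g hx) hx
  · exact sub_mem (hA.ρ_mem g hx) hx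

variable (D) in
/-- The differential of `phi`. -/
noncomputable def phiD (g : G) (ε : ℕ) : (ℕ → D.V) →ₗ[k] (ℕ → D.V) :=
  LinearMap.pi fun a => (-1 : k) ^ a • D.d ∘ₗ LinearMap.proj a +
    D.th g (a + 1 + ε) ∘ₗ LinearMap.proj (a + 1)

variable (D) in
/-- The diagonal action on `phi`. -/
noncomputable def phiρ : G →* Module.End k (ℕ → D.V) where
  toFun h := LinearMap.pi fun a => D.ρ h ∘ₗ LinearMap.proj a
  map_one' := by ext; simp
  map_mul' _ _ := by ext; simp

@[simp] theorem phiD_apply (g : G) (ε : ℕ) (f : ℕ → D.V) (a : ℕ) : D.phiD g ε f a =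
    (-1 : k) ^ a • D.d (f a) + D.th g (a + 1 + ε) (f (a + 1)) := rfl

@[simp] theorem phiρ_apply (h : G) (f : ℕ → D.V) (a : ℕ) : D.phiρ h f a = D.ρ h (f a) := rfl

variable (D) in
/-- The total complex computing the equivariant homology of the cyclic group generated by `g`
(with a shift of the periodic resolution by `ε`). -/
noncomputable abbrev phi (g : G) (ε : ℕ) : Amb.{u} k p G where
  V := ℕ → D.V
  d := D.phiD g ε
  ρ := D.phiρ
  dd x := by
    ext a
    have h := D.th_th g (a + 1 + ε) (x (a + 2))
    rw [show a + 1 + ε + 1 = a + 1 + 1 + ε by omega] at h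
    simp [D.dd, d_th, pow_succ, h]
  comm h x := by ext a; simp [D.comm, ρ_th]
  pow h := by
    rw [← map_pow]
    ext x a
    rw [phiρ_apply, map_pow, D.pow]
    rfl

variable (D) in
/-- The subcomplex of `phi` of sequences with entries in a given subcomplex. -/
def fam (A : ℕ → Submodule k D.V) (j : ℕ) : Submodule k (ℕ → D.V) :=
  Submodule.pi Set.univ fun a => A (j - a)

theorem mem_fam {j : ℕ} {f : ℕ → D.V} : f ∈ D.fam A j ↔ ∀ a, f a ∈ A (j - a) := by
  simp [fam, Submodule.mem_pi]

theorem fam_mono (h : A ≤ B) : D.fam A ≤ D.fam B := fun _ _ hf =>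
  mem_fam.2 fun a => h _ (mem_fam.1 hf a)

theorem IsSub.phi (hA : D.IsSub A) (g : G) (ε : ℕ) : (D.phi g ε).IsSub (D.fam A) where
  zero := by
    rw [eq_bot_iff]
    intro f hf
    ext a
    have := mem_fam.1 hf a
    rwa [Nat.zero_sub, hA.zero, Submodule.mem_bot] at this
  d_mem {j f} hf := by
    refine mem_fam.2 fun a => ?_
    have h1 := hA.d_mem' (mem_fam.1 hf a)
    have h2 := hA.th_mem g (a + 1 + ε) (mem_fam.1 hf (a + 1))
    rw [phiD_apply]
    refine add_mem (Submodule.smul_mem _ _ ?_) ?_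
    · rwa [show j + 1 - a - 1 = j - a by omega] at h1
    · rwa [show j + 1 - (a + 1) = j - a by omega] at h2
  ρ_mem h hf := mem_fam.2 fun a => hA.ρ_mem h (mem_fam.1 hf a)

end Amb

end MannSu

namespace MannSu

universe u v w

variable {k : Type v} [Field k] {p : ℕ} {G : Type w} [CommGroup G]

namespace Amb

variable {D : Amb.{u} k p G} {A B C : ℕ → Submodule k D.V}

variable (D) in
/-- Prepending an entry, with the signs that make it compatible with the differentials of `phi`. -/
def cns : (D.V × (ℕ → D.V)) →ₗ[k] (ℕ → D.V) where
  toFun x a := Nat.casesOn a x.1 fun b => (-1 : k) ^ b • x.2 b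
  map_add' x y := by ext (_ | a) <;> simp
  map_smul' c x := by
    ext (_ | a)
    · simp
    · simp [smul_comm c]

@[simp] theorem cns_zero (x : D.V × (ℕ → D.V)) : D.cns x 0 = x.1 := rfl

@[simp] theorem cns_succ (x : D.V × (ℕ → D.V)) (a : ℕ) :
    D.cns x (a + 1) = (-1 : k) ^ a • x.2 a := rfl

theorem neg_one_pow_smul_smul {V : Type*} [AddCommGroup V] [Module k V] (a : ℕ) (x : V) :
    (-1 : k) ^ a • (-1 : k) ^ a • x = x := by
  rw [smul_smul, ← mul_pow]; simp

theorem exists_cns (f : ℕ → D.V) : ∃ y q, D.cns (y, q) = f :=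
  ⟨f 0, fun a => (-1 : k) ^ a • f (a + 1), by
    ext (_ | a)
    · rfl
    · simp [neg_one_pow_smul_smul]⟩

theorem cns_mem_fam {j : ℕ} {y : D.V} {q : ℕ → D.V} :
    D.cns (y, q) ∈ D.fam A j ↔ y ∈ A j ∧ q ∈ D.fam A (j - 1) := by
  simp only [mem_fam]
  constructor
  · intro h
    refine ⟨h 0, fun a => ?_⟩
    have := Submodule.smul_mem _ ((-1 : k) ^ a) (h (a + 1))
    rw [cns_succ, neg_one_pow_smul_smul] at this
    rwa [show j - 1 - a = j - (a + 1) by omega]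
  · rintro ⟨h0, h⟩ (_ | a)
    · exact h0
    · rw [cns_succ, show j - (a + 1) = j - 1 - a by omega]
      exact Submodule.smul_mem _ _ (h a)

theorem phiD_cns (g : G) (ε : ℕ) (y : D.V) (q : ℕ → D.V) : D.phiD g ε (D.cns (y, q)) =
    D.cns (D.d y + D.th g (1 + ε) (q 0), - D.phiD g (ε + 1) q) := by
  ext (_ | a)
  · simp
  · simp only [phiD_apply, cns_succ, Pi.neg_apply, map_smul, pow_succ]
    rw [show a + 1 + 1 + ε = a + 1 + (ε + 1) by omega]
    simp [neg_one_pow_smul_smul]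
    abel

/-- The first entry of a cycle of `phi` whose tail is a boundary. -/
theorem th_mem_of_mem_Bd (hB : D.IsSub B) {g : G} {ε j : ℕ} {q : ℕ → D.V}
    (hq : q ∈ (D.phi g (ε + 1)).Bd (D.fam A) (D.fam B) j) :
    ∃ v ∈ D.fam A (j + 1), q - D.phiD g (ε + 1) v ∈ D.fam B j ∧
      D.th g (1 + ε) (q 0) - D.d (D.th g (1 + ε) (v 0)) ∈ B j := by
  obtain ⟨v, hv, h⟩ := mem_Bd.1 hq
  refine ⟨v, hv, h, ?_⟩
  have h0 := hB.th_mem g (1 + ε) (mem_fam.1 h 0)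
  have h1 := D.th_th g (1 + ε) (v 1)
  rw [show 1 + ε + 1 = 0 + 1 + (ε + 1) by omega] at h1
  simpa [d_th, h1] using h0

variable (D A B) in
theorem H_phi_le (hA : D.IsSub A) (hB : D.IsSub B) (g : G) (ε j : ℕ) :
    (D.phi g ε).H (D.fam A) (D.fam B) (j + 1) ≤
      D.H A B (j + 1) + (D.phi g (ε + 1)).H (D.fam A) (D.fam B) j := by
  let sh : (ℕ → D.V) →ₗ[k] (ℕ → D.V) :=
    LinearMap.pi fun a => (-1 : k) ^ a • LinearMap.proj (a + 1)
  have hsh : ∀ y q, sh (D.cns (y, q)) = q := by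
    intro y q
    ext a
    simp [sh, neg_one_pow_smul_smul]
  rw [add_comm (D.H _ _ _)]
  refine (relLen_le_add _ _ (((D.phi g (ε + 1)).Bd (D.fam A) (D.fam B) j).comap sh)).trans
    (add_le_add ?_ ?_)
  · rw [← relLen_map]
    refine relLen_mono _ ?_
    rintro _ ⟨f, ⟨hf, hf'⟩, rfl⟩
    obtain ⟨y, q, rfl⟩ := exists_cns f
    rw [hsh]
    replace hf' : D.phiD g ε (D.cns (y, q)) ∈ D.fam B j := hf'
    rw [phiD_cns, cns_mem_fam] at hf'
    refine ⟨(cns_mem_fam.1 hf).2, ?_⟩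
    simpa using hf'.2
  · have h : (D.phi g ε).Z (D.fam A) (D.fam B) (j + 1) ⊓
        ((D.phi g (ε + 1)).Bd (D.fam A) (D.fam B) j).comap sh ≤
        (D.Z A B (j + 1)).map (D.cns ∘ₗ LinearMap.inl k _ _) ⊔
          (D.phi g ε).Bd (D.fam A) (D.fam B) (j + 1) := by
      rintro f ⟨⟨hf, hf'⟩, hq⟩
      obtain ⟨y, q, rfl⟩ := exists_cns f
      replace hq : sh (D.cns (y, q)) ∈ (D.phi g (ε + 1)).Bd (D.fam A) (D.fam B) j := hq
      rw [hsh] at hq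
      obtain ⟨v, hv, h1, h2⟩ := th_mem_of_mem_Bd hB hq
      replace hf' : D.phiD g ε (D.cns (y, q)) ∈ D.fam B j := hf'
      rw [phiD_cns, cns_mem_fam] at hf'
      have hv0 := hA.th_mem g (1 + ε) (mem_fam.1 hv 0)
      refine Submodule.mem_sup.2 ⟨_, ⟨y + D.th g (1 + ε) (v 0), ⟨?_, ?_⟩, rfl⟩,
        D.cns (0, q - D.phiD g (ε + 1) v) + D.phiD g ε (D.cns (0, -v)), ?_, ?_⟩
      · exact add_mem (cns_mem_fam.1 hf).1 hv0
      · have := sub_mem hf'.1 h2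
        change D.d (y + _) ∈ B j
        convert this using 1
        rw [map_add]
        abel
      · refine mem_Bd.2 ⟨D.cns (0, -v), cns_mem_fam.2 ⟨zero_mem _, neg_mem hv⟩, ?_⟩
        rw [add_sub_cancel_right]
        exact cns_mem_fam.2 ⟨zero_mem _, h1⟩
      · rw [phiD_cns, LinearMap.comp_apply, LinearMap.inl_apply, ← map_add, ← map_add]
        simp
    refine (relLen_mono _ h).trans ?_
    rw [relLen_sup_right le_rfl]
    refine relLen_map_le _ ?_
    intro x hx
    obtain ⟨y, hy, hxy⟩ := mem_Bd.1 hx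
    refine mem_Bd.2 ⟨D.cns (y, 0), cns_mem_fam.2 ⟨hy, zero_mem _⟩, ?_⟩
    change D.cns (x, 0) - D.phiD g ε (D.cns (y, 0)) ∈ D.fam B (j + 1)
    rw [phiD_cns, ← map_sub]
    exact cns_mem_fam.2 ⟨by simpa using hxy, by simp⟩

variable (D A B) in
theorem H_le_phi (hA : D.IsSub A) (hB : D.IsSub B) (g : G) (ε j : ℕ) :
    D.H A B j ≤ (D.phi g ε).H (D.fam A) (D.fam B) j +
      (D.phi g (ε + 1)).H (D.fam A) (D.fam B) j := by
  refine (relLen_le_add _ _ (((D.phi g ε).Bd (D.fam A) (D.fam B) j).comap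
    (D.cns ∘ₗ LinearMap.inl k _ _))).trans (add_le_add ?_ ?_)
  · rw [← relLen_map]
    refine relLen_mono _ ?_
    rintro _ ⟨z, ⟨hz, hz'⟩, rfl⟩
    refine ⟨cns_mem_fam.2 ⟨hz, zero_mem _⟩, ?_⟩
    change D.phiD g ε (D.cns (z, 0)) ∈ D.fam B (j - 1)
    rw [phiD_cns]
    exact cns_mem_fam.2 ⟨by simpa using hz', by simp⟩
  · have h : D.Z A B j ⊓ ((D.phi g ε).Bd (D.fam A) (D.fam B) j).comap
        (D.cns ∘ₗ LinearMap.inl k _ _) ≤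
        ((D.phi g (ε + 1)).Z (D.fam A) (D.fam B) j).map (D.th g (1 + ε) ∘ₗ LinearMap.proj 0) ⊔
          D.Bd A B j := by
      rintro z ⟨_, hz⟩
      obtain ⟨u, hu, h⟩ := mem_Bd.1 hz
      obtain ⟨y, q, rfl⟩ := exists_cns u
      replace h : D.cns (z, 0) - D.phiD g ε (D.cns (y, q)) ∈ D.fam B j := h
      rw [phiD_cns, ← map_sub, Prod.mk_sub_mk, cns_mem_fam] at h
      rw [cns_mem_fam] at hu
      refine Submodule.mem_sup.2 ⟨_, ⟨q, ⟨hu.2, ?_⟩, rfl⟩, _, mem_Bd.2 ⟨y, hu.1, ?_⟩,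
        add_sub_cancel _ _⟩
      · simpa using h.2
      · convert h.1 using 1
        simp
        abel
    refine (relLen_mono _ h).trans ?_
    rw [relLen_sup_right le_rfl]
    refine relLen_map_le _ ?_
    intro q hq
    obtain ⟨v, hv, _, h⟩ := th_mem_of_mem_Bd hB hq
    exact mem_Bd.2 ⟨_, hA.th_mem g (1 + ε) (mem_fam.1 hv 0), h⟩

/-- Partial sums. -/
def psum (b : ℕ → ℕ∞) (j : ℕ) : ℕ∞ := ∑ i ∈ Finset.range (j + 1), b i

theorem psum_mono {b c : ℕ → ℕ∞} (h : b ≤ c) : psum b ≤ psum c := fun _ =>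
  Finset.sum_le_sum fun i _ => h i

variable (A B) in
theorem H_phi_le_psum (hA : D.IsSub A) (hB : D.IsSub B) (g : G) (ε j : ℕ) :
    (D.phi g ε).H (D.fam A) (D.fam B) j ≤ psum (D.H A B) j := by
  induction j generalizing ε with
  | zero => rw [H_zero (hA.phi g ε)]; exact zero_le
  | succ j ih =>
    refine (H_phi_le D A B hA hB g ε j).trans ?_
    rw [psum, Finset.sum_range_succ, add_comm]
    gcongr
    exact ih _

/-- Iterated equivariant homology with respect to a list of group elements. -/
noncomputable def HPhi : List G → ∀ (D : Amb.{u} k p G) (_ _ : ℕ → Submodule k D.V), ℕ → ℕ∞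
  | [], D, A, B => D.H A B
  | g :: l, D, A, B => HPhi l (D.phi g 0) (D.fam A) (D.fam B)

theorem HPhi_le (l : List G) (hA : D.IsSub A) (hB : D.IsSub B) {b : ℕ → ℕ∞}
    (h : D.H A B ≤ b) : HPhi l D A B ≤ psum^[l.length] b := by
  induction l generalizing D b with
  | nil => exact h
  | cons g l ih =>
    rw [List.length_cons, Function.iterate_succ_apply]
    refine ih (hA.phi g 0) (hB.phi g 0) fun j => ?_
    exact (H_phi_le_psum A B hA hB g 0 j).trans (psum_mono h j)

theorem HPhi_triple_mid (l : List G) (hBA : B ≤ A) (hCB : C ≤ B) (j : ℕ) :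
    HPhi l D A C j ≤ HPhi l D A B j + HPhi l D B C j := by
  induction l generalizing D with
  | nil => exact H_triple_mid hBA hCB j
  | cons g l ih => exact ih (fam_mono hBA) (fam_mono hCB)

theorem HPhi_triple_quot (l : List G) (hBA : B ≤ A) (hCB : C ≤ B) (j : ℕ) :
    HPhi l D A B (j + 1) ≤ HPhi l D A C (j + 1) + HPhi l D B C j := by
  induction l generalizing D with
  | nil => exact H_triple_quot hBA hCB j
  | cons g l ih => exact ih (fam_mono hBA) (fam_mono hCB)

theorem HPhi_triple_sub (l : List G) (hBA : B ≤ A) (hCB : C ≤ B) (j : ℕ) :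
    HPhi l D B C j ≤ HPhi l D A C j + HPhi l D A B (j + 1) := by
  induction l generalizing D with
  | nil => exact H_triple_sub hBA hCB j
  | cons g l ih => exact ih (fam_mono hBA) (fam_mono hCB)

theorem psum_zero (j : ℕ) : psum 0 j = 0 := by simp [psum]

theorem HPhi_eq_zero (l : List G) (hA : D.IsSub A) (hB : D.IsSub B)
    (h : ∀ j, D.H A B j = 0) (j : ℕ) : HPhi l D A B j = 0 := by
  have h0 : psum^[l.length] 0 = 0 := Function.iterate_fixed (funext psum_zero) _
  have := HPhi_le l hA hB (b := 0) (fun j => (h j).le) j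
  rw [h0] at this
  exact le_zero_iff.1 this

theorem HPhi_le_of_hom (l : List G) {D' : Amb.{u} k p G} (f : D.V →ₗ[k] D'.V)
    (hd : ∀ x, f (D.d x) = D'.d (f x)) (hρ : ∀ g x, f (D.ρ g x) = D'.ρ g (f x))
    {A' B' : ℕ → Submodule k D'.V} (hB' : D'.IsSub B')
    (hAs : D.IsSub A) (hA : ∀ j, ∀ x ∈ A j, f x ∈ A' j)
    (hB : ∀ j, ∀ x ∈ A j, f x ∈ B' j ↔ x ∈ B j)
    (hs : ∀ j, ∀ x ∈ A' j, ∃ y ∈ A j, x - f y ∈ B' j) (j : ℕ) :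
    HPhi l D A B j ≤ HPhi l D' A' B' j := by
  induction l generalizing D D' with
  | nil => exact H_le_of_hom f hd hB' hA hB (fun j x => hAs.d_mem') hs j
  | cons g l ih =>
    have hnm : ∀ x, f (D.nm g x) = D'.nm g (f x) := by
      intro x; simp only [nm_apply, map_sum, hρ]
    have hth : ∀ n x, f (D.th g n x) = D'.th g n (f x) := by
      intro n x
      unfold th
      split_ifs
      · exact hnm x
      · simp [hρ]
    refine ih (D := D.phi g 0) (D' := D'.phi g 0) (f.compLeft ℕ) ?_ ?_ (hB'.phi g 0) (hAs.phi g 0)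
      ?_ ?_ ?_
    · intro x
      ext a
      simp [hd, hth]
    · intro h x
      ext a
      simp [hρ]
    · exact fun j x hx => mem_fam.2 fun a => hA _ _ (mem_fam.1 hx a)
    · intro j x hx
      change _ ∈ D'.fam B' j ↔ x ∈ D.fam B j
      rw [mem_fam, mem_fam]
      exact forall_congr' fun a => hB _ _ (mem_fam.1 hx a)
    · intro j x hx
      choose y hy hxy using fun a => hs _ _ (mem_fam.1 hx a)
      exact ⟨y, mem_fam.2 hy, mem_fam.2 hxy⟩

end Amb

end MannSu

namespace MannSu

universe u v w

variable {k : Type v} [Field k] {p : ℕ} {G : Type w} [CommGroup G]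

/-- The sequence concentrated at `i`. -/
def dlt (i j : ℕ) : ℕ∞ := if j = i then 1 else 0

theorem psum_succ (b : ℕ → ℕ∞) (j : ℕ) : Amb.psum b (j + 1) = Amb.psum b j + b (j + 1) :=
  Finset.sum_range_succ _ _

theorem iterate_psum_dlt_of_lt (r : ℕ) {i j : ℕ} (h : j < i) : Amb.psum^[r] (dlt i) j = 0 := by
  induction r generalizing j with
  | zero => simp [dlt, h.ne]
  | succ r ih =>
    rw [Function.iterate_succ_apply']
    exact Finset.sum_eq_zero fun x hx => ih (by simp at hx; omega)

theorem psum_eq_of_vanish {b : ℕ → ℕ∞} {i : ℕ} (h : ∀ j < i, b j = 0) : Amb.psum b i = b i := by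
  rw [Amb.psum, Finset.sum_range_succ, Finset.sum_eq_zero fun j hj => h j (by simpa using hj),
    zero_add]

theorem iterate_psum_dlt (r i a : ℕ) :
    Amb.psum^[r + 1] (dlt i) (i + a) = ((a + r).choose r : ℕ) := by
  induction r generalizing a with
  | zero =>
    induction a with
    | zero => 
      rw [Function.iterate_one, add_zero, psum_eq_of_vanish fun j hj => by simp [dlt, hj.ne]]
      simp [dlt]
    | succ a ih =>
      rw [Function.iterate_one] at ih ⊢
      rw [← add_assoc, psum_succ, ih]
      simp [dlt, add_assoc]
  | succ r ihr =>
    rw [Function.iterate_succ_apply']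
    induction a with
    | zero =>
      rw [add_zero, psum_eq_of_vanish fun j hj => iterate_psum_dlt_of_lt _ hj]
      have := ihr 0
      rw [add_zero] at this
      rw [this]; simp
    | succ a ih =>
      rw [← add_assoc, psum_succ, ih, add_assoc i a 1, ihr]
      rw [show a + 1 + (r + 1) = a + (r + 1) + 1 by omega, Nat.choose_succ_succ (a + (r + 1)) r,
        add_comm (Nat.choose _ r), show a + 1 + r = a + (r + 1) by omega]
      push_cast
      rfl

theorem iterate_psum_mul (r : ℕ) (c : ℕ∞) (b : ℕ → ℕ∞) (j : ℕ) :
    Amb.psum^[r] (fun j => c * b j) j = c * Amb.psum^[r] b j := by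
  induction r generalizing b with
  | zero => rfl
  | succ r ih =>
    rw [Function.iterate_succ_apply, Function.iterate_succ_apply, ← ih]
    have h : Amb.psum (fun j => c * b j) = fun j => c * Amb.psum b j :=
      funext fun j => (Finset.mul_sum _ _ _).symm
    rw [h]

namespace Amb

variable {D : Amb.{u} k p G} {A B C : ℕ → Submodule k D.V}

theorem nm_mem_of_sub_mem (hk : (p : k) = 0) {B : Submodule k D.V} {g : G} {x : D.V}
    (hB : ∀ x ∈ B, D.ρ g x ∈ B) (h : D.ρ g x - x ∈ B) : D.nm g x ∈ B := by
  have h1 : ∀ i : ℕ, D.ρ (g ^ i) x - x ∈ B := by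
    intro i
    induction i with
    | zero => simp
    | succ i ih =>
      have := add_mem (hB _ ih) h
      rw [pow_succ', map_mul, Module.End.mul_apply]
      simpa using this
  rw [nm_apply]
  have h2 : ∑ i ∈ Finset.range p, D.ρ (g ^ i) x =
      ∑ i ∈ Finset.range p, (D.ρ (g ^ i) x - x) := by
    rw [Finset.sum_sub_distrib, Finset.sum_const, Finset.card_range, ← Nat.cast_smul_eq_nsmul k, hk]
    simp
  rw [h2]
  exact sum_mem fun i _ => h1 i

/-- Lower bound for the equivariant homology of a trivial module with zero differential. -/
theorem iterate_psum_le_HPhi (hk : (p : k) = 0) (l : List G) (hA : D.IsSub A) (hB : D.IsSub B)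
    (hd : ∀ j, ∀ x ∈ A (j + 1), D.d x ∈ B j)
    (hρ : ∀ j, ∀ x ∈ A j, ∀ g ∈ l, D.ρ g x - x ∈ B j) {c : ℕ → ℕ∞}
    (hc : ∀ j, c j ≤ relLen (A j) (B j)) (j : ℕ) :
    psum^[l.length] c j ≤ HPhi l D A B j := by
  induction l generalizing D c with
  | nil =>
    refine (hc j).trans ?_
    have h1 : A j ≤ D.Z A B j := by
      intro x hx
      refine ⟨hx, ?_⟩
      cases j with
      | zero => 
        rw [hA.zero, Submodule.mem_bot] at hx
        simp [hx]
      | succ j => exact hd _ _ hx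
    have h2 : D.Bd A B j ≤ B j := by
      refine sup_le le_rfl ?_
      rintro _ ⟨x, hx, rfl⟩
      exact hd _ _ hx
    exact (relLen_mono _ h1).trans (relLen_anti _ h2)
  | cons g l ih =>
    have hth : ∀ n j, ∀ x ∈ A j, D.th g n x ∈ B j := by
      intro n j x hx
      have := hρ j x hx g (by simp)
      unfold th
      split_ifs
      · exact nm_mem_of_sub_mem hk (fun x hx => hB.ρ_mem g hx) this
      · exact this
    rw [List.length_cons, Function.iterate_succ_apply]
    refine ih (hA.phi g 0) (hB.phi g 0) ?_ ?_ ?_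
    · intro j f hf
      change D.phiD g 0 f ∈ D.fam B j
      refine mem_fam.2 fun a => ?_
      rw [phiD_apply]
      refine add_mem (Submodule.smul_mem _ _ ?_) ?_
      · have h1 := mem_fam.1 hf a
        rcases le_or_gt a j with h | h
        · rw [show j + 1 - a = j - a + 1 by omega] at h1
          exact hd _ _ h1
        · rw [show j + 1 - a = 0 by omega, hA.zero, Submodule.mem_bot] at h1
          simp [h1]
      · have h1 := mem_fam.1 hf (a + 1)
        rw [show j + 1 - (a + 1) = j - a by omega] at h1
        exact hth _ _ _ h1
    · intro j f hf h hh
      change D.phiρ h f - f ∈ D.fam B j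
      exact mem_fam.2 fun a => hρ _ _ (mem_fam.1 hf a) h (by simp [hh])
    · intro j
      change psum c j ≤ relLen (D.fam A j) (D.fam B j)
      induction j with
      | zero =>
        have := hc 0
        rw [hA.zero, relLen_eq_zero bot_le] at this
        simp [psum, le_zero_iff.1 this]
      | succ j ihj =>
        rw [psum_succ, add_comm]
        have h : ∀ A : ℕ → Submodule k D.V,
            (D.fam A (j + 1)).comap D.cns = (A (j + 1)).prod (D.fam A j) := by
          intro A
          ext ⟨y, q⟩
          exact cns_mem_fam
        have hs : ((A (j + 1)).prod (D.fam A j)).map D.cns = D.fam A (j + 1) := by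
          rw [← h, Submodule.map_comap_eq_of_surjective]
          intro f
          obtain ⟨y, q, h⟩ := exists_cns f
          exact ⟨_, h⟩
        rw [← hs, relLen_map, h, relLen_prod]
        exact add_le_add (hc _) ihj

variable (D) in
/-- `E + Σ (g - 1) Z`, the sum being over the list. -/
def aug (E Z : Submodule k D.V) : List G → Submodule k D.V
  | [] => E
  | g :: l => aug E Z l ⊔ Z.map (D.ρ g - 1)

theorem le_aug (E Z : Submodule k D.V) (l : List G) : E ≤ D.aug E Z l := by
  induction l with
  | nil => exact le_rfl
  | cons g l ih => exact ih.trans le_sup_left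

theorem sub_mem_aug (E Z : Submodule k D.V) (l : List G) {g : G} (hg : g ∈ l) {x : D.V}
    (hx : x ∈ Z) : D.ρ g x - x ∈ D.aug E Z l := by
  induction l with
  | nil => simp at hg
  | cons h l ih =>
    rcases List.mem_cons.1 hg with rfl | hg
    · exact le_sup_right (a := D.aug E Z l) ⟨x, hx, rfl⟩
    · exact le_sup_left (a := D.aug E Z l) (ih hg)

theorem aug_le {E Z : Submodule k D.V} (l : List G) (h : E ≤ Z)
    (hZ : ∀ g, ∀ x ∈ Z, D.ρ g x ∈ Z) : D.aug E Z l ≤ Z := by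
  induction l with
  | nil => exact h
  | cons g l ih =>
    refine sup_le ih ?_
    rintro _ ⟨x, hx, rfl⟩
    exact sub_mem (hZ _ _ hx) hx

theorem ρ_mem_aug {E Z : Submodule k D.V} (l : List G) (hE : ∀ g, ∀ x ∈ E, D.ρ g x ∈ E)
    (hZ : ∀ g, ∀ x ∈ Z, D.ρ g x ∈ Z) : ∀ g, ∀ x ∈ D.aug E Z l, D.ρ g x ∈ D.aug E Z l := by
  induction l with
  | nil => exact hE
  | cons h l ih =>
    intro g x hx
    obtain ⟨y, hy, _, ⟨z, hz, rfl⟩, rfl⟩ := Submodule.mem_sup.1 hx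
    refine Submodule.mem_sup.2 ⟨_, ih g y hy, _, ⟨D.ρ g z, hZ _ _ hz, rfl⟩, ?_⟩
    simp [ρ_comm g h]

theorem le_of_le_aug (hp : p.Prime) (hk : (p : k) = 0) {E Z : Submodule k D.V} (l : List G)
    (hE : ∀ g, ∀ x ∈ E, D.ρ g x ∈ E) (hZ : ∀ g, ∀ x ∈ Z, D.ρ g x ∈ Z) (h : Z ≤ D.aug E Z l) :
    Z ≤ E := by
  induction l with
  | nil => exact h
  | cons g l ih =>
    refine ih ?_
    have h1 : ∀ m : ℕ, ∀ x ∈ Z, ∃ y ∈ Z, x - ((D.ρ g - 1) ^ m : Module.End k D.V) y ∈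
        D.aug E Z l := by
      intro m
      induction m with
      | zero => exact fun x hx => ⟨x, hx, by simp⟩
      | succ m ihm =>
        intro x hx
        obtain ⟨y, hy, hxy⟩ := ihm x hx
        obtain ⟨a, ha, _, ⟨z, hz, rfl⟩, rfl⟩ := Submodule.mem_sup.1 (h hy)
        refine ⟨z, hz, ?_⟩
        have h2 : ∀ i : ℕ, ∀ a ∈ D.aug E Z l, ((D.ρ g - 1) ^ i : Module.End k D.V) a ∈
            D.aug E Z l := by
          intro i
          induction i with
          | zero => exact fun a ha => ha
          | succ i ihi =>
            intro a ha
            rw [pow_succ]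
            exact ihi _ (sub_mem (ρ_mem_aug l hE hZ g a ha) ha)
        have := add_mem hxy (h2 m a ha)
        rw [pow_succ]
        rw [map_add] at this
        convert this using 1
        rw [Module.End.mul_apply]
        abel
    intro x hx
    obtain ⟨y, hy, hxy⟩ := h1 p x hx
    have : CharP k p := by
      refine (CharP.charP_iff_prime_eq_zero hp).2 hk
    have := Fact.mk hp
    have h3 : (D.ρ g - 1) ^ p = 0 := by
      have : CharP (Module.End k D.V) p ∨ Subsingleton (Module.End k D.V) := by
        rcases subsingleton_or_nontrivial (Module.End k D.V) with h | h
        · exact Or.inr h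
        · exact Or.inl (charP_of_injective_algebraMap (algebraMap k _).injective p)
      rcases this with h | h
      · rw [sub_pow_char_of_commute _ (Commute.one_right _), D.pow, one_pow, sub_self]
      · exact Subsingleton.elim _ _
    rwa [h3, LinearMap.zero_apply, sub_zero] at hxy

/-- A list of elements whose iterated equivariant homology is bounded is short, unless the complex
is acyclic. -/
theorem length_le_of_HPhi_vanish (hp : p.Prime) (hk : (p : k) = 0) (l : List G) (hA : D.IsSub A)
    (hB : D.IsSub B) (hBA : B ≤ A) {N b : ℕ} (hv : ∀ j > N, HPhi l D A B j = 0)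
    (hb : ∀ j, D.H A B j ≤ b) (hne : ∃ j, D.H A B j ≠ 0) : l.length ≤ b * (N + 1) := by
  classical
  obtain ⟨i, hi, hmin⟩ : ∃ i, D.H A B i ≠ 0 ∧ ∀ j < i, D.H A B j = 0 :=
    ⟨Nat.find hne, Nat.find_spec hne, fun j hj => by simpa using Nat.find_min hne hj⟩
  have hi0 : i ≠ 0 := by
    rintro rfl
    exact hi (H_zero hA)
  have hBZ : B i ≤ D.Z A B i := fun x hx => ⟨hBA _ hx, hB.d_mem' hx⟩
  have hZinv : ∀ g, ∀ x ∈ D.Z A B i, D.ρ g x ∈ D.Z A B i := by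
    rintro g x ⟨hx, hx'⟩
    refine ⟨hA.ρ_mem g hx, ?_⟩
    change D.d _ ∈ B (i - 1)
    rw [D.comm]
    exact hB.ρ_mem g hx'
  have hBdinv : ∀ g, ∀ x ∈ D.Bd A B i, D.ρ g x ∈ D.Bd A B i := by
    intro g x hx
    obtain ⟨y, hy, h⟩ := mem_Bd.1 hx
    refine mem_Bd.2 ⟨_, hA.ρ_mem g hy, ?_⟩
    rw [D.comm, ← map_sub]
    exact hB.ρ_mem g h
  have hBdZ : D.Bd A B i ≤ D.Z A B i := by
    refine sup_le hBZ ?_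
    rintro _ ⟨x, hx, rfl⟩
    exact ⟨hA.d_mem hx, by simp [D.dd]⟩
  set R := D.aug (D.Bd A B i) (D.Z A B i) l with hR
  have hRZ : R ≤ D.Z A B i := aug_le l hBdZ hZinv
  have hBdR : D.Bd A B i ≤ R := le_aug _ _ _
  -- truncation of the complex with a given submodule in the lowest degree
  let T : Submodule k D.V → ℕ → Submodule k D.V := fun Y j =>
    if j < i then B j else if j = i then Y else A j
  have Tlt : ∀ Y j, j < i → T Y j = B j := fun Y j h => by simp [T, h]
  have Ti : ∀ Y, T Y i = Y := fun Y => by simp [T]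
  have Tgt : ∀ Y j, i < j → T Y j = A j := fun Y j h => by simp [T, h.ne', h.not_gt]
  have hT : ∀ Y, D.Bd A B i ≤ Y → Y ≤ D.Z A B i → (∀ g, ∀ x ∈ Y, D.ρ g x ∈ Y) →
      D.IsSub (T Y) := by
    intro Y h1 h2 h3
    refine ⟨?_, ?_, ?_⟩
    · rw [Tlt _ _ (Nat.pos_of_ne_zero hi0), hB.zero]
    · intro j x hx
      rcases lt_trichotomy (j + 1) i with h | h | h
      · rw [Tlt _ _ h] at hx
        rw [Tlt _ _ (by omega)]
        exact hB.d_mem hx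
      · rw [h, Ti] at hx
        rw [Tlt _ _ (by omega)]
        have := (h2 hx).2
        rwa [← h] at this
      · rw [Tgt _ _ h] at hx
        rcases (Nat.lt_succ_iff.1 h).lt_or_eq with h | h
        · rw [Tgt _ _ h]; exact hA.d_mem hx
        · rw [← h, Ti]
          rw [← h] at hx
          exact h1 (le_sup_right (a := B i) ⟨x, hx, rfl⟩)
    · intro j x g hx
      rcases lt_trichotomy j i with h | h | h
      · rw [Tlt _ _ h] at hx ⊢; exact hB.ρ_mem g hx
      · subst h; rw [Ti] at hx ⊢; exact h3 g x hx
      · rw [Tgt _ _ h] at hx ⊢; exact hA.ρ_mem g hx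
  have hTmono : ∀ Y Y', Y ≤ Y' → T Y ≤ T Y' := by
    intro Y Y' h j
    simp only [T]; split_ifs <;> simp [h]
  have hTA : ∀ Y, Y ≤ D.Z A B i → T Y ≤ A := by
    intro Y h j
    simp only [T]; split_ifs with h1 h2
    · exact hBA j
    · subst h2; exact h.trans inf_le_left
    · exact le_rfl
  have hBT : ∀ Y, D.Bd A B i ≤ Y → B ≤ T Y := by
    intro Y h j
    simp only [T]; split_ifs with h1 h2
    · exact le_rfl
    · subst h2; exact le_sup_left.trans h
    · exact hBA j
  have hT1 := hT (D.Z A B i) hBdZ le_rfl hZinv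
  have hT2 := hT R hBdR hRZ (ρ_mem_aug l hBdinv hZinv)
  have hlow : psum^[l.length] (dlt i) (i + N + 1) ≤
      HPhi l D (T (D.Z A B i)) (T R) (i + N + 1) := by
    refine iterate_psum_le_HPhi hk l hT1 hT2 ?_ ?_ ?_ _
    · intro j x hx
      rcases lt_or_ge j i with h | h
      · have := hT1.d_mem hx
        rwa [Tlt _ _ h] at this ⊢
      · rw [Tgt _ _ (by omega)] at hx
        have h' : x ∈ T R (j + 1) := by rwa [Tgt _ _ (by omega)]
        exact hT2.d_mem h'
    · intro j x hx g hg
      rcases lt_trichotomy j i with h | h | h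
      · rw [Tlt _ _ h] at hx ⊢; exact sub_mem (hB.ρ_mem g hx) hx
      · subst h; rw [Ti] at hx ⊢; exact sub_mem_aug _ _ l hg hx
      · rw [Tgt _ _ h] at hx ⊢; exact sub_mem (hA.ρ_mem g hx) hx
    · intro j
      by_cases h : j = i
      · subst h
        rw [Ti, Ti, dlt, if_pos rfl, Order.one_le_iff_pos, pos_iff_ne_zero, ne_eq,
          relLen_eq_zero_iff]
        intro h
        exact hi (relLen_eq_zero (le_of_le_aug hp hk l hBdinv hZinv h))
      · simp [dlt, h]
  have hquo : ∀ j, D.H A (T (D.Z A B i)) j = 0 := by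
    intro j
    rcases lt_trichotomy j i with h | h | h
    · rw [← hmin j h]
      unfold H Z Bd
      rw [Tlt _ _ h, Tlt _ _ (by omega)]
    · refine relLen_eq_zero ?_
      refine le_trans ?_ le_sup_left
      subst h
      rw [Ti, Z, Tlt _ _ (by omega)]
      exact le_rfl
    · refine relLen_eq_zero ?_
      refine le_trans ?_ le_sup_left
      rw [Tgt _ _ h]
      exact inf_le_left
  have h1 : HPhi l D (T (D.Z A B i)) B (i + N + 1) = 0 := by
    refine le_zero_iff.1 ((HPhi_triple_sub l (hTA _ le_rfl) (hBT _ hBdZ) _).trans ?_)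
    rw [hv _ (by omega), HPhi_eq_zero l hA hT1 hquo, add_zero]
  have h2 : HPhi l D (T R) B (i + N) ≤ b * psum^[l.length + 1] (dlt i) (i + N) := by
    rw [Function.iterate_succ_apply, ← iterate_psum_mul]
    refine HPhi_le l hT2 hB ?_ _
    intro j
    rcases lt_or_ge j i with h | h
    · refine (relLen_eq_zero ?_).le.trans zero_le
      refine le_trans ?_ le_sup_left
      rw [← Tlt R j h]
      exact inf_le_left
    · have h3 : psum (dlt i) j = 1 := by
        obtain ⟨a, rfl⟩ := Nat.exists_eq_add_of_le h
        simpa using iterate_psum_dlt 0 i a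
      beta_reduce
      rw [h3, mul_one]
      refine le_trans ?_ (hb j)
      unfold H Z Bd
      rw [Tgt _ _ (by omega : i < j + 1)]
      exact relLen_mono _ (inf_le_inf_right _ (hTA _ hRZ j))
  have h3 := hlow.trans ((HPhi_triple_quot l (hTmono _ _ hRZ) (hBT _ hBdR) _).trans
    (add_le_add h1.le h2))
  rcases hl : l.length with _ | r
  · exact Nat.zero_le _
  · rw [hl, zero_add, add_assoc, iterate_psum_dlt, iterate_psum_dlt] at h3
    have h4 : (N + 1 + r).choose r ≤ b * (N + (r + 1)).choose (r + 1) := by exact_mod_cast h3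
    rw [show N + (r + 1) = N + 1 + r by omega] at h4
    have h5 := Nat.choose_succ_right_eq (N + 1 + r) r
    rw [show N + 1 + r - r = N + 1 by omega] at h5
    have h6 : 0 < (N + 1 + r).choose r := Nat.choose_pos (by omega)
    have h7 := Nat.mul_le_mul_right (r + 1) h4
    rw [mul_assoc, h5, mul_left_comm] at h7
    exact Nat.le_of_mul_le_mul_left (by linarith) h6

end Amb

end MannSu

namespace MannSu

universe u v w

variable {k : Type v} [Field k] {p : ℕ} {G : Type w} [CommGroup G]

namespace Amb

variable {D : Amb.{u} k p G} {A B C K O : ℕ → Submodule k D.V}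

theorem ρ_th_nm (g : G) (x : D.V) : D.nm g (D.ρ g x - x) = 0 := by
  have := LinearMap.congr_fun (D.nm_mul_sub g) x
  simpa using this

theorem ρ_nm_self (g : G) (x : D.V) : D.ρ g (D.nm g x) = D.nm g x := by
  have := LinearMap.congr_fun (D.sub_mul_nm g) x
  simpa [sub_eq_zero] using this

/-- One step of the computation of the iterated equivariant homology of a free action. -/
theorem HPhi_free_step (l : List G) (g : G) {A' A'' : ℕ → Submodule k D.V} (hA' : D.IsSub A')
    (hB : D.IsSub B) (hBA : B ≤ A')
    (h1 : ∀ j, ∀ x ∈ A' j, D.nm g x ∈ A'' j)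
    (h2 : ∀ j, ∀ x ∈ A'' j, ∃ y ∈ A' j, x - D.nm g y ∈ B j)
    (h3 : ∀ j, ∀ x ∈ A' j, D.ρ g x - x ∈ B j → ∃ y ∈ A' j, x - D.nm g y ∈ B j)
    (h4 : ∀ j, ∀ x ∈ A' j, D.nm g x ∈ B j → ∃ y ∈ A' j, x - (D.ρ g y - y) ∈ B j) (j : ℕ) :
    HPhi (g :: l) D A' B j ≤ HPhi l D A'' B j := by
  let π : (ℕ → D.V) →ₗ[k] D.V := D.nm g ∘ₗ LinearMap.proj 0
  have hπ : ∀ f, π f = D.nm g (f 0) := fun _ => rfl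
  have hπd : ∀ f, π (D.phiD g 0 f) = D.d (π f) := by
    intro f
    simp only [hπ, phiD_apply, pow_zero, one_smul, map_add, d_nm]
    simp [th, ρ_th_nm]
  have hπρ : ∀ h f, π (D.phiρ h f) = D.ρ h (π f) := by
    intro h f
    simp [hπ, ρ_nm]
  let K : ℕ → Submodule k (ℕ → D.V) := fun j => D.fam A' j ⊓ (B j).comap π
  have memK : ∀ {j f}, f ∈ K j ↔ f ∈ D.fam A' j ∧ π f ∈ B j := Iff.rfl
  have hK : (D.phi g 0).IsSub K := by
    refine ⟨?_, ?_, ?_⟩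
    · rw [eq_bot_iff, ← (hA'.phi g 0).zero]
      exact inf_le_left
    · rintro j f ⟨hf, hf'⟩
      refine ⟨(hA'.phi g 0).d_mem hf, ?_⟩
      change π (D.phiD g 0 f) ∈ B j
      rw [hπd]
      exact hB.d_mem hf'
    · rintro j f h ⟨hf, hf'⟩
      refine ⟨(hA'.phi g 0).ρ_mem h hf, ?_⟩
      change π (D.phiρ h f) ∈ B j
      rw [hπρ]
      exact hB.ρ_mem h hf'
  have hKA : K ≤ D.fam A' := fun j => inf_le_left
  have hBK : D.fam B ≤ K := by
    intro j f hf
    refine ⟨fam_mono hBA _ hf, ?_⟩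
    exact nm_mem g (fun g x hx => hB.ρ_mem g hx) (mem_fam.1 hf 0)
  have hrow : ∀ n j, ∀ x ∈ A' j, D.th g n x ∈ B j → ∃ y ∈ A' j, x - D.th g (n + 1) y ∈ B j := by
    intro n j x hx h
    unfold th at h ⊢
    by_cases hn : Even n
    · rw [if_pos hn] at h
      rw [if_neg (by simpa [Nat.even_add_one] using hn)]
      exact h4 j x hx h
    · rw [if_neg hn] at h
      rw [if_pos (by simpa [Nat.even_add_one] using hn)]
      exact h3 j x hx h
  have hacyc : ∀ j, (D.phi g 0).H K (D.fam B) j = 0 := by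
    intro j
    rw [H_eq_zero_iff]
    intro f hf hf'
    have key : ∀ m, ∃ u ∈ K (j + 1), ∀ a < m, (f - D.phiD g 0 u) a ∈ B (j - a) := by
      intro m
      induction m with
      | zero => exact ⟨0, zero_mem _, by simp⟩
      | succ m ih =>
        obtain ⟨u, hu, hua⟩ := ih
        set f' := f - D.phiD g 0 u with hf'_def
        have hfK : f' ∈ K j := sub_mem hf (hK.d_mem hu)
        have hdf : D.phiD g 0 f' ∈ D.fam B (j - 1) := by
          rw [hf'_def, map_sub]
          have : D.phiD g 0 (D.phiD g 0 u) = 0 := (D.phi g 0).dd u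
          rw [this, sub_zero]
          exact hf'
        have hth : D.th g m (f' m) ∈ B (j - m) := by
          cases m with
          | zero =>
            have := (memK.1 hfK).2
            rw [hπ] at this
            simpa [th] using this
          | succ m =>
            have h5 := mem_fam.1 hdf m
            rw [phiD_apply, add_zero, show j - 1 - m = j - (m + 1) by omega] at h5
            refine (Submodule.add_mem_iff_right _ (Submodule.smul_mem _ _ ?_)).1 h5
            have := hB.d_mem' (hua m (by omega))
            rwa [show j - m - 1 = j - (m + 1) by omega] at this
        obtain ⟨y, hy, hxy⟩ := hrow _ _ _ (mem_fam.1 (memK.1 hfK).1 m) hth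
        refine ⟨u + Pi.single (m + 1) y, add_mem hu (memK.2 ⟨mem_fam.2 fun a => ?_, ?_⟩), ?_⟩
        · by_cases h : a = m + 1
          · subst h
            rw [Pi.single_eq_same, show j + 1 - (m + 1) = j - m by omega]
            exact hy
          · rw [Pi.single_eq_of_ne h]; exact zero_mem _
        · rw [hπ, Pi.single_eq_of_ne (by omega)]
          simp
        · intro a ha
          rw [map_add, ← sub_sub, ← hf'_def, Pi.sub_apply, phiD_apply]
          rcases Nat.lt_succ_iff_lt_or_eq.1 ha with h | rfl
          · rw [Pi.single_eq_of_ne (by omega), Pi.single_eq_of_ne (by omega)]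
            simpa using hua a h
          · rw [Pi.single_eq_of_ne (by omega), Pi.single_eq_same]
            simpa using hxy
    obtain ⟨u, hu, hua⟩ := key j
    refine ⟨u, hu, ?_⟩
    change f - D.phiD g 0 u ∈ D.fam B j
    refine mem_fam.2 fun a => ?_
    rcases lt_or_ge a j with h | h
    · exact hua a h
    · have h6 : f - D.phiD g 0 u ∈ K j := sub_mem hf (hK.d_mem hu)
      have := mem_fam.1 (memK.1 h6).1 a
      rw [show j - a = 0 by omega, hA'.zero, Submodule.mem_bot] at this
      rw [this]
      exact zero_mem _
  refine (HPhi_triple_mid (D := D.phi g 0) l hKA hBK j).trans ?_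
  rw [HPhi_eq_zero (D := D.phi g 0) l hK (hB.phi g 0) hacyc, add_zero]
  refine HPhi_le_of_hom (D := D.phi g 0) l π hπd hπρ hB (hA'.phi g 0) ?_ ?_ ?_ j
  · intro j f hf
    exact h1 _ _ (mem_fam.1 hf 0)
  · intro j f hf
    exact ⟨fun h => ⟨hf, h⟩, fun h => h.2⟩
  · intro j x hx
    obtain ⟨y, hy, hxy⟩ := h2 j x hx
    refine ⟨Pi.single 0 y, mem_fam.2 fun a => ?_, ?_⟩
    · by_cases h : a = 0
      · subst h; simpa using hy
      · rw [Pi.single_eq_of_ne h]; exact zero_mem _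
    · rw [hπ, Pi.single_eq_same]; exact hxy

variable (D) in
/-- Elements of `A` whose class modulo `B` is fixed by `H`. -/
def fx (A B : ℕ → Submodule k D.V) (H : Subgroup G) (j : ℕ) : Submodule k D.V :=
  A j ⊓ ⨅ h : H, (B j).comap (D.ρ h - 1)

theorem mem_fx {H : Subgroup G} {j : ℕ} {x : D.V} :
    x ∈ D.fx A B H j ↔ x ∈ A j ∧ ∀ h ∈ H, D.ρ h x - x ∈ B j := by
  simp [fx, Submodule.mem_iInf]

theorem le_fx (hBA : B ≤ A) (hB : D.IsSub B) (H : Subgroup G) : B ≤ D.fx A B H := fun _ _ hx =>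
  mem_fx.2 ⟨hBA _ hx, fun h _ => sub_mem (hB.ρ_mem h hx) hx⟩

theorem IsSub.fx (hA : D.IsSub A) (hB : D.IsSub B) (H : Subgroup G) : D.IsSub (D.fx A B H) where
  zero := by
    rw [eq_bot_iff, ← hA.zero]
    exact inf_le_left
  d_mem hx := by
    rw [mem_fx] at hx ⊢
    refine ⟨hA.d_mem hx.1, fun h hh => ?_⟩
    rw [← D.comm, ← map_sub]
    exact hB.d_mem (hx.2 h hh)
  ρ_mem g hx := by
    rw [mem_fx] at hx ⊢
    refine ⟨hA.ρ_mem g hx.1, fun h hh => ?_⟩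
    rw [ρ_comm, ← map_sub]
    exact hB.ρ_mem g (hx.2 h hh)

theorem mem_fx_sup_zpowers (hB : D.IsSub B) {H : Subgroup G} {g : G} {j : ℕ} {x : D.V} :
    x ∈ D.fx A B (H ⊔ Subgroup.zpowers g) j ↔ x ∈ D.fx A B H j ∧ D.ρ g x - x ∈ B j := by
  have hmul : ∀ a b : G, D.ρ a x - x ∈ B j → D.ρ b x - x ∈ B j → D.ρ (a * b) x - x ∈ B j := by
    intro a b ha hb
    have := add_mem (hB.ρ_mem a hb) ha
    simpa using this
  let S : Subgroup G :=
    { carrier := {h | D.ρ h x - x ∈ B j}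
      mul_mem' := fun ha hb => hmul _ _ ha hb
      one_mem' := by simp
      inv_mem' := by
        intro h hh
        have := neg_mem (hB.ρ_mem h⁻¹ hh)
        rw [map_sub, ← Module.End.mul_apply, ← map_mul, inv_mul_cancel] at this
        simpa using this }
  rw [mem_fx, mem_fx, and_assoc]
  refine and_congr_right fun _ => ?_
  have e : ∀ H : Subgroup G, (∀ h ∈ H, D.ρ h x - x ∈ B j) ↔ H ≤ S := fun H => Iff.rfl
  rw [e, e, sup_le_iff, Subgroup.zpowers_le]
  rfl

/-- Independence of a list of group elements modulo a subgroup. -/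
def Indep (H : Subgroup G) : List G → Prop
  | [] => True
  | g :: l => g ∉ H ∧ Indep (H ⊔ Subgroup.zpowers g) l

/-- `e` is a decomposition of the identity on `A / B`, free with respect to `g`, commuting with
`H`. -/
structure FreeOp (D : Amb.{u} k p G) (A B : ℕ → Submodule k D.V) (H : Subgroup G) (g : G)
    (e : D.V →ₗ[k] D.V) : Prop where
  mem_A : ∀ j, ∀ x ∈ A j, e x ∈ A j
  mem_B : ∀ j, ∀ x ∈ B j, e x ∈ B j
  comm : ∀ h ∈ H, ∀ x, D.ρ h (e x) = e (D.ρ h x)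
  sum : ∀ j, ∀ x ∈ A j, ∑ i ∈ Finset.range p, D.ρ (g ^ i) (e (D.ρ (g ^ i)⁻¹ x)) - x ∈ B j

theorem FreeOp.mem_fx {H : Subgroup G} {g : G} {e : D.V →ₗ[k] D.V} (he : FreeOp D A B H g e)
    {j : ℕ} {x : D.V} (hx : x ∈ D.fx A B H j) : e x ∈ D.fx A B H j := by
  rw [Amb.mem_fx] at hx ⊢
  refine ⟨he.mem_A _ _ hx.1, fun h hh => ?_⟩
  rw [he.comm h hh, ← map_sub]
  exact he.mem_B _ _ (hx.2 h hh)

theorem HPhi_cons_le_fx (hp : p ≠ 0) (l : List G) (hA : D.IsSub A) (hB : D.IsSub B) (hBA : B ≤ A)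
    {H : Subgroup G} {g : G} {e : D.V →ₗ[k] D.V} (he : FreeOp D A B H g e) (j : ℕ) :
    HPhi (g :: l) D (D.fx A B H) B j ≤ HPhi l D (D.fx A B (H ⊔ Subgroup.zpowers g)) B j := by
  have hBinv : ∀ j g, ∀ x ∈ B j, D.ρ g x ∈ B j := fun j g x hx => hB.ρ_mem g hx
  have hF := hA.fx hB H
  have R1 : ∀ j, ∀ x ∈ D.fx A B H j, D.ρ g x - x ∈ B j →
      ∃ y ∈ D.fx A B H j, x - D.nm g y ∈ B j := by
    intro j x hx hgx
    refine ⟨e x, he.mem_fx hx, ?_⟩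
    have hx' : x ∈ D.fx A B (H ⊔ Subgroup.zpowers g) j := (mem_fx_sup_zpowers hB).2 ⟨hx, hgx⟩
    have h1 : ∀ i ∈ Finset.range p, D.ρ (g ^ i) (e (D.ρ (g ^ i)⁻¹ x)) - D.ρ (g ^ i) (e x) ∈
        B j := by
      intro i _
      rw [← map_sub, ← map_sub]
      refine hB.ρ_mem _ (he.mem_B _ _ ?_)
      exact (Amb.mem_fx.1 hx').2 _ (Subgroup.mem_sup_right (inv_mem (pow_mem
        (Subgroup.mem_zpowers g) i)))
    have h2 := sub_mem (sum_mem h1) (he.sum j x (Amb.mem_fx.1 hx).1)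
    rw [Finset.sum_sub_distrib, ← nm_apply] at h2
    convert h2 using 1
    abel
  refine HPhi_free_step l g hF hB (le_fx hBA hB H) ?_ ?_ R1 ?_ j
  · intro j x hx
    rw [mem_fx_sup_zpowers hB, ρ_nm_self, sub_self]
    exact ⟨nm_mem g (fun g x hx => hF.ρ_mem g hx) hx, zero_mem _⟩
  · intro j x hx
    rw [mem_fx_sup_zpowers hB] at hx
    exact R1 j x hx.1 hx.2
  · intro j x hx hn
    let c : ℕ → D.V := fun i => ∑ m ∈ Finset.range i, D.ρ (g ^ (m + 1))⁻¹ x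
    have hc : ∀ i, c i ∈ D.fx A B H j := fun i => sum_mem fun m _ => hF.ρ_mem _ hx
    refine ⟨-∑ i ∈ Finset.range p, D.ρ (g ^ i) (e (c i)),
      neg_mem (sum_mem fun i _ => hF.ρ_mem _ (he.mem_fx (hc i))), ?_⟩
    obtain ⟨q, rfl⟩ := Nat.exists_eq_succ_of_ne_zero hp
    have h1 : D.ρ g (∑ i ∈ Finset.range (q + 1), D.ρ (g ^ i) (e (c i))) =
        ∑ i ∈ Finset.range q, D.ρ (g ^ (i + 1)) (e (c i)) + e (c q) := by
      rw [map_sum, Finset.sum_range_succ]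
      have h2 : ∀ i y, D.ρ g (D.ρ (g ^ i) y) = D.ρ (g ^ (i + 1)) y := by
        intro i y
        rw [← Module.End.mul_apply, ← map_mul, pow_succ']
      simp only [h2]
      have h3 : D.ρ (g ^ (q + 1)) = 1 := by rw [map_pow, D.pow]
      rw [h3, Module.End.one_apply]
    have h2 : ∑ i ∈ Finset.range (q + 1), D.ρ (g ^ i) (e (c i)) =
        ∑ i ∈ Finset.range q, D.ρ (g ^ (i + 1)) (e (c i)) +
        ∑ i ∈ Finset.range q, D.ρ (g ^ (i + 1)) (e (D.ρ (g ^ (i + 1))⁻¹ x)) := by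
      rw [Finset.sum_range_succ', ← Finset.sum_add_distrib]
      simp only [c, Finset.sum_range_zero, map_zero, add_zero, Finset.sum_range_succ, map_add]
    have h3 := he.sum j x (Amb.mem_fx.1 hx).1
    rw [Finset.sum_range_succ'] at h3
    have h4 : D.nm g x = x + c q := by
      have h5 : ∀ y, D.nm g y = D.nm g (D.ρ (g ^ q)⁻¹ y) := by
        intro y
        have : ∀ n : ℕ, ∀ z, D.nm g (D.ρ (g ^ n) z) = D.nm g z := by
          intro n
          induction n with
          | zero => simp
          | succ n ih =>
            intro z
            rw [pow_succ, map_mul, Module.End.mul_apply, ih, ← ρ_nm, ρ_nm_self]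
        have hinv : D.ρ (g ^ q) (D.ρ (g ^ q)⁻¹ y) = y := by
          rw [← Module.End.mul_apply, ← map_mul, mul_inv_cancel, map_one, Module.End.one_apply]
        conv_lhs => rw [← hinv]
        exact this q _
      rw [h5, nm_apply, ← Finset.sum_range_reflect, Finset.sum_range_succ', add_comm]
      have h6 : ∀ i ≤ q, D.ρ (g ^ (q + 1 - 1 - i)) (D.ρ (g ^ q)⁻¹ x) = D.ρ (g ^ i)⁻¹ x := by
        intro i hi
        rw [← Module.End.mul_apply, ← map_mul]
        congr 2
        rw [mul_inv_eq_iff_eq_mul, eq_inv_mul_iff_mul_eq, ← pow_add]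
        congr 1
        omega
      congr 1
      · rw [h6 0 (Nat.zero_le _)]; simp
      · refine Finset.sum_congr rfl fun i hi => h6 _ ?_
        simp at hi; omega
    have h5 : e x + e (c q) ∈ B j := by
      rw [← map_add, ← h4]
      exact he.mem_B _ _ hn
    have h7 := sub_mem h5 h3
    rw [map_neg, h1, h2]
    convert h7 using 1
    simp only [pow_zero, inv_one, map_one, Module.End.one_apply]
    abel

theorem HPhi_le_fx (hp : p ≠ 0) (l : List G) (hA : D.IsSub A) (hB : D.IsSub B) (hBA : B ≤ A)
    {H E : Subgroup G} (hH : H ≤ E) (hl : ∀ g ∈ l, g ∈ E) (hi : Indep H l)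
    (he : ∀ K ≤ E, ∀ g ∈ E, g ∉ K → ∃ e, FreeOp D A B K g e) :
    ∃ K ≤ E, ∀ j, HPhi l D (D.fx A B H) B j ≤ D.H (D.fx A B K) B j := by
  induction l generalizing H with
  | nil => exact ⟨H, hH, fun j => le_rfl⟩
  | cons g l ih =>
    obtain ⟨e, heg⟩ := he H hH g (hl g (by simp)) hi.1
    have hg : H ⊔ Subgroup.zpowers g ≤ E :=
      sup_le hH ((Subgroup.zpowers_le).2 (hl g (by simp)))
    obtain ⟨K, hK, h⟩ := ih hg (fun x hx => hl x (by simp [hx])) hi.2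
    exact ⟨K, hK, fun j => (HPhi_cons_le_fx hp l hA hB hBA heg j).trans (h j)⟩

theorem fx_bot : D.fx A B ⊥ = A := by
  ext j x
  rw [mem_fx]
  simp

end Amb

end MannSu

namespace MannSu

universe u v w

variable {k : Type v} [Field k] {p : ℕ} {G : Type w} [CommGroup G]

namespace Amb

variable {D : Amb.{u} k p G} {A B C K O : ℕ → Submodule k D.V}

variable (D) in
/-- The image of the homology of the fixed set and of the Smith special homology group in the
homology of the total space, at the level of cycles. -/
noncomputable def smithP (g : G) (C K O : ℕ → Submodule k D.V) (ε j : ℕ) : Submodule k D.V :=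
  (((D.phi g (ε + 1)).Z (D.fam C) (D.fam K) j).prod (D.Z K O j)).map
    ((D.th g (1 + ε) ∘ₗ LinearMap.proj 0).coprod LinearMap.id)

theorem smithP_le (hC : D.IsSub C) (hKC : K ≤ C) {g : G}
    (hth : ∀ n j, ∀ x ∈ K j, D.th g n x ∈ O j) (ε j : ℕ) :
    D.smithP g C K O ε j ≤ D.Z C O j := by
  rintro _ ⟨⟨q, κ⟩, ⟨⟨hq, hq'⟩, hκ⟩, rfl⟩
  replace hκ := mem_Z.1 hκ
  replace hq' := mem_fam.1 (show D.phiD g (ε + 1) q ∈ D.fam K (j - 1) from hq') 0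
  refine add_mem (mem_Z.2 ⟨hC.th_mem _ _ (mem_fam.1 hq 0), ?_⟩) (mem_Z.2 ⟨hKC _ hκ.1, hκ.2⟩)
  have h0 := hth (1 + ε) _ _ hq'
  have h1 := D.th_th g (1 + ε) (q 1)
  rw [show 1 + ε + 1 = 0 + 1 + (ε + 1) by omega] at h1
  simpa [d_th, h1] using h0

theorem smith_sub_le {g : G}
    (hth : ∀ n j, ∀ x ∈ K j, D.th g n x ∈ O j) (hOK : O ≤ K) (ε j : ℕ) :
    (D.phi g (ε + 1)).H (D.fam C) (D.fam K) j + D.H K O j ≤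
      relLen (D.smithP g C K O ε j) (D.Bd C O j) +
        (D.phi g ε).H (D.fam C) (D.fam K) (j + 1) := by
  set ψ : ((ℕ → D.V) × D.V) →ₗ[k] D.V :=
    (D.th g (1 + ε) ∘ₗ LinearMap.proj 0).coprod LinearMap.id with hψ
  set L : Submodule k ((ℕ → D.V) × D.V) :=
    ((D.phi g (ε + 1)).Z (D.fam C) (D.fam K) j).prod (D.Z K O j) with hL
  set Q : Submodule k ((ℕ → D.V) × D.V) :=
    ((D.phi g (ε + 1)).Bd (D.fam C) (D.fam K) j).prod (D.Bd K O j) with hQ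
  have h1 : relLen L Q = (D.phi g (ε + 1)).H (D.fam C) (D.fam K) j + D.H K O j :=
    relLen_prod _ _ _ _
  rw [← h1]
  refine (relLen_le_add L Q ((D.Bd C O j).comap ψ)).trans (add_le_add ?_ ?_)
  · rw [← relLen_map]
    exact le_rfl
  let π := LinearMap.fst k ((ℕ → D.V) × D.V) D.V
  let δ : (((ℕ → D.V) × D.V) × D.V) →ₗ[k] D.V := ψ.coprod (-D.d)
  let P₀ : Submodule k (((ℕ → D.V) × D.V) × D.V) := L.prod (C (j + 1)) ⊓ (O j).comap δ
  let η : (((ℕ → D.V) × D.V) × D.V) →ₗ[k] (ℕ → D.V) :=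
    D.cns ∘ₗ (-LinearMap.snd k _ _).prod (LinearMap.fst k _ _ ∘ₗ LinearMap.fst k _ _)
  have hη : ∀ q κ y, η ((q, κ), y) = D.cns (-y, q) := fun _ _ _ => rfl
  have hδ : ∀ q κ y, δ ((q, κ), y) = D.th g (1 + ε) (q 0) + κ - D.d y := by
    intro q κ y
    simp [δ, hψ, sub_eq_add_neg]
  have hsurj : L ⊓ (D.Bd C O j).comap ψ ≤ P₀.map π := by
    rintro x ⟨hx, hx'⟩
    obtain ⟨y, hy, h⟩ := mem_Bd.1 hx'
    refine ⟨(x, y), ⟨⟨hx, hy⟩, ?_⟩, rfl⟩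
    change δ (x, y) ∈ O j
    rw [← Prod.mk.eta (p := x), hδ]
    exact h
  refine (relLen_mono _ hsurj).trans ?_
  rw [relLen_map]
  refine (relLen_le_map η (R := (D.phi g ε).Bd (D.fam C) (D.fam K) (j + 1)) ?_).trans
    (relLen_mono _ ?_)
  · rintro ⟨⟨q, κ⟩, y⟩ ⟨⟨⟨⟨hq, hκ⟩, hy⟩, hδ'⟩, hη'⟩
    replace hδ' : δ ((q, κ), y) ∈ O j := hδ'
    rw [hδ] at hδ'
    replace hη' : η ((q, κ), y) ∈ (D.phi g ε).Bd (D.fam C) (D.fam K) (j + 1) := hη'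
    rw [hη] at hη'
    obtain ⟨u, hu, huη⟩ := mem_Bd.1 hη'
    obtain ⟨y', q', rfl⟩ := exists_cns u
    replace huη : D.cns (-y, q) - D.phiD g ε (D.cns (y', q')) ∈ D.fam K (j + 1) := huη
    rw [phiD_cns, ← map_sub, Prod.mk_sub_mk, cns_mem_fam, sub_neg_eq_add] at huη
    obtain ⟨hm, hq'⟩ := huη
    have hqC := (cns_mem_fam.1 hu).2
    refine ⟨mem_Bd.2 ⟨-q', neg_mem hqC, ?_⟩, mem_Bd.2 ⟨_, neg_mem hm, ?_⟩⟩
    · change q - D.phiD g (ε + 1) (-q') ∈ D.fam K j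
      rw [map_neg, sub_neg_eq_add]
      exact hq'
    · have h0 := hth (1 + ε) _ _ (mem_fam.1 hq' 0)
      have h2 := D.th_th g (1 + ε) (q' 1)
      rw [show 1 + ε + 1 = 0 + 1 + (ε + 1) by omega] at h2
      have := sub_mem hδ' h0
      simp only [Pi.add_apply, phiD_apply, map_add, pow_zero, one_smul, h2, add_zero] at this
      change κ - _ ∈ O j
      convert this using 1
      simp only [d_th, D.dd, map_neg, map_sub, map_add, zero_add]
      abel
  · rintro _ ⟨⟨⟨q, κ⟩, y⟩, ⟨⟨⟨hq, hκ⟩, hy⟩, hδ'⟩, rfl⟩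
    replace hδ' : δ ((q, κ), y) ∈ O j := hδ'
    rw [hδ] at hδ'
    rw [hη]
    refine ⟨cns_mem_fam.2 ⟨neg_mem hy, hq.1⟩, ?_⟩
    change D.phiD g ε (D.cns (-y, q)) ∈ D.fam K j
    rw [phiD_cns, cns_mem_fam]
    refine ⟨?_, neg_mem hq.2⟩
    have := sub_mem (hOK _ hδ') hκ.1
    convert this using 1
    simp
    abel

theorem smith_mid_le {g : G} (hth : ∀ n j, ∀ x ∈ K j, D.th g n x ∈ O j) (hOK : O ≤ K) (ε j : ℕ) :
    D.H C O j ≤ relLen (D.smithP g C K O ε j) (D.Bd C O j) +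
      (D.phi g ε).H (D.fam C) (D.fam K) j := by
  let η : D.V →ₗ[k] (ℕ → D.V) := D.cns ∘ₗ LinearMap.inl k _ _
  have hη : ∀ x, η x = D.cns (x, 0) := fun _ => rfl
  rw [add_comm]
  refine (relLen_le_add _ _ (((D.phi g ε).Bd (D.fam C) (D.fam K) j).comap η)).trans
    (add_le_add ?_ ?_)
  · rw [← relLen_map]
    refine relLen_mono _ ?_
    rintro _ ⟨x, ⟨hx, hx'⟩, rfl⟩
    rw [hη]
    refine ⟨cns_mem_fam.2 ⟨hx, zero_mem _⟩, ?_⟩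
    change D.phiD g ε (D.cns (x, 0)) ∈ D.fam K (j - 1)
    rw [phiD_cns, cns_mem_fam]
    simpa using hOK _ hx'
  · rw [← relLen_sup_right (P := D.smithP g C K O ε j) (P' := D.Bd C O j) le_rfl]
    refine relLen_mono _ ?_
    rintro x ⟨⟨hx, hx'⟩, hx''⟩
    replace hx' : D.d x ∈ O (j - 1) := hx'
    replace hx'' : η x ∈ (D.phi g ε).Bd (D.fam C) (D.fam K) j := hx''
    rw [hη] at hx''
    obtain ⟨u, hu, huη⟩ := mem_Bd.1 hx''
    obtain ⟨y', q', rfl⟩ := exists_cns u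
    replace huη : D.cns (x, 0) - D.phiD g ε (D.cns (y', q')) ∈ D.fam K j := huη
    rw [phiD_cns, ← map_sub, Prod.mk_sub_mk, cns_mem_fam, sub_neg_eq_add, zero_add] at huη
    obtain ⟨hy', hqC⟩ := cns_mem_fam.1 hu
    obtain ⟨hm, hq'⟩ := huη
    have hdm : D.d (x - (D.d y' + D.th g (1 + ε) (q' 0))) ∈ O (j - 1) := by
      have h0 := hth (1 + ε) _ _ (mem_fam.1 hq' 0)
      have h2 := D.th_th g (1 + ε) (q' 1)
      rw [show 1 + ε + 1 = 0 + 1 + (ε + 1) by omega] at h2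
      have := sub_mem hx' h0
      simp only [phiD_apply, map_add, h2] at this
      simpa [d_th, D.dd] using this
    have : x = (D.th g (1 + ε) (q' 0) + (x - (D.d y' + D.th g (1 + ε) (q' 0)))) + D.d y' := by
      abel
    rw [this]
    refine Submodule.add_mem_sup ⟨(q', _), ⟨⟨hqC, hq'⟩, ⟨hm, hdm⟩⟩, rfl⟩ ?_
    exact Submodule.mem_sup_right ⟨y', hy', rfl⟩

/-- If every class of the Smith special homology vanishes in the total space, so does everything. -/
theorem newman_vanish {g : G}
    (hth : ∀ n j, ∀ x ∈ K j, D.th g n x ∈ O j) (hOK : O ≤ K) {N : ℕ}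
    (hv : ∀ ε, ∀ j > N, (D.phi g ε).H (D.fam C) (D.fam K) j = 0)
    (hP : ∀ ε j, D.smithP g C K O ε j ≤ D.Bd C O j) (j : ℕ) : D.H C O j = 0 := by
  have h1 : ∀ ε j, (D.phi g (ε + 1)).H (D.fam C) (D.fam K) j ≤
      (D.phi g ε).H (D.fam C) (D.fam K) (j + 1) := fun ε j => by
    have := smith_sub_le (C := C) hth hOK ε j
    rw [relLen_eq_zero (hP ε j), zero_add] at this
    exact le_self_add.trans this
  have h2 : ∀ m ε j, (D.phi g (ε + m)).H (D.fam C) (D.fam K) j ≤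
      (D.phi g ε).H (D.fam C) (D.fam K) (j + m) := by
    intro m
    induction m with
    | zero => exact fun ε j => le_rfl
    | succ m ih =>
      intro ε j
      refine (h1 (ε + m) j).trans ?_
      have := ih ε (j + 1)
      rwa [show j + 1 + m = j + (m + 1) by omega] at this
  have h3 := smith_mid_le (C := C) hth hOK (0 + (N + 1)) j
  rw [relLen_eq_zero (hP _ j), zero_add] at h3
  have h4 := h3.trans (h2 (N + 1) 0 j)
  rw [hv 0 _ (by omega)] at h4
  exact le_antisymm h4 bot_le

theorem smith_sum_le (hC : D.IsSub C) {g : G}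
    (hth : ∀ n j, ∀ x ∈ K j, D.th g n x ∈ O j) (hOK : O ≤ K) (hKC : K ≤ C) (m ε j : ℕ) :
    (D.phi g (ε + m)).H (D.fam C) (D.fam K) j + ∑ i ∈ Finset.range m, D.H K O (j + i) ≤
      ∑ i ∈ Finset.range m, D.H C O (j + i) + (D.phi g ε).H (D.fam C) (D.fam K) (j + m) := by
  have he : ∀ ε j, relLen (D.smithP g C K O ε j) (D.Bd C O j) ≤ D.H C O j := fun ε j =>
    relLen_mono _ (smithP_le hC hKC hth ε j)
  induction m generalizing j with
  | zero => simp
  | succ m ih =>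
    have h1 := (smith_sub_le (C := C) hth hOK (ε + m) j).trans (add_le_add_left (he _ _) _)
    have h2 := ih (j + 1)
    rw [Finset.sum_range_succ', Finset.sum_range_succ']
    simp only [show ∀ i, j + 1 + i = j + (i + 1) by intro i; omega] at h2
    calc (D.phi g (ε + (m + 1))).H (D.fam C) (D.fam K) j +
          (∑ i ∈ Finset.range m, D.H K O (j + (i + 1)) + D.H K O (j + 0))
        = ((D.phi g (ε + m + 1)).H (D.fam C) (D.fam K) j + D.H K O j) +
          ∑ i ∈ Finset.range m, D.H K O (j + (i + 1)) := by
          rw [add_comm (∑ i ∈ Finset.range m, D.H K O (j + (i + 1))), add_assoc]; rfl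
      _ ≤ (D.H C O j + (D.phi g (ε + m)).H (D.fam C) (D.fam K) (j + 1)) +
          ∑ i ∈ Finset.range m, D.H K O (j + (i + 1)) := add_le_add_left h1 _
      _ = D.H C O j + ((D.phi g (ε + m)).H (D.fam C) (D.fam K) (j + 1) +
          ∑ i ∈ Finset.range m, D.H K O (j + (i + 1))) := add_assoc _ _ _
      _ ≤ D.H C O j + (∑ i ∈ Finset.range m, D.H C O (j + (i + 1)) +
          (D.phi g ε).H (D.fam C) (D.fam K) (j + (m + 1))) := add_le_add_right h2 _
      _ = _ := by rw [← add_assoc, add_comm (D.H C O j)]; rfl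

variable (D) in
/-- A weighted total Betti number. -/
noncomputable def wt (N : ℕ) (A B : ℕ → Submodule k D.V) : ℕ∞ :=
  ∑ j ∈ Finset.range N, ∑ i ∈ Finset.range N, D.H A B (j + i)

theorem smith_wt_add_le (hC : D.IsSub C) {g : G}
    (hth : ∀ n j, ∀ x ∈ K j, D.th g n x ∈ O j) (hOK : O ≤ K) (hKC : K ≤ C) {N : ℕ}
    (hv : ∀ ε, ∀ j ≥ N, (D.phi g ε).H (D.fam C) (D.fam K) j = 0) (ε : ℕ) :
    ∑ j ∈ Finset.range N, (D.phi g (ε + N)).H (D.fam C) (D.fam K) j + D.wt N K O ≤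
      D.wt N C O := by
  rw [wt, wt, ← Finset.sum_add_distrib]
  refine Finset.sum_le_sum fun j _ => ?_
  have := smith_sum_le hC hth hOK hKC N ε j
  rwa [hv ε _ (by omega), add_zero] at this

/-- The Smith inequality. -/
theorem smith_wt_le (hC : D.IsSub C) {g : G}
    (hth : ∀ n j, ∀ x ∈ K j, D.th g n x ∈ O j) (hOK : O ≤ K) (hKC : K ≤ C) {N : ℕ}
    (hv : ∀ ε, ∀ j ≥ N, (D.phi g ε).H (D.fam C) (D.fam K) j = 0) : D.wt N K O ≤ D.wt N C O :=
  le_add_self.trans (smith_wt_add_le hC hth hOK hKC hv 0)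

theorem H_eq_zero_of_smith_wt_eq (hC : D.IsSub C) (hK : D.IsSub K) {g : G}
    (hth : ∀ n j, ∀ x ∈ K j, D.th g n x ∈ O j) (hOK : O ≤ K) (hKC : K ≤ C) {N : ℕ}
    (hv : ∀ ε, ∀ j ≥ N, (D.phi g ε).H (D.fam C) (D.fam K) j = 0)
    (hfin : D.wt N C O ≠ ⊤) (hle : D.wt N C O ≤ D.wt N K O) (j : ℕ) : D.H C K j = 0 := by
  have h1 : ∀ ε j, (D.phi g (ε + N)).H (D.fam C) (D.fam K) j = 0 := by
    intro ε j
    rcases lt_or_ge j N with h | h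
    · have h2 := (smith_wt_add_le hC hth hOK hKC hv ε).trans hle
      have h3 : D.wt N K O ≠ ⊤ := ne_top_of_le_ne_top hfin (smith_wt_le hC hth hOK hKC hv)
      have h4 : ∑ j ∈ Finset.range N, (D.phi g (ε + N)).H (D.fam C) (D.fam K) j ≤ 0 := by
        refine (ENat.add_le_add_iff_right h3).1 ?_
        rwa [zero_add]
      refine le_antisymm (le_trans ?_ h4) bot_le
      exact Finset.single_le_sum
        (f := fun j => (D.phi g (ε + N)).H (D.fam C) (D.fam K) j) (fun _ _ => bot_le)
        (Finset.mem_range.2 h)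
    · exact hv _ _ h
  have h5 := H_le_phi D C K hC hK g (0 + N) j
  have h6 := h1 1 j
  rw [h1 0, show 0 + N + 1 = 1 + N by omega, h1 1 j, add_zero] at h5
  exact le_antisymm h5 bot_le

end Amb

end MannSu

namespace MannSu

open scoped Topology
open Set Filter

universe u v w

section Cochain

variable {k : Type v} [Field k] {M : Type u} {M' : Type w}

/-- The alternating sum of the values on the faces of a simplex. -/
def del : (List M → k) → List M → k
  | _, [] => 0
  | f, x :: l => f l - del (fun l' => f (x :: l')) l

@[simp] theorem del_nil (f : List M → k) : del f [] = 0 := rfl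

theorem del_cons (f : List M → k) (x : M) (l : List M) :
    del f (x :: l) = f l - del (fun l' => f (x :: l')) l := rfl

theorem del_add (f g : List M → k) (l : List M) : del (f + g) l = del f l + del g l := by
  induction l generalizing f g with
  | nil => simp
  | cons x l ih =>
    have := ih (fun l' => f (x :: l')) (fun l' => g (x :: l'))
    simp only [del_cons, Pi.add_apply] at this ⊢
    change _ - del ((fun l' => f (x :: l')) + fun l' => g (x :: l')) l = _
    rw [this]
    ring

theorem del_smul (c : k) (f : List M → k) (l : List M) : del (c • f) l = c * del f l := by
  induction l generalizing f with
  | nil => simp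
  | cons x l ih =>
    have := ih (fun l' => f (x :: l'))
    simp only [del_cons, Pi.smul_apply, smul_eq_mul] at this ⊢
    change _ - del (c • fun l' => f (x :: l')) l = _
    rw [this]
    ring

theorem del_sub (f g : List M → k) (l : List M) : del (f - g) l = del f l - del g l := by
  have := del_add (f - g) g l
  rw [sub_add_cancel] at this
  rw [this, add_sub_cancel_right]

theorem del_eq_zero {f : List M → k} {l : List M}
    (h : ∀ l' : List M, l'.length + 1 = l.length → l' ⊆ l → f l' = 0) : del f l = 0 := by
  induction l generalizing f with
  | nil => rfl
  | cons x l ih =>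
    rw [del_cons, h l rfl (List.subset_cons_self x l), ih, sub_zero]
    intro l' hl hs
    exact h _ (by simp [hl]) (List.cons_subset_cons x hs)

theorem del_del (f : List M → k) (l : List M) : del (del f) l = 0 := by
  induction l generalizing f with
  | nil => rfl
  | cons x l ih =>
    have h : (fun l' => del f (x :: l')) = f - del (fun l' => f (x :: l')) := by
      ext l'; simp [del_cons]
    rw [del_cons, h, del_sub, ih]
    ring

theorem del_map (φ : M → M') (f : List M' → k) (l : List M) :
    del (fun l => f (l.map φ)) l = del f (l.map φ) := by
  induction l generalizing f with
  | nil => rfl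
  | cons x l ih =>
    rw [List.map_cons, del_cons, del_cons, ← ih]
    simp

variable (k M) in
/-- The coboundary operator; a list of length `j + 1` is a `j`-simplex. -/
def cd : (List M → k) →ₗ[k] (List M → k) where
  toFun f l := if l.length ≤ 1 then 0 else del f l
  map_add' f g := by
    ext l
    simp only [del_add, Pi.add_apply]
    split_ifs <;> simp
  map_smul' c f := by
    ext l
    simp only [del_smul, RingHom.id_apply, Pi.smul_apply, smul_eq_mul]
    split_ifs <;> simp

theorem cd_apply (f : List M → k) (l : List M) :
    cd k M f l = if l.length ≤ 1 then 0 else del f l := rfl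

theorem cd_cd (f : List M → k) : cd k M (cd k M f) = 0 := by
  ext l
  rw [cd_apply, Pi.zero_apply, ite_eq_left_iff, not_le]
  intro hl
  rcases Nat.lt_or_ge 2 l.length with h | h
  · rw [← sub_eq_zero, ← sub_zero (_ - _), sub_zero, sub_zero, ← del_del f l, ← sub_eq_zero,
      ← del_sub]
    refine del_eq_zero fun l' hl' _ => ?_
    rw [Pi.sub_apply, cd_apply, if_neg (by omega), sub_self]
  · refine del_eq_zero fun l' hl' _ => ?_
    rw [cd_apply, if_pos (by omega)]

variable (k) in
/-- Pullback of cochains. -/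
def pull (φ : M → M') : (List M' → k) →ₗ[k] (List M → k) :=
  LinearMap.funLeft k k (List.map φ)

@[simp] theorem pull_apply (φ : M → M') (f : List M' → k) (l : List M) :
    pull k φ f l = f (l.map φ) := rfl

theorem cd_pull (φ : M → M') (f : List M' → k) :
    cd k M (pull k φ f) = pull k φ (cd k M' f) := by
  ext l
  have : pull k φ f = fun l => f (l.map φ) := rfl
  simp [cd_apply, this, del_map]

/-- Multiplication by a function of the first vertex. -/
def cut (χ : M → k) : (List M → k) →ₗ[k] (List M → k) where
  toFun f l := (l.head?.elim 1 χ) * f l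
  map_add' f g := by ext; simp [mul_add]
  map_smul' c f := by ext; simp; ring

theorem cut_apply (χ : M → k) (f : List M → k) (l : List M) :
    cut χ f l = l.head?.elim 1 χ * f l := rfl

/-- The prism operator between a self-map and the identity. -/
def prism (r : M → M) : (List M → k) → List M → k
  | _, [] => 0
  | f, x :: l => f (r x :: x :: l) - prism r (fun l' => f (r x :: l')) l

theorem prism_cons (r : M → M) (f : List M → k) (x : M) (l : List M) :
    prism r f (x :: l) = f (r x :: x :: l) - prism r (fun l' => f (r x :: l')) l := rfl

theorem prism_add (r : M → M) (f g : List M → k) (l : List M) :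
    prism r (f + g) l = prism r f l + prism r g l := by
  induction l generalizing f g with
  | nil => simp [prism]
  | cons x l ih =>
    have := ih (fun l' => f (r x :: l')) (fun l' => g (r x :: l'))
    simp only [prism_cons, Pi.add_apply] at this ⊢
    change _ - prism r ((fun l' => f (r x :: l')) + fun l' => g (r x :: l')) l = _
    rw [this]
    ring

theorem prism_smul (r : M → M) (c : k) (f : List M → k) (l : List M) :
    prism r (c • f) l = c * prism r f l := by
  induction l generalizing f with
  | nil => simp [prism]
  | cons x l ih =>
    have := ih (fun l' => f (r x :: l'))
    simp only [prism_cons, Pi.smul_apply, smul_eq_mul] at this ⊢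
    change _ - prism r (c • fun l' => f (r x :: l')) l = _
    rw [this]
    ring

theorem prism_sub (r : M → M) (f g : List M → k) (l : List M) :
    prism r (f - g) l = prism r f l - prism r g l := by
  have := prism_add r (f - g) g l
  rw [sub_add_cancel] at this
  rw [this, add_sub_cancel_right]

theorem prism_eq_zero {r : M → M} {f : List M → k} {l : List M}
    (h : ∀ l' : List M, l'.length = l.length + 1 → (∀ x ∈ l', x ∈ l ∨ ∃ y ∈ l, x = r y) →
      f l' = 0) : prism r f l = 0 := by
  induction l generalizing f with
  | nil => rfl
  | cons x l ih =>
    rw [prism_cons, h _ rfl (by simp; exact fun a ha => Or.inl (Or.inr ha)), ih, sub_zero]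
    intro l' hl hs
    refine h _ (by simp [hl]) ?_
    intro y hy
    rcases List.mem_cons.1 hy with rfl | hy
    · exact Or.inr ⟨x, by simp, rfl⟩
    · rcases hs y hy with h1 | ⟨z, hz, h1⟩
      · exact Or.inl (List.mem_cons_of_mem _ h1)
      · exact Or.inr ⟨z, List.mem_cons_of_mem _ hz, h1⟩

theorem del_prism (r : M → M) (f : List M → k) (l : List M) :
    del (prism r f) l + prism r (del f) l = f l - f (l.map r) := by
  induction l generalizing f with
  | nil => simp [prism]
  | cons x l ih =>
    have h1 : (fun l' => prism r f (x :: l')) =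
        (fun l' => f (r x :: x :: l')) - prism r (fun l' => f (r x :: l')) := by
      ext l'; simp [prism_cons]
    have h2 : (fun l' => del f (r x :: l')) = f - del (fun l' => f (r x :: l')) := by
      ext l'; simp [del_cons]
    have := ih (fun l' => f (r x :: l'))
    rw [prism_cons, h2, prism_sub, del_cons, del_cons, del_cons, h1, del_sub, List.map_cons]
    linear_combination this

variable (k) in
/-- The prism operator as a linear map. -/
def prismL (r : M → M) : (List M → k) →ₗ[k] (List M → k) where
  toFun f := prism r f
  map_add' f g := by ext; simp [prism_add]
  map_smul' c f := by ext; simp [prism_smul]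

theorem cd_prism (r : M → M) (f : List M → k) :
    cd k M (prismL k r f) + prismL k r (cd k M f) = f - pull k r f := by
  ext l
  have h1 : cd k M (prism r f) l = del (prism r f) l := by
    rw [cd_apply]
    split_ifs with h
    · match l, h with
      | [], _ => rfl
      | [x], _ => simp [del_cons, prism]
    · rfl
  have h2 : prism r (cd k M f) l = prism r (del f) l := by
    rw [← sub_eq_zero, ← prism_sub]
    cases l with
    | nil => rfl
    | cons x l =>
      refine prism_eq_zero fun l' hl _ => ?_
      rw [Pi.sub_apply, cd_apply, if_neg (by simp at hl; omega), sub_self]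
  change cd k M (prism r f) l + prism r (cd k M f) l = f l - f (l.map r)
  rw [h1, h2, del_prism]

end Cochain

section Ideal

variable {k : Type v} [Field k] {M' : Type w} [TopologicalSpace M']
  {M : Type u} [TopologicalSpace M]

/-- Points near which a cochain vanishes on small simplices with vertices in `F`. -/
def van (F : Set M) (f : List M → k) (j : ℕ) : Set M :=
  {s | ∃ U ∈ 𝓝 s, ∀ l : List M, l.length = j → (∀ x ∈ l, x ∈ U ∩ F) → f l = 0}

theorem isOpen_van (F : Set M) (f : List M → k) (j : ℕ) : IsOpen (van F f j) := by
  rw [isOpen_iff_mem_nhds]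
  rintro s ⟨U, hU, h⟩
  filter_upwards [eventually_mem_nhds_iff.2 hU] with t ht
  exact ⟨U, ht, h⟩

variable (k) in
/-- Cochains with vertices in `F` that vanish near the points of `S`. -/
def IF (F S : Set M) (j : ℕ) : Submodule k (List M → k) where
  carrier := {f | j ≠ 0 → S ⊆ van F f j}
  add_mem' {f g} hf hg hj s hs := by
    obtain ⟨U, hU, h⟩ := hf hj hs
    obtain ⟨U', hU', h'⟩ := hg hj hs
    refine ⟨U ∩ U', inter_mem hU hU', fun l hl hx => ?_⟩
    rw [Pi.add_apply, h l hl fun x hx' => ⟨(hx x hx').1.1, (hx x hx').2⟩,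
      h' l hl fun x hx' => ⟨(hx x hx').1.2, (hx x hx').2⟩, add_zero]
  zero_mem' _ s _ := ⟨univ, univ_mem, fun _ _ _ => rfl⟩
  smul_mem' c f hf hj s hs := by
    obtain ⟨U, hU, h⟩ := hf hj hs
    exact ⟨U, hU, fun l hl hx => by rw [Pi.smul_apply, h l hl hx, smul_zero]⟩

variable (k) in
/-- Cochains that vanish near the points of `S`. -/
abbrev I (S : Set M) (j : ℕ) : Submodule k (List M → k) := IF k univ S j

variable {F S T : Set M} {j : ℕ} {f : List M → k}

theorem mem_IF : f ∈ IF k F S j ↔ (j ≠ 0 → S ⊆ van F f j) := Iff.rfl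

theorem IF_zero : IF k F S 0 = ⊤ := by
  rw [eq_top_iff]
  intro f _ h
  exact absurd rfl h

theorem IF_empty : IF k F ∅ j = ⊤ := by
  rw [eq_top_iff]
  intro f _ _
  exact empty_subset _

theorem IF_anti (h : S ⊆ T) : IF k F T j ≤ IF k F S j := fun _ hf hj => h.trans (hf hj)

theorem I_le_IF : I k S j ≤ IF k F S j := fun _ hf hj s hs => by
  obtain ⟨U, hU, h⟩ := hf hj hs
  exact ⟨U, hU, fun l hl hx => h l hl fun x hx' => ⟨(hx x hx').1, trivial⟩⟩

theorem IF_union : IF k F (S ∪ T) j = IF k F S j ⊓ IF k F T j := by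
  ext f
  simp only [Submodule.mem_inf, mem_IF, union_subset_iff]
  tauto

theorem mem_van_of_forall {s : M} {U : Set M} (hU : U ∈ 𝓝 s)
    (h : ∀ l : List M, l.length = j → (∀ x ∈ l, x ∈ U) → f l = 0) : s ∈ van univ f j :=
  ⟨U, hU, fun l hl hx => h l hl fun x hx' => (hx x hx').1⟩

theorem cd_mem_IF (hf : f ∈ IF k F S j) : cd k M f ∈ IF k F S (j + 1) := by
  intro _ s hs
  rcases Nat.eq_zero_or_pos j with rfl | hj
  · exact ⟨univ, univ_mem, fun l hl _ => by rw [cd_apply, if_pos (by omega)]⟩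
  · obtain ⟨U, hU, h⟩ := hf hj.ne' hs
    refine ⟨U, hU, fun l hl hx => ?_⟩
    rw [cd_apply, if_neg (by omega)]
    exact del_eq_zero fun l' hl' hs => h l' (by omega) fun x hx' => hx x (hs hx')

theorem pull_mem_IF {φ : M → M'} {F' S' : Set M'} (hφ : ∀ s ∈ S, ContinuousAt φ s)
    (hS : MapsTo φ S S') (hF : MapsTo φ F F') {f : List M' → k} (hf : f ∈ IF k F' S' j) :
    pull k φ f ∈ IF k F S j := by
  intro hj s hs
  obtain ⟨U, hU, h⟩ := hf hj (hS hs)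
  refine ⟨φ ⁻¹' U, hφ s hs hU, fun l hl hx => h _ (by simpa using hl) ?_⟩
  simp only [List.mem_map]
  rintro _ ⟨x, hx', rfl⟩
  exact ⟨(hx x hx').1, hF (hx x hx').2⟩

theorem cut_mem_IF (χ : M → k) (hf : f ∈ IF k F S j) : cut χ f ∈ IF k F S j := by
  intro hj s hs
  obtain ⟨U, hU, h⟩ := hf hj hs
  exact ⟨U, hU, fun l hl hx => by rw [cut_apply, h l hl hx, mul_zero]⟩

theorem prism_mem_IF {r : M → M} (hr : ∀ s ∈ S, Tendsto r (𝓝 s) (𝓝 s)) (hF : MapsTo r F F)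
    (hf : f ∈ IF k F S (j + 1)) : prismL k r f ∈ IF k F S j := by
  intro hj s hs
  obtain ⟨U, hU, h⟩ := hf (by omega) hs
  refine ⟨U ∩ r ⁻¹' U, inter_mem hU (hr s hs hU), fun l hl hx => prism_eq_zero fun l' hl' hs => ?_⟩
  refine h l' (by omega) fun x hx' => ?_
  rcases hs x hx' with h1 | ⟨y, hy, rfl⟩
  · exact ⟨(hx x h1).1.1, (hx x h1).2⟩
  · exact ⟨(hx y hy).1.2, hF (hx y hy).2⟩

/-- Cutting a cochain along an open set. -/
theorem cut_mem_of_closure {P : Set M} [DecidablePred (· ∈ P)]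
    (hT : T ⊆ van univ f j ∪ (closure P)ᶜ) :
    cut (fun x => if x ∈ P then 1 else 0) f ∈ I k T j := by
  intro hj s hs
  rcases hT hs with ⟨U, hU, h⟩ | h
  · exact ⟨U, hU, fun l hl hx => by rw [cut_apply, h l hl hx, mul_zero]⟩
  · refine ⟨(closure P)ᶜ, isClosed_closure.isOpen_compl.mem_nhds h, fun l hl hx => ?_⟩
    match l, hl with
    | [], hl => exact absurd hl.symm hj
    | x :: l, _ =>
      have : x ∉ P := fun h => (hx x (by simp)).1 (subset_closure h)
      simp [cut_apply, this]

theorem sub_cut_mem_of_isOpen {P : Set M} [DecidablePred (· ∈ P)] (hP : IsOpen P)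
    (hS : S ⊆ van univ f j ∪ P) :
    f - cut (fun x => if x ∈ P then 1 else 0) f ∈ I k S j := by
  intro hj s hs
  rcases hS hs with ⟨U, hU, h⟩ | h
  · exact ⟨U, hU, fun l hl hx => by rw [Pi.sub_apply, cut_apply, h l hl hx, mul_zero, sub_zero]⟩
  · refine ⟨P, hP.mem_nhds h, fun l hl hx => ?_⟩
    match l, hl with
    | [], hl => exact absurd hl.symm hj
    | x :: l, _ =>
      have : x ∈ P := (hx x (by simp)).1
      simp [cut_apply, this]

theorem I_inter [NormalSpace M] (hS : IsClosed S) (hT : IsClosed T) :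
    I k (S ∩ T) j = I k S j ⊔ I k T j := by
  classical
  refine le_antisymm ?_ (sup_le (IF_anti inter_subset_left) (IF_anti inter_subset_right))
  intro f hf
  rcases eq_or_ne j 0 with rfl | hj
  · rw [I, IF_zero]; simp
  have hO := isOpen_van univ f j
  have hd : S \ van univ f j ⊆ (T \ van univ f j)ᶜ := fun x hx hx' =>
    hx.2 (hf hj ⟨hx.1, hx'.1⟩)
  obtain ⟨P, hP, hSP, hPT⟩ :=
    normal_exists_closure_subset (hS.sdiff hO) (hT.sdiff hO).isOpen_compl hd
  rw [← sub_add_cancel f (cut (fun x => if x ∈ P then 1 else 0) f)]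
  refine Submodule.add_mem_sup (sub_cut_mem_of_isOpen hP fun x hx => ?_)
    (cut_mem_of_closure fun x hx => ?_)
  · by_cases h : x ∈ van univ f j
    · exact Or.inl h
    · exact Or.inr (hSP ⟨hx, h⟩)
  · by_cases h : x ∈ van univ f j
    · exact Or.inl h
    · exact Or.inr fun h' => hPT h' ⟨hx, h⟩

end Ideal

end MannSu

namespace MannSu

open scoped Topology Pointwise
open Set Filter

universe u v w

variable {k : Type v} [Field k] {M : Type u}

/-- Relative cohomological acyclicity in one degree. -/
def CAcy (k : Type v) [Field k] {M : Type u} [TopologicalSpace M] (S T : Set M) (j : ℕ) : Prop :=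
  ∀ f ∈ I k T j, cd k M f ∈ I k S (j + 1) → ∃ g ∈ I k T (j - 1), f - cd k M g ∈ I k S j

section Complex

variable {p : ℕ} {G : Type w} [CommGroup G] [MulAction G M]

/-- The dual Alexander-Spanier complex. -/
noncomputable abbrev AS (k : Type v) [Field k] (M : Type u) {p : ℕ} {G : Type w} [CommGroup G]
    [MulAction G M] (hG : ∀ g : G, g ^ p = 1) : Amb.{max u v} k p G where
  V := Module.Dual k (List M → k)
  d := (cd k M).dualMap
  ρ :=
    { toFun g := (pull k (g • · : M → M)).dualMap
      map_one' := by
        ext l f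
        simp only [LinearMap.dualMap_apply, Module.End.one_apply]
        congr 1
        ext m
        simp
      map_mul' g h := by
        ext l f
        simp only [LinearMap.dualMap_apply, Module.End.mul_apply]
        congr 1
        ext m
        simp [mul_smul, Function.comp_def] }
  dd x := by
    ext f
    simp [LinearMap.dualMap_apply, cd_cd]
  comm g x := by
    ext f
    simp [LinearMap.dualMap_apply, cd_pull]
  pow g := by
    rw [← map_pow, hG, map_one]

variable {hG : ∀ g : G, g ^ p = 1}

theorem AS_ρ_apply (g : G) (l : Module.Dual k (List M → k)) (f : List M → k) :
    (AS k M hG).ρ g l f = l (pull k (g • ·) f) := rfl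

theorem AS_d_apply (l : Module.Dual k (List M → k)) (f : List M → k) :
    (AS k M hG).d l f = l (cd k M f) := rfl

variable [TopologicalSpace M]

variable (k) in
/-- Functionals on cochains with vertices in `F`, supported near `S`. -/
def AF (F S : Set M) (j : ℕ) : Submodule k (Module.Dual k (List M → k)) :=
  (IF k F S j).dualAnnihilator

variable (k) in
/-- Functionals supported near `S`. -/
abbrev A (S : Set M) (j : ℕ) : Submodule k (Module.Dual k (List M → k)) := AF k univ S j

variable {F S T : Set M} {j : ℕ}

theorem mem_AF {l : Module.Dual k (List M → k)} :
    l ∈ AF k F S j ↔ ∀ f ∈ IF k F S j, l f = 0 := Submodule.mem_dualAnnihilator l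

theorem AF_mono (h : S ⊆ T) : AF k F S ≤ AF k F T := fun _ =>
  Submodule.dualAnnihilator_anti (IF_anti h)

theorem AF_zero : AF k F S 0 = ⊥ := by rw [AF, IF_zero, Submodule.dualAnnihilator_top]

theorem AF_empty : AF k F (∅ : Set M) j = ⊥ := by
  rw [AF, IF_empty, Submodule.dualAnnihilator_top]

theorem AF_le_A : AF k F S ≤ A k S := fun _ => Submodule.dualAnnihilator_anti I_le_IF

theorem A_union : A k (S ∪ T) j = A k S j ⊔ A k T j := by
  rw [A, AF, IF_union, Subspace.dualAnnihilator_inf_eq]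
  rfl

theorem A_inter [NormalSpace M] (hS : IsClosed S) (hT : IsClosed T) :
    A k (S ∩ T) j = A k S j ⊓ A k T j := by
  rw [A, AF, show IF k univ (S ∩ T) j = _ from I_inter hS hT, Submodule.dualAnnihilator_sup_eq]
  rfl

theorem AF_ρ_mem [ContinuousConstSMul G M] {T : Set M} (g : G) (hS : MapsTo (g • ·) S T)
    (hF : MapsTo (g • ·) F F) {l : Module.Dual k (List M → k)} (hl : l ∈ AF k F S j) :
    (AS k M hG).ρ g l ∈ AF k F T j := by
  rw [mem_AF] at hl ⊢
  intro f hf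
  rw [AS_ρ_apply]
  exact hl _ (pull_mem_IF (fun s _ => (continuous_const_smul g).continuousAt) hS hF hf)

theorem AF_d_mem {l : Module.Dual k (List M → k)} (hl : l ∈ AF k F S (j + 1)) :
    (AS k M hG).d l ∈ AF k F S j := by
  rw [mem_AF] at hl ⊢
  intro f hf
  exact hl _ (cd_mem_IF hf)

theorem isSub_A [ContinuousConstSMul G M] (hS : ∀ g : G, MapsTo (g • ·) S S) :
    (AS k M hG).IsSub (A k S) where
  zero := AF_zero
  d_mem h := AF_d_mem h
  ρ_mem g h := AF_ρ_mem g (hS g) (mapsTo_univ _ _) h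

/-- Universal coefficients. -/
theorem exists_sub_d_mem {z : Module.Dual k (List M → k)}
    (h : ∀ f ∈ I k T j, cd k M f ∈ I k S (j + 1) → z f = 0) :
    ∃ y ∈ A k S (j + 1), z - (AS k M hG).d y ∈ A k T j := by
  let c : I k T j →ₗ[k] (List M → k) ⧸ I k S (j + 1) :=
    (I k S (j + 1)).mkQ ∘ₗ cd k M ∘ₗ (I k T j).subtype
  let z' : I k T j →ₗ[k] k := z ∘ₗ (I k T j).subtype
  have hker : LinearMap.ker c ≤ LinearMap.ker z' := by
    rintro ⟨f, hf⟩ hfc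
    rw [LinearMap.mem_ker] at hfc ⊢
    simp only [c, LinearMap.comp_apply, Submodule.mkQ_apply, Submodule.Quotient.mk_eq_zero,
      Submodule.subtype_apply] at hfc
    exact h f hf hfc
  obtain ⟨y, hy⟩ := LinearMap.exists_extend
    ((c.ker.liftQ z' hker) ∘ₗ c.quotKerEquivRange.symm.toLinearMap)
  refine ⟨y ∘ₗ (I k S (j + 1)).mkQ, mem_AF.2 fun f hf => ?_, mem_AF.2 fun f hf => ?_⟩
  · simp only [LinearMap.comp_apply, Submodule.mkQ_apply]
    rw [(Submodule.Quotient.mk_eq_zero _).2 hf, map_zero]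
  · have h1 := LinearMap.congr_fun hy (c.quotKerEquivRange (Submodule.Quotient.mk ⟨f, hf⟩))
    simp only [LinearMap.comp_apply, LinearEquiv.coe_coe, LinearEquiv.symm_apply_apply,
      Submodule.liftQ_apply] at h1
    rw [LinearMap.sub_apply, AS_d_apply, sub_eq_zero]
    exact h1.symm

/-- Relative cohomological acyclicity implies homological acyclicity. -/
theorem H_eq_zero_of_CAcy (h : CAcy k S T j) :
    (AS k M hG).H (A k S) (A k T) j = 0 := by
  rw [Amb.H_eq_zero_iff]
  intro z hz hdz
  rw [mem_AF] at hz
  refine exists_sub_d_mem fun f hf hfc => ?_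
  obtain ⟨g, hg, hfg⟩ := h f hf hfc
  have h1 := hz _ hfg
  have h2 := mem_AF.1 hdz g hg
  rw [AS_d_apply] at h2
  rwa [map_sub, h2, sub_zero] at h1

end Complex

end MannSu

namespace MannSu

open scoped Topology
open Set Filter

universe u v w

variable {k : Type v} [Field k] {M : Type u} [TopologicalSpace M]

/-- Vanishing of the cohomology of `S` in one degree. -/
def Van (k : Type v) [Field k] {M : Type u} [TopologicalSpace M] (S : Set M) (j : ℕ) : Prop :=
  ∀ f, cd k M f ∈ I k S (j + 1) → ∃ g, f - cd k M g ∈ I k S j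

theorem cAcy_empty_iff {S : Set M} {j : ℕ} : CAcy k S ∅ j ↔ Van k S j := by
  simp [CAcy, Van, I, IF_empty]

theorem van_of_empty (j : ℕ) : Van k (∅ : Set M) j := fun f _ => ⟨0, by rw [I, IF_empty]; trivial⟩

theorem glue_of_union [NormalSpace M] {S T : Set M} (hS : IsClosed S) (hT : IsClosed T) {j : ℕ}
    {f g₁ g₂ h w : List M → k} (h₁ : f - cd k M g₁ ∈ I k S (j + 1))
    (h₂ : f - cd k M g₂ ∈ I k T (j + 1)) (hh : cd k M h ∈ I k (S ∪ T) (j + 1))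
    (hw : g₁ - g₂ - h - cd k M w ∈ I k (S ∩ T) j) :
    ∃ g, f - cd k M g ∈ I k (S ∪ T) (j + 1) := by
  rw [I_inter hS hT] at hw
  obtain ⟨a, ha, b, hb, hab⟩ := Submodule.mem_sup.1 hw
  refine ⟨g₂ + b, ?_⟩
  rw [I, IF_union]
  refine ⟨?_, ?_⟩
  · have := add_mem (add_mem h₁ (IF_anti subset_union_left hh)) (cd_mem_IF ha)
    have e : g₂ + b = g₁ - h - cd k M w - a := by
      rw [eq_sub_iff_add_eq, add_assoc, add_comm b, hab]
      abel
    have e' : f - cd k M (g₂ + b) = f - cd k M g₁ + cd k M h + cd k M a := by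
      simp only [e, map_sub, cd_cd]
      abel
    rwa [← e'] at this
  · have := sub_mem h₂ (cd_mem_IF hb)
    rwa [sub_sub, ← map_add] at this

theorem exists_slab {S : Set M} (hS : IsCompact S) {π : M → ℝ} (hπ : Continuous π) {t : ℝ}
    {W : Set M} (hW : IsOpen W) (h : S ∩ π ⁻¹' {t} ⊆ W) :
    ∃ ε > 0, S ∩ π ⁻¹' Icc (t - ε) (t + ε) ⊆ W := by
  have hK : IsClosed (π '' (S \ W)) := ((hS.diff hW).image hπ).isClosed
  have ht : t ∈ (π '' (S \ W))ᶜ := by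
    rintro ⟨x, ⟨hx, hx'⟩, rfl⟩
    exact hx' (h ⟨hx, rfl⟩)
  obtain ⟨ε, hε, hb⟩ := Metric.nhds_basis_closedBall.mem_iff.1 (hK.isOpen_compl.mem_nhds ht)
  refine ⟨ε, hε, fun x hx => ?_⟩
  rw [Real.closedBall_eq_Icc] at hb
  by_contra hxW
  exact hb hx.2 ⟨x, ⟨hx.1, hxW⟩, rfl⟩

/-- Vanishing of cohomology classes can be tested on the fibres of a real function. -/
theorem van_of_slices [T4Space M] {S : Set M} (hS : IsCompact S) {π : M → ℝ} (hπ : Continuous π)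
    {j : ℕ} (h1 : ∀ t, Van k (S ∩ π ⁻¹' {t}) (j + 1))
    (h2 : ∀ t, ∀ u, cd k M u ∈ I k (S ∩ π ⁻¹' {t}) (j + 1) →
      ∃ h w, cd k M h ∈ I k S (j + 1) ∧ u - h - cd k M w ∈ I k (S ∩ π ⁻¹' {t}) j) :
    Van k S (j + 1) := by
  intro f hf
  let P : Set ℝ := {t | ∃ g, f - cd k M g ∈ I k (S ∩ π ⁻¹' Iic t) (j + 1)}
  have hstep : ∀ t, ∃ ε > 0, ∀ s, t - ε ≤ s → ∀ b, s ≤ b → b ≤ t + ε → s ∈ P → b ∈ P := by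
    intro t
    obtain ⟨g₂, hg₂⟩ := h1 t f (IF_anti inter_subset_left hf)
    obtain ⟨ε, hε, hW⟩ := exists_slab hS hπ (isOpen_van _ _ _) (hg₂ (by omega))
    refine ⟨ε, hε, fun s hs b hsb hb ⟨g₁, hg₁⟩ => ?_⟩
    have hg₂' : f - cd k M g₂ ∈ I k (S ∩ π ⁻¹' Icc s b) (j + 1) := fun _ x hx =>
      hW ⟨hx.1, hs.trans hx.2.1, hx.2.2.trans hb⟩
    have e1 : (S ∩ π ⁻¹' Iic s) ∪ (S ∩ π ⁻¹' Icc s b) = S ∩ π ⁻¹' Iic b := by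
      rw [← inter_union_distrib_left, ← preimage_union, Iic_union_Icc_eq_Iic hsb]
    have e2 : (S ∩ π ⁻¹' Iic s) ∩ (S ∩ π ⁻¹' Icc s b) = S ∩ π ⁻¹' {s} := by
      ext x
      simp only [mem_inter_iff, mem_preimage, mem_Iic, mem_Icc, mem_singleton_iff]
      constructor
      · rintro ⟨⟨h1, h2⟩, -, h3, -⟩
        exact ⟨h1, le_antisymm h2 h3⟩
      · rintro ⟨h1, h2⟩
        exact ⟨⟨h1, h2.le⟩, h1, h2.ge, h2.le.trans hsb⟩
    obtain ⟨h, w, hh, hw⟩ := h2 s (g₁ - g₂) (by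
      rw [← e2]
      have := sub_mem (IF_anti inter_subset_right hg₂') (IF_anti inter_subset_left hg₁)
      convert this using 1
      rw [map_sub]
      abel)
    rw [← e2] at hw
    change ∃ g, _
    rw [← e1]
    refine glue_of_union (hS.isClosed.inter (isClosed_Iic.preimage hπ))
      (hS.isClosed.inter (isClosed_Icc.preimage hπ)) hg₁ hg₂' ?_ hw
    rw [e1]
    exact IF_anti inter_subset_left hh
  obtain ⟨a, ha⟩ := (hS.image hπ).bddBelow
  obtain ⟨b, hb⟩ := (hS.image hπ).bddAbove
  have ha' : min (a - 1) b ∈ P := by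
    refine ⟨0, ?_⟩
    have : S ∩ π ⁻¹' Iic (min (a - 1) b) = ∅ := by
      ext x
      simp only [mem_inter_iff, mem_preimage, mem_Iic, mem_empty_iff_false, iff_false, not_and,
        not_le]
      intro hx
      have := ha ⟨x, hx, rfl⟩
      exact (min_le_left _ _).trans_lt (by linarith)
    rw [this, I, IF_empty]
    trivial
  have hbP : b ∈ P := by
    have hmono : ∀ s ∈ P, ∀ t ≤ s, t ∈ P := fun s ⟨g, hg⟩ t hts =>
      ⟨g, IF_anti (inter_subset_inter_right _ (preimage_mono (Iic_subset_Iic.2 hts))) hg⟩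
    have hcl : IsClosed P := by
      rw [← isOpen_compl_iff, isOpen_iff_mem_nhds]
      intro t ht
      obtain ⟨ε, hε, h⟩ := hstep t
      filter_upwards [Ioi_mem_nhds (show t - ε < t by linarith)] with s hs hsP
      rcases le_or_gt s t with h1 | h1
      · exact ht (h s hs.le t h1 (by linarith) hsP)
      · exact ht (hmono s hsP t h1.le)
    refine (hcl.inter isClosed_Icc).Icc_subset_of_forall_exists_gt ha' ?_
      (right_mem_Icc.2 (min_le_right (a - 1) b))
    rintro x ⟨hx, -⟩ y hy
    obtain ⟨ε, hε, h⟩ := hstep x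
    exact ⟨min y (x + ε), h x (by linarith) _ (le_min (le_of_lt hy) (by linarith))
      (min_le_right _ _) hx, lt_min hy (by linarith), min_le_left _ _⟩
  obtain ⟨g, hg⟩ := hbP
  exact ⟨g, IF_anti (show S ⊆ S ∩ π ⁻¹' Iic b from fun x hx => ⟨hx, hb ⟨x, hx, rfl⟩⟩) hg⟩

theorem van_of_subsingleton {S : Set M} (hS : S.Subsingleton) {j : ℕ} (hj : 2 ≤ j) :
    Van k S j := by
  intro f hf
  rcases hS.eq_empty_or_singleton with rfl | ⟨x, rfl⟩
  · exact van_of_empty j f hf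
  refine ⟨fun l => f (x :: l), fun _ s hs => ?_⟩
  obtain rfl : s = x := hs
  obtain ⟨U, hU, h⟩ := hf (by omega) (mem_singleton s)
  have hs : s ∈ U := mem_of_mem_nhds hU
  refine mem_van_of_forall hU fun l hl hx => ?_
  have := h (s :: l) (by simp [hl]) fun y hy =>
    (List.mem_cons.1 hy).elim (fun e => e ▸ ⟨hs, trivial⟩) fun h => ⟨hx y h, trivial⟩
  have hl' : ¬ l.length ≤ 1 := by omega
  have hl'' : ¬ (s :: l).length ≤ 1 := by rw [List.length_cons]; omega
  rw [cd_apply, if_neg hl'', del_cons] at this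
  rw [Pi.sub_apply, cd_apply, if_neg hl']
  exact this

theorem cd_const_mem (S : Set M) (c : k) : cd k M (fun _ => c) ∈ I k S 2 := fun _ s _ =>
  mem_van_of_forall univ_mem fun l hl _ => by
    match l, hl with
    | [x, y], _ => simp [cd_apply, del_cons]

theorem exists_sub_const_mem {S : Set M} (hS : IsPreconnected S) {f : List M → k}
    (hf : cd k M f ∈ I k S 2) : ∃ c : k, f - (fun _ => c) ∈ I k S 1 := by
  rcases S.eq_empty_or_nonempty with rfl | ⟨x, hx⟩
  · exact ⟨0, by rw [I, IF_empty]; trivial⟩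
  have hloc : ∀ s ∈ S, ∀ᶠ y in 𝓝 s, f [y] = f [s] := by
    intro s hs
    obtain ⟨U, hU, h⟩ := hf (by omega) hs
    filter_upwards [hU] with y hy
    have := h [s, y] rfl (by simpa using ⟨mem_of_mem_nhds hU, hy⟩)
    simpa [cd_apply, del_cons, sub_eq_zero] using this
  let _ : TopologicalSpace k := ⊥
  have _ : DiscreteTopology k := ⟨rfl⟩
  have hc : ContinuousOn (fun y => f [y]) S := fun s hs =>
    ((continuousAt_const (y := f [s])).congr
      ((hloc s hs).mono fun _ h => h.symm)).continuousWithinAt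
  refine ⟨f [x], fun _ s hs => mem_van_of_forall (hloc s hs) fun l hl hl' => ?_⟩
  match l, hl with
  | [y], _ =>
    have h1 : f [y] = f [s] := hl' y (by simp)
    have h2 : f [s] = f [x] := hS.constant hc hs hx
    simp [h1, h2]

/-- Connected sets whose higher cohomology vanishes. -/
structure Triv (k : Type v) [Field k] {M : Type u} [TopologicalSpace M] (S : Set M) : Prop where
  conn : IsPreconnected S
  van : ∀ j ≥ 2, Van k S j

theorem Triv.cAcy {S T : Set M} (hS : Triv k S) (hT : Triv k T) (hTS : T ⊆ S)
    (hne : T.Nonempty) (j : ℕ) : CAcy k S T j := by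
  intro f hf hcf
  match j with
  | 0 => exact ⟨0, zero_mem _, by rw [I, IF_zero]; trivial⟩
  | 1 =>
    obtain ⟨c, hc⟩ := exists_sub_const_mem hS.conn hcf
    refine ⟨0, zero_mem _, ?_⟩
    obtain ⟨x, hx⟩ := hne
    obtain ⟨U, hU, h⟩ := hf (by omega) hx
    obtain ⟨U', hU', h'⟩ := hc (by omega) (hTS hx)
    have h1 := h [x] rfl (by simpa using mem_of_mem_nhds hU)
    have h2 := h' [x] rfl (by simpa using mem_of_mem_nhds hU')
    have h3 : c = 0 := by simpa [h1] using h2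
    subst h3
    rw [map_zero, sub_zero]
    convert hc using 1
    ext
    simp
  | j + 2 =>
    obtain ⟨g, hg⟩ := hS.van (j + 2) (by omega) f hcf
    have hgT : cd k M g ∈ I k T (j + 2) := by
      have := sub_mem hf (IF_anti hTS hg)
      rwa [sub_sub_cancel] at this
    have h : ∃ h, cd k M h ∈ I k S (j + 2) ∧ g - h ∈ I k T (j + 1) := by
      rcases Nat.eq_zero_or_pos j with rfl | hj
      · obtain ⟨c, hc⟩ := exists_sub_const_mem hT.conn hgT
        exact ⟨_, cd_const_mem S c, hc⟩
      · obtain ⟨w, hw⟩ := hT.van (j + 1) (by omega) g hgT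
        exact ⟨cd k M w, by rw [cd_cd]; exact zero_mem _, hw⟩
    obtain ⟨h, hh, hgh⟩ := h
    refine ⟨g - h, hgh, ?_⟩
    have := add_mem hg hh
    convert this using 1
    rw [map_sub]
    abel

section Euclid

variable {n : ℕ}

theorem van_euclid {S : Set (Fin n → ℝ)} (hS : IsCompact S) (s : Finset (Fin n))
    (hs : ∀ i ∉ s, ∃ c, ∀ x ∈ S, x i = c) {j : ℕ} (hj : s.card + 2 ≤ j) : Van k S j := by
  induction s using Finset.induction generalizing S j with
  | empty =>
    refine van_of_subsingleton (fun x hx y hy => ?_) (by simpa using hj)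
    ext i
    obtain ⟨c, hc⟩ := hs i (by simp)
    rw [hc x hx, hc y hy]
  | insert i s his ih =>
    rw [Finset.card_insert_of_notMem his] at hj
    obtain ⟨j, rfl⟩ : ∃ j', j = j' + 1 := ⟨j - 1, by omega⟩
    have key : ∀ t, ∀ m ≥ s.card + 2, Van k (S ∩ (fun x : Fin n → ℝ => x i) ⁻¹' {t}) m := by
      intro t m hm
      refine ih (hS.inter_right (isClosed_singleton.preimage (continuous_apply i))) ?_ hm
      intro i' hi'
      by_cases h : i' = i
      · subst h
        exact ⟨t, fun x hx => hx.2⟩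
      · obtain ⟨c, hc⟩ := hs i' (by simp [h, hi'])
        exact ⟨c, fun x hx => hc x hx.1⟩
    refine van_of_slices hS (continuous_apply i) (fun t => key t _ (by omega)) fun t u hu => ?_
    obtain ⟨w, hw⟩ := key t j (by omega) u hu
    exact ⟨0, w, by simp, by simpa using hw⟩

theorem Icc_inter_slice (a b : Fin n → ℝ) (i : Fin n) {t : ℝ} (h1 : a i ≤ t) (h2 : t ≤ b i) :
    Icc a b ∩ {x | x i = t} = Icc (Function.update a i t) (Function.update b i t) := by
  ext x
  simp only [mem_inter_iff, mem_Icc, Pi.le_def, mem_ofPred_eq]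
  constructor
  · rintro ⟨⟨ha, hb⟩, rfl⟩
    refine ⟨fun m => ?_, fun m => ?_⟩ <;> by_cases hm : m = i
    · subst hm; simp
    · simpa [hm] using ha m
    · subst hm; simp
    · simpa [hm] using hb m
  · rintro ⟨ha, hb⟩
    have hi : x i = t := le_antisymm (by simpa using hb i) (by simpa using ha i)
    refine ⟨⟨fun m => ?_, fun m => ?_⟩, hi⟩ <;> by_cases hm : m = i
    · subst hm; rwa [hi]
    · simpa [hm] using ha m
    · subst hm; rwa [hi]
    · simpa [hm] using hb m

theorem Icc_inter_slice_eq_empty {a b : Fin n → ℝ} {i : Fin n} {t : ℝ}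
    (h : ¬ (a i ≤ t ∧ t ≤ b i)) : Icc a b ∩ {x | x i = t} = ∅ := by
  ext x
  simp only [mem_inter_iff, mem_ofPred_eq, mem_empty_iff_false, iff_false, not_and]
  rintro hx rfl
  exact h ⟨hx.1 i, hx.2 i⟩

theorem isPreconnected_box (a b : Fin n → ℝ) : IsPreconnected (Icc a b) :=
  (convex_Icc a b).isPreconnected

theorem van_box (s : Finset (Fin n)) (a b : Fin n → ℝ) (hs : ∀ i ∉ s, b i ≤ a i) {j : ℕ}
    (hj : 2 ≤ j) : Van k (Icc a b) j := by
  induction s using Finset.induction generalizing a b j with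
  | empty =>
    refine van_of_subsingleton (fun x hx y hy => ?_) hj
    ext i
    have := hs i (by simp)
    linarith [hx.1 i, hx.2 i, hy.1 i, hy.2 i]
  | insert i s his ih =>
    obtain ⟨j, rfl⟩ : ∃ j', j = j' + 1 := ⟨j - 1, by omega⟩
    have key : ∀ t, ∀ m ≥ 2, Van k (Icc a b ∩ (fun x : Fin n → ℝ => x i) ⁻¹' {t}) m := by
      intro t m hm
      change Van k (Icc a b ∩ {x | x i = t}) m
      by_cases h : a i ≤ t ∧ t ≤ b i
      · rw [Icc_inter_slice a b i h.1 h.2]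
        refine ih _ _ (fun i' hi' => ?_) hm
        by_cases h' : i' = i
        · subst h'; simp
        · simpa [h'] using hs i' (by simp [h', hi'])
      · rw [Icc_inter_slice_eq_empty h]
        exact van_of_empty _
    refine van_of_slices isCompact_Icc (continuous_apply i) (fun t => key t _ (by omega))
      fun t u hu => ?_
    rcases Nat.lt_or_ge j 2 with h | h
    · obtain rfl : j = 1 := by omega
      have hc : IsPreconnected (Icc a b ∩ (fun x : Fin n → ℝ => x i) ⁻¹' {t}) := by
        change IsPreconnected (Icc a b ∩ {x | x i = t})
        by_cases h : a i ≤ t ∧ t ≤ b i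
        · rw [Icc_inter_slice a b i h.1 h.2]
          exact isPreconnected_box _ _
        · rw [Icc_inter_slice_eq_empty h]
          exact isPreconnected_empty
      obtain ⟨c, hc⟩ := exists_sub_const_mem hc hu
      exact ⟨_, 0, cd_const_mem _ c, by simpa using hc⟩
    · obtain ⟨w, hw⟩ := key t j h u hu
      exact ⟨0, w, by simp, by simpa using hw⟩

theorem triv_box (a b : Fin n → ℝ) : Triv k (Icc a b) :=
  ⟨isPreconnected_box a b, fun _ hj => van_box Finset.univ a b (by simp) hj⟩

end Euclid

section Chart

variable {X : Type w} [TopologicalSpace X] (φ : OpenPartialHomeomorph M X)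

theorem CAcy.chart {S T : Set X} (hS : S ⊆ φ.target) (hTS : T ⊆ S) {j : ℕ} (h : CAcy k S T j) :
    CAcy k (φ.symm '' S) (φ.symm '' T) j := by
  intro f hf hcf
  have hc : ∀ s ∈ S, ContinuousAt φ.symm s := fun s hs => φ.continuousAt_symm (hS hs)
  have hm : ∀ R ⊆ S, MapsTo φ (φ.symm '' R) R := by
    rintro R hR _ ⟨x, hx, rfl⟩
    rwa [φ.right_inv (hS (hR hx))]
  have hc' : ∀ s ∈ φ.symm '' S, ContinuousAt φ s := by
    rintro _ ⟨x, hx, rfl⟩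
    exact φ.continuousAt (φ.map_target (hS hx))
  obtain ⟨g, hg, hfg⟩ := h (pull k φ.symm f)
    (pull_mem_IF (fun s hs => hc s (hTS hs)) (mapsTo_image _ _) (mapsTo_univ _ _) hf) (by
      rw [cd_pull]
      exact pull_mem_IF hc (mapsTo_image _ _) (mapsTo_univ _ _) hcf)
  refine ⟨pull k φ g, pull_mem_IF (fun s hs => hc' s (image_mono hTS hs)) (hm T hTS)
    (mapsTo_univ _ _) hg, ?_⟩
  have h1 : pull k φ (pull k φ.symm f - cd k X g) ∈ I k (φ.symm '' S) j :=
    pull_mem_IF hc' (hm S le_rfl) (mapsTo_univ _ _) hfg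
  have h2 : f - pull k φ (pull k φ.symm f) ∈ I k (φ.symm '' S) j := by
    rintro _ _ ⟨x, hx, rfl⟩
    refine mem_van_of_forall (φ.open_source.mem_nhds (φ.map_target (hS hx))) fun l _ hl => ?_
    have : (l.map φ).map φ.symm = l := by
      rw [List.map_map]
      conv_rhs => rw [← List.map_id l]
      exact List.map_congr_left fun x hx => φ.left_inv (hl x hx)
    simp only [Pi.sub_apply, pull_apply, this, sub_self]
  have := add_mem h2 h1
  convert this using 1
  rw [map_sub, cd_pull]
  abel

end Chart

end MannSu

namespace MannSu

open scoped Topology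
open Set Filter

universe u v w

variable {k : Type v} [Field k] {M : Type u}
  {E : Type w} [Group E] [MulAction E M]

section Defs

variable (E) in
/-- Invariant cochains. -/
def EInv (f : List M → k) : Prop := ∀ g : E, pull k (g • · : M → M) f = f

variable (E) in
/-- Invariant subsets. -/
def SInv (S : Set M) : Prop := ∀ g : E, MapsTo (g • · : M → M) S S

variable {f g : List M → k} {S T : Set M} {j : ℕ}

theorem EInv.sub (hf : EInv E f) (hg : EInv E g) : EInv E (f - g) := fun h => by
  rw [map_sub, hf h, hg h]

theorem EInv.add (hf : EInv E f) (hg : EInv E g) : EInv E (f + g) := fun h => by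
  rw [map_add, hf h, hg h]

theorem EInv.cd (hf : EInv E f) : EInv E (cd k M f) := fun h => by
  rw [← cd_pull, hf h]

theorem pull_smul_smul (g h : E) (f : List M → k) :
    pull k (g • · : M → M) (pull k (h • · : M → M) f) = pull k ((h * g) • · : M → M) f := by
  ext l
  simp [mul_smul, Function.comp_def]

theorem pull_one_smul (f : List M → k) : pull k ((1 : E) • · : M → M) f = f := by
  ext l
  simp

theorem EInv.sum [Fintype E] (f : List M → k) : EInv E (∑ h : E, pull k (h • · : M → M) f) := by
  intro g
  rw [map_sum]
  simp only [pull_smul_smul]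
  exact Fintype.sum_equiv (Equiv.mulRight g) _ _ fun _ => rfl

theorem SInv.mem_iff (hS : SInv E S) (g : E) {x : M} : g • x ∈ S ↔ x ∈ S := by
  refine ⟨fun h => ?_, fun h => hS g h⟩
  have := hS g⁻¹ h
  simpa using this

theorem SInv.inter (hS : SInv E S) (hT : SInv E T) : SInv E (S ∩ T) := fun g =>
  (hS g).inter_inter (hT g)

theorem SInv.union (hS : SInv E S) (hT : SInv E T) : SInv E (S ∪ T) := fun g =>
  (hS g).union_union (hT g)

theorem SInv.compl (hS : SInv E S) : SInv E Sᶜ := fun g _ hx h => hx ((hS.mem_iff g).1 h)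

theorem SInv.sdiff (hS : SInv E S) (hT : SInv E T) : SInv E (S \ T) := hS.inter hT.compl

theorem EInv.cut {P : Set M} [DecidablePred (· ∈ P)] (hf : EInv E f) (hP : SInv E P) :
    EInv E (cut (fun x => if x ∈ P then 1 else 0) f) := by
  intro g
  ext l
  have := congrFun (hf g) l
  simp only [pull_apply, cut_apply] at this ⊢
  rw [this]
  cases l with
  | nil => rfl
  | cons x l => simp [hP.mem_iff g]

/-- The union of the translates of a set. -/
abbrev orb (E : Type w) [Group E] [MulAction E M] (C : Set M) : Set M :=
  ⋃ g : E, (g • · : M → M) '' C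

theorem subset_orb (C : Set M) : C ⊆ orb E C := fun x hx =>
  mem_iUnion.2 ⟨1, x, hx, one_smul _ _⟩

theorem orb_inv (C : Set M) : SInv E (orb E C) := by
  intro g x hx
  obtain ⟨h, y, hy, rfl⟩ := mem_iUnion.1 hx
  exact mem_iUnion.2 ⟨g * h, y, hy, mul_smul _ _ _⟩

theorem orb_subset {C : Set M} (hS : SInv E S) (hC : C ⊆ S) : orb E C ⊆ S :=
  iUnion_subset fun g => image_subset_iff.2 fun _ hx => hS g (hC hx)

theorem orb_inter {C : Set M} (hS : SInv E S) : S ∩ orb E C = orb E (C ∩ S) := by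
  refine Subset.antisymm ?_ (subset_inter (orb_subset hS inter_subset_right)
    (orb_subset (orb_inv C) (inter_subset_left.trans (subset_orb C))))
  rintro x ⟨hx, hx'⟩
  obtain ⟨h, y, hy, rfl⟩ := mem_iUnion.1 hx'
  exact mem_iUnion.2 ⟨h, y, ⟨hy, (hS.mem_iff h).1 hx⟩, rfl⟩

variable [TopologicalSpace M]

variable (k E) in
/-- Vanishing of the invariant cohomology of `S` in one degree. -/
def EVan (S : Set M) (j : ℕ) : Prop :=
  ∀ f : List M → k, EInv E f → cd k M f ∈ I k S (j + 1) → ∃ g, EInv E g ∧ f - cd k M g ∈ I k S j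

variable [ContinuousConstSMul E M]

theorem pull_mem_I (g : E) (hS : MapsTo (g • · : M → M) S T)
    (hf : f ∈ I k T j) : pull k (g • · : M → M) f ∈ I k S j :=
  pull_mem_IF (fun _ _ => (continuous_const_smul g).continuousAt) hS (mapsTo_univ _ _) hf

theorem EInv.sInv_van (hf : EInv E f) (hj : j ≠ 0) :
    SInv E (van univ f j) := by
  have key : ∀ g : E, (g • · : M → M) ⁻¹' van univ f j ⊆ van univ f j := by
    intro g
    have := pull_mem_I (S := (g • · : M → M) ⁻¹' van univ f j) g (mapsTo_preimage _ _)
      (fun _ => subset_rfl : f ∈ I k (van univ f j) j)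
    rw [hf g] at this
    exact this hj
  intro g x hx
  refine key g⁻¹ ?_
  simpa using hx

theorem isOpen_orb {C : Set M} (hC : IsOpen C) : IsOpen (orb E C) :=
  isOpen_iUnion fun g => (Homeomorph.smul g).isOpenMap _ hC

theorem isClosed_orb [Finite E] {C : Set M} (hC : IsClosed C) : IsClosed (orb E C) :=
  isClosed_iUnion_of_finite fun g => (Homeomorph.smul g).isClosedMap _ hC

/-- Normality with invariant sets. -/
theorem exists_inv_between [Finite E] [NormalSpace M] (hS : IsClosed S) (hT : IsOpen T)
    (hTi : SInv E T) (h : S ⊆ T) :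
    ∃ P, IsOpen P ∧ SInv E P ∧ S ⊆ P ∧ closure P ⊆ T ∧ SInv E (closure P) := by
  obtain ⟨P, hP, hSP, hPT⟩ := normal_exists_closure_subset hS hT h
  have hi := orb_inv (E := E) P
  refine ⟨orb E P, isOpen_orb hP, hi, hSP.trans (subset_orb P), ?_, fun g =>
    (hi g).closure (continuous_const_smul g)⟩
  exact (closure_minimal (iUnion_mono fun g => image_mono subset_closure)
    (isClosed_orb isClosed_closure)).trans (orb_subset hTi hPT)

theorem exists_inv_decomp [Finite E] [NormalSpace M] (hS : IsClosed S) (hT : IsClosed T)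
    (hTi : SInv E T) (hf : EInv E f) (h : f ∈ I k (S ∩ T) j) :
    ∃ a ∈ I k S j, ∃ b ∈ I k T j, EInv E a ∧ EInv E b ∧ a + b = f := by
  classical
  rcases eq_or_ne j 0 with rfl | hj
  · exact ⟨f, by rw [I, IF_zero]; trivial, 0, zero_mem _, hf, fun g => by rw [map_zero],
      add_zero f⟩
  have hO := isOpen_van univ f j
  have hOi := hf.sInv_van hj
  have hd : S \ van univ f j ⊆ (T \ van univ f j)ᶜ := fun x hx hx' =>
    hx.2 (h hj ⟨hx.1, hx'.1⟩)
  obtain ⟨P, hP, hPi, hSP, hPT, -⟩ := exists_inv_between (hS.sdiff hO) (hT.sdiff hO).isOpen_compl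
    (hTi.sdiff hOi).compl hd
  refine ⟨_, sub_cut_mem_of_isOpen (P := P) (f := f) hP fun x hx => ?_, _,
    cut_mem_of_closure (P := P) (f := f) fun x hx => ?_, hf.sub (hf.cut hPi), hf.cut hPi,
    sub_add_cancel _ _⟩
  · by_cases h : x ∈ van univ f j
    · exact Or.inl h
    · exact Or.inr (hSP ⟨hx, h⟩)
  · by_cases h : x ∈ van univ f j
    · exact Or.inl h
    · exact Or.inr fun h' => hPT h' ⟨hx, h⟩

theorem EVan.union [Finite E] [NormalSpace M] (hS : IsClosed S) (hT : IsClosed T)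
    (hTi : SInv E T) (h₁ : EVan k E S (j + 1)) (h₂ : EVan k E T (j + 1))
    (h₃ : EVan k E (S ∩ T) j) : EVan k E (S ∪ T) (j + 1) := by
  intro f hf hcf
  rw [I, IF_union] at hcf
  obtain ⟨g₁, hg₁, h₁⟩ := h₁ f hf hcf.1
  obtain ⟨g₂, hg₂, h₂⟩ := h₂ f hf hcf.2
  obtain ⟨w, hw, h₃⟩ := h₃ (g₁ - g₂) (hg₁.sub hg₂) (by
    have := sub_mem (IF_anti inter_subset_right h₂) (IF_anti inter_subset_left h₁)
    rwa [sub_sub_sub_cancel_left, ← map_sub] at this)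
  obtain ⟨a, ha, b, hb, -, hbi, hab⟩ := exists_inv_decomp hS hT hTi
    ((hg₁.sub hg₂).sub hw.cd) h₃
  refine ⟨g₂ + b, hg₂.add hbi, ?_⟩
  rw [I, IF_union]
  refine ⟨?_, ?_⟩
  · have := add_mem h₁ (cd_mem_IF ha)
    have e : g₂ + b = g₁ - cd k M w - a := by
      rw [eq_sub_iff_add_eq, add_assoc, add_comm b, hab]
      abel
    have e' : f - cd k M (g₂ + b) = f - cd k M g₁ + cd k M a := by
      simp only [e, map_sub, cd_cd]
      abel
    rwa [← e'] at this
  · have := sub_mem h₂ (cd_mem_IF hb)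
    rwa [sub_sub, ← map_add] at this

end Defs

section Free

variable [TopologicalSpace M] {n : ℕ} {C S X : Set M} {j : ℕ}

/-- A closed set with disjoint translates and with the cohomological dimension of a closed subset
of Euclidean space. -/
structure Small (k : Type v) [Field k] (E : Type w) [Group E] [MulAction E M] (n : ℕ)
    (C : Set M) : Prop where
  closed : IsClosed C
  disj : ∀ g : E, g ≠ 1 → Disjoint C ((g • · : M → M) '' C)
  van : ∀ S ⊆ C, IsClosed S → ∀ j, n + 2 ≤ j → Van k S j

theorem Small.mono (h : Small k E n C) {C' : Set M} (hC' : C' ⊆ C) (hc : IsClosed C') :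
    Small k E n C' :=
  ⟨hc, fun g hg => (h.disj g hg).mono hC' (image_mono hC'), fun S hS => h.van S (hS.trans hC')⟩

variable [ContinuousConstSMul E M]

theorem EInv.mem_orb {f : List M → k} (hf : EInv E f) (h : f ∈ I k C j) :
    f ∈ I k (orb E C) j := by
  intro hj
  exact orb_subset (hf.sInv_van hj) (h hj)

theorem Small.eVan [Finite E] [NormalSpace M] (h : Small k E n C) (hj : n + 2 ≤ j) :
    EVan k E (orb E C) j := by
  classical
  cases nonempty_fintype E
  intro f hf hcf
  obtain ⟨g₀, hg₀⟩ := h.van C subset_rfl h.closed j hj f (IF_anti (subset_orb C) hcf)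
  have hcl : IsClosed (⋃ g : {g : E // g ≠ 1}, (g.1 • · : M → M) '' C) :=
    isClosed_iUnion_of_finite fun g => (Homeomorph.smul g.1).isClosedMap _ h.closed
  obtain ⟨P, hP, hCP, hPc⟩ := normal_exists_closure_subset h.closed hcl.isOpen_compl (by
    refine Disjoint.subset_compl_right (disjoint_iUnion_right.2 fun g => h.disj g.1 g.2))
  let g₁ := cut (fun x => if x ∈ P then 1 else 0) g₀
  have h1 : g₀ - g₁ ∈ I k C (j - 1) :=
    sub_cut_mem_of_isOpen hP (hCP.trans subset_union_right)
  have h2 : ∀ g : E, g ≠ 1 → pull k (g • · : M → M) g₁ ∈ I k C (j - 1) := by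
    intro g hg
    refine pull_mem_I g (mapsTo_image _ _) (cut_mem_of_closure fun x hx => Or.inr fun hx' => ?_)
    exact hPc hx' (mem_iUnion.2 ⟨⟨g, hg⟩, hx⟩)
  refine ⟨∑ g : E, pull k (g • · : M → M) g₁, EInv.sum g₁,
    (hf.sub (EInv.sum g₁).cd).mem_orb ?_⟩
  have h3 : ∑ g ∈ Finset.univ.erase (1 : E), pull k (g • · : M → M) g₁ ∈ I k C (j - 1) :=
    sum_mem fun g hg => h2 g (Finset.ne_of_mem_erase hg)
  have h4 := cd_mem_IF (sub_mem h1 h3)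
  rw [show j - 1 + 1 = j by omega] at h4
  replace h4 := add_mem hg₀ h4
  rw [← Finset.add_sum_erase _ _ (Finset.mem_univ (1 : E)), pull_one_smul]
  convert h4 using 1
  simp only [map_sub, map_add]
  abel

theorem eVan_biUnion [Finite E] [NormalSpace M] {ι : Type*} (s : Finset ι) {C : ι → Set M}
    (h : ∀ i ∈ s, Small k E n (C i)) (hj : n + 3 ≤ j) :
    EVan k E (⋃ i ∈ s, orb E (C i)) j := by
  classical
  induction s using Finset.induction with
  | empty =>
    intro f _ _
    refine ⟨0, fun g => by rw [map_zero], ?_⟩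
    simp [I, IF_empty]
  | insert a s ha ih =>
    have hs : ∀ i ∈ s, Small k E n (C i) := fun i hi => h i (Finset.mem_insert_of_mem hi)
    have hc := h a (Finset.mem_insert_self a s)
    obtain ⟨j, rfl⟩ : ∃ j', j = j' + 1 := ⟨j - 1, by omega⟩
    have hcl : IsClosed (⋃ i ∈ s, orb E (C i)) :=
      isClosed_biUnion_finset fun i hi => isClosed_orb (hs i hi).closed
    have hi : SInv E (⋃ i ∈ s, orb E (C i)) := fun g x hx => by
      obtain ⟨i, hi, hx⟩ := mem_iUnion₂.1 hx
      exact mem_iUnion₂.2 ⟨i, hi, orb_inv _ g hx⟩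
    rw [Finset.set_biUnion_insert, union_comm]
    refine EVan.union hcl (isClosed_orb hc.closed) (orb_inv _) (ih hs) (hc.eVan (by omega)) ?_
    rw [orb_inter hi]
    exact (hc.mono inter_subset_left (hc.closed.inter hcl)).eVan (by omega)

/-- Locally Euclidean spaces. -/
def LocEuc (n : ℕ) (M : Type u) [TopologicalSpace M] : Prop :=
  ∀ x : M, ∃ φ : OpenPartialHomeomorph M (Fin n → ℝ), x ∈ φ.source

theorem LocEuc.exists_small [Finite E] [T2Space M] [CompactSpace M] (hM : LocEuc n M) {x : M}
    (hx : ∀ g : E, g • x = x → g = 1) : ∃ C ∈ 𝓝 x, Small k E n C := by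
  obtain ⟨φ, hφ⟩ := hM x
  have h1 : ∀ g : E, ∃ U ∈ 𝓝 x, g ≠ 1 → Disjoint U ((g • · : M → M) '' U) := by
    intro g
    by_cases hg : g = 1
    · exact ⟨univ, univ_mem, fun h => absurd hg h⟩
    obtain ⟨U, V, hU, hV, hUV⟩ := t2_separation_nhds (show x ≠ g • x from
      fun h => hg (hx g h.symm))
    refine ⟨U ∩ (g • · : M → M) ⁻¹' V, inter_mem hU
      ((continuous_const_smul g).continuousAt hV), fun _ => ?_⟩
    exact hUV.mono inter_subset_left (image_subset_iff.2 inter_subset_right)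
  choose U hU hd using h1
  obtain ⟨C, hC, hCc, hCU⟩ := exists_mem_nhds_isClosed_subset
    (inter_mem ((Filter.iInter_mem).2 hU) (φ.open_source.mem_nhds hφ))
  refine ⟨C, hC, hCc, fun g hg => ?_, fun S hS hSc j hj => ?_⟩
  · have : C ⊆ U g := hCU.trans (inter_subset_left.trans (iInter_subset U g))
    exact (hd g hg).mono this (image_mono this)
  · have hSs : S ⊆ φ.source := hS.trans (hCU.trans inter_subset_right)
    have e : φ.symm '' (φ '' S) = S := φ.symm_image_image_of_subset_source hSs
    have h2 : Van k (φ '' S) j := van_euclid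
      (hSc.isCompact.image_of_continuousOn (φ.continuousOn.mono hSs)) Finset.univ (by simp)
      (by simpa using hj)
    have h3 := CAcy.chart φ (S := φ '' S) (T := ∅)
      (image_subset_iff.2 fun x hx => φ.map_source (hSs hx)) (empty_subset _) (cAcy_empty_iff.2 h2)
    rw [e, image_empty, cAcy_empty_iff] at h3
    exact h3

theorem LocEuc.eVan [Finite E] [T2Space M] [CompactSpace M] (hM : LocEuc n M) (hS : IsClosed S)
    (hSi : SInv E S) (hfree : ∀ x ∈ S, ∀ g : E, g • x = x → g = 1) (hj : n + 3 ≤ j) :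
    EVan k E S j := by
  have h : ∀ x ∈ S, ∃ C ∈ 𝓝 x, Small k E n C := fun x hx => hM.exists_small (hfree x hx)
  choose! C hC hs using h
  obtain ⟨t, ht, hSt⟩ := hS.isCompact.elim_nhds_subcover C hC
  have := eVan_biUnion (E := E) t (C := fun x => C x ∩ S)
    (fun x hx => (hs x (ht x hx)).mono inter_subset_left ((hs x (ht x hx)).closed.inter hS)) hj
  have e : ⋃ i ∈ t, orb E (C i ∩ S) = S := by
    refine Subset.antisymm (iUnion₂_subset fun x _ => orb_subset hSi inter_subset_right) ?_
    intro x hx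
    obtain ⟨y, hy, hxy⟩ := mem_iUnion₂.1 (hSt hx)
    exact mem_iUnion₂.2 ⟨y, hy, subset_orb _ ⟨hxy, hx⟩⟩
  rwa [e] at this

/-- Relative vanishing of the invariant cohomology of a free action in high degrees. -/
theorem LocEuc.exists_inv [Finite E] [T2Space M] [CompactSpace M] (hM : LocEuc n M)
    (hX : IsClosed X) (hXi : SInv E X) (hS : IsClosed S)
    (hfree : ∀ x ∈ X \ S, ∀ g : E, g • x = x → g = 1) (hj : n + 4 ≤ j) {f : List M → k}
    (hf : EInv E f) (hfS : f ∈ I k S j) (hcf : cd k M f ∈ I k X (j + 1)) :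
    ∃ g ∈ I k S (j - 1), EInv E g ∧ f - cd k M g ∈ I k X j := by
  obtain ⟨j, rfl⟩ : ∃ j', j = j' + 1 := ⟨j - 1, by omega⟩
  have hO := isOpen_van univ f (j + 1)
  have hOi := hf.sInv_van (j := j + 1) (by omega)
  obtain ⟨P, hP, hPi, hSP, hPO, hPci⟩ := exists_inv_between hS hO hOi (hfS (by omega))
  have hQc : IsClosed (X \ P) := hX.sdiff hP
  have hQi : SInv E (X \ P) := hXi.sdiff hPi
  have hQf : ∀ x ∈ X \ P, ∀ g : E, g • x = x → g = 1 := fun x hx =>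
    hfree x ⟨hx.1, fun h => hx.2 (hSP h)⟩
  have hfW : f ∈ I k (closure P) (j + 1) := fun _ => hPO
  obtain ⟨g₂, hg₂, h₂⟩ := hM.eVan hQc hQi hQf (j := j + 1) (by omega) f hf
    (IF_anti sdiff_subset hcf)
  obtain ⟨w, hw, h₃⟩ := hM.eVan (hQc.inter isClosed_closure) (hQi.inter hPci)
    (fun x hx => hQf x hx.1) (j := j) (by omega) g₂ hg₂ (by
      have := sub_mem (IF_anti inter_subset_right hfW) (IF_anti inter_subset_left h₂)
      rwa [sub_sub_cancel] at this)
  obtain ⟨b, hb, a, ha, -, hai, hab⟩ := exists_inv_decomp hQc isClosed_closure hPci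
    (hg₂.sub hw.cd) h₃
  refine ⟨a, IF_anti (hSP.trans subset_closure) ha, hai, ?_⟩
  have e : X ⊆ (X \ P) ∪ closure P := fun x hx => by
    by_cases h : x ∈ P
    · exact Or.inr (subset_closure h)
    · exact Or.inl ⟨hx, h⟩
  refine IF_anti e ?_
  rw [IF_union]
  refine ⟨?_, sub_mem hfW (cd_mem_IF ha)⟩
  have := add_mem h₂ (cd_mem_IF hb)
  have e' : f - cd k M a = f - cd k M g₂ + cd k M b := by
    have := congrArg (cd k M) hab
    rw [map_add, map_sub, cd_cd, sub_zero] at this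
    rw [← this]
    abel
  rwa [e']

end Free

end MannSu

namespace MannSu

open scoped Topology
open Set Filter

universe u v w

theorem dvd_of_zpow_mem {p : ℕ} {G : Type w} [CommGroup G] (hp : p.Prime)
    (hG : ∀ g : G, g ^ p = 1) {K : Subgroup G} {g : G} (hg : g ∉ K) {m : ℤ} (hm : g ^ m ∈ K) :
    (p : ℤ) ∣ m := by
  by_contra hpm
  obtain ⟨a, b, hab⟩ := ((Nat.prime_iff_prime_int.1 hp).coprime_iff_not_dvd.2 hpm)
  refine hg ?_
  have : g = (g ^ m) ^ b := by
    conv_lhs => rw [← zpow_one g, ← hab, zpow_add, mul_comm a, zpow_mul, zpow_natCast, hG, one_zpow,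
      one_mul, mul_comm b, zpow_mul]
  rw [this]
  exact zpow_mem hm b

variable {k : Type v} [Field k] {M : Type u}

section Reps

variable {E : Type w} [Group E] [MulAction E M]

variable (M E) in
/-- Points with trivial stabilizer. -/
def freeLocus : Set M := {x | ∀ g : E, g • x = x → g = 1}

theorem mem_freeLocus {x : M} : x ∈ freeLocus M E ↔ ∀ g : E, g • x = x → g = 1 := Iff.rfl

theorem isOpen_freeLocus [TopologicalSpace M] [T2Space M] [Finite E] [ContinuousConstSMul E M] :
    IsOpen (freeLocus M E) := by
  have : freeLocus M E = ⋂ g : E, {x | g • x = x → g = 1} := by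
    ext x
    simp [mem_freeLocus]
  rw [this]
  refine isOpen_iInter_of_finite fun g => ?_
  by_cases hg : g = 1
  · simp [hg]
  · have := (isClosed_eq (continuous_const_smul (T := M) g) continuous_id).isOpen_compl
    convert this using 1
    ext x
    simp [hg]

variable (M E) in
theorem exists_reps : ∃ P : Set M, ∀ x ∈ freeLocus M E, ∃! g : E, g • x ∈ P := by
  refine ⟨range (Quotient.out : MulAction.orbitRel.Quotient E M → M), fun x hx => ?_⟩
  have h1 : ∀ g : E, g • x ∈ range (Quotient.out : MulAction.orbitRel.Quotient E M → M) →
      g • x = (Quotient.mk'' x : MulAction.orbitRel.Quotient E M).out := by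
    rintro g ⟨q, hq⟩
    rw [← hq]
    congr 1
    rw [← Quotient.out_eq' q, hq, Quotient.eq'']
    exact ⟨g, rfl⟩
  obtain ⟨g, hg⟩ : (Quotient.mk'' x : MulAction.orbitRel.Quotient E M).out ∈
      MulAction.orbit E x := by
    rw [← MulAction.orbitRel_apply, ← Quotient.eq'', Quotient.out_eq']
  refine ⟨g, ⟨_, hg.symm⟩, fun h hh => ?_⟩
  have h2 := (h1 h hh).trans hg.symm
  have := hx (g⁻¹ * h) (by rw [mul_smul, h2]; exact inv_smul_smul g x)
  rw [inv_mul_eq_one] at this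
  exact this.symm

theorem sub_mem_I_of_free [TopologicalSpace M] [T2Space M] [Finite E] [ContinuousConstSMul E M]
    {X S : Set M} (hXS : X \ S ⊆ freeLocus M E) {j : ℕ} {f u : List M → k} (hf : f ∈ I k S j)
    (hu : u ∈ I k S j) (h : ∀ x ∈ freeLocus M E, ∀ l, f (x :: l) = u (x :: l)) :
    f - u ∈ I k X j := by
  intro hj x hx
  by_cases hxS : x ∈ S
  · exact sub_mem hf hu hj hxS
  · refine mem_van_of_forall (isOpen_freeLocus.mem_nhds (hXS ⟨hx, hxS⟩)) fun l hl hl' => ?_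
    match l, hl with
    | [], hl => exact absurd hl.symm hj
    | x :: l, _ => rw [Pi.sub_apply, h x (hl' x (by simp)), sub_self]

end Reps

theorem exists_dual_comp_eq {P Q : Type*} [AddCommGroup P] [Module k P] [AddCommGroup Q]
    [Module k Q] (c : P →ₗ[k] Q) (z : P →ₗ[k] k) (h : ∀ x, c x = 0 → z x = 0) :
    ∃ y : Q →ₗ[k] k, ∀ x, y (c x) = z x := by
  have : z ∈ LinearMap.range c.dualMap := by
    rw [LinearMap.range_dualMap_eq_dualAnnihilator_ker]
    exact (Submodule.mem_dualAnnihilator _).2 h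
  obtain ⟨y, rfl⟩ := this
  exact ⟨y, fun _ => rfl⟩

variable [TopologicalSpace M] {p : ℕ} {G : Type w} [CommGroup G] [MulAction G M]
  [ContinuousConstSMul G M] {n : ℕ} {hG : ∀ g : G, g ^ p = 1}

instance subgroup_continuousConstSMul (E : Subgroup G) : ContinuousConstSMul E M :=
  ⟨fun g => continuous_const_smul (g : G)⟩

/-- Homological form of the vanishing theorem for free actions. -/
theorem exists_fx_bounding [Finite G] [T2Space M] [CompactSpace M] (hM : LocEuc n M) {X S : Set M}
    (E : Subgroup G) (hX : IsClosed X) (hXi : SInv E X) (hS : IsClosed S)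
    (hSi : SInv E S) (hfree : X \ S ⊆ freeLocus M E) {j : ℕ} (hj : n + 4 ≤ j)
    {z : Module.Dual k (List M → k)} (hz : z ∈ A k X j)
    (hzi : ∀ h ∈ E, (AS k M hG).ρ h z - z ∈ A k S j)
    (hzd : (AS k M hG).d z ∈ A k S (j - 1)) :
    ∃ y ∈ A k X (j + 1), (∀ h ∈ E, (AS k M hG).ρ h y - y ∈ A k S (j + 1)) ∧
      z - (AS k M hG).d y ∈ A k S j := by
  classical
  cases nonempty_fintype E
  let ν : (List M → k) →ₗ[k] (List M → k) := ∑ h : E, pull k (h • · : M → M)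
  have hν : ∀ f, ν f = ∑ h : E, pull k (h • · : M → M) f := fun f => by simp [ν]
  have hνI : ∀ i, ∀ f ∈ I k X i, ν f ∈ I k X i := fun i f hf => by
    rw [hν]
    exact sum_mem fun h _ => pull_mem_I h (hXi h) hf
  have hνS : ∀ i, ∀ f ∈ I k S i, ν f ∈ I k S i := fun i f hf => by
    rw [hν]
    exact sum_mem fun h _ => pull_mem_I h (hSi h) hf
  have hνd : ∀ f, ν (cd k M f) = cd k M (ν f) := fun f => by simp only [hν, map_sum, cd_pull]
  let T : Submodule k (List M → k) :=
    I k X (j + 1) ⊔ ⨆ h : E, (I k S (j + 1)).map (pull k (h • · : M → M) - 1)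
  have hνT : T ≤ (I k X (j + 1)).comap ν := by
    refine sup_le (fun f hf => hνI _ f hf) (iSup_le fun h => ?_)
    rw [Submodule.map_le_iff_le_comap]
    intro f _
    have : ν (pull k (h • · : M → M) f - f) = 0 := by
      rw [map_sub, hν, hν, sub_eq_zero]
      simp only [pull_smul_smul]
      exact Fintype.sum_equiv (Equiv.mulLeft h) _ _ fun _ => rfl
    change ν (pull k (h • · : M → M) f - f) ∈ I k X (j + 1)
    rw [this]
    exact zero_mem _
  obtain ⟨P, hP⟩ := exists_reps M E
  let e := cut (k := k) (fun x => if x ∈ P then 1 else 0)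
  have hsum : ∀ x ∈ freeLocus M E, ∑ h : E, (if h • x ∈ P then (1 : k) else 0) = 1 := by
    intro x hx
    obtain ⟨g, hg, hu⟩ := hP x hx
    rw [Finset.sum_eq_single g (fun b _ hb => if_neg fun h => hb (hu b h)) (by simp), if_pos hg]
  have hz' : ∀ f ∈ I k S j, ν f ∈ I k X j → z f = 0 := by
    intro f hf hνf
    have h1 : f - ∑ h : E, pull k (h • · : M → M) (e (pull k (h⁻¹ • · : M → M) f)) ∈ I k X j := by
      refine sub_mem_I_of_free hfree hf (sum_mem fun h _ => pull_mem_I h (hSi h)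
        (cut_mem_IF _ (pull_mem_I h⁻¹ (hSi _) hf))) fun x hx l => ?_
      rw [Finset.sum_apply]
      simp only [pull_apply, e, cut_apply, List.map_cons, List.head?_cons, Option.elim_some,
        inv_smul_smul, List.map_map, Function.comp_def, List.map_id']
      rw [← Finset.sum_mul, hsum x hx, one_mul]
    have h2 := mem_AF.1 hz _ h1
    rw [map_sub, sub_eq_zero] at h2
    rw [h2, map_sum]
    have h3 : ∀ h : E, z (pull k (h • · : M → M) (e (pull k (h⁻¹ • · : M → M) f))) =
        z (e (pull k (h⁻¹ • · : M → M) f)) := by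
      intro h
      have := mem_AF.1 (hzi h h.2) _ (cut_mem_IF (fun x => if x ∈ P then 1 else 0)
        (pull_mem_I h⁻¹ (hSi _) hf))
      rw [LinearMap.sub_apply, sub_eq_zero] at this
      exact this
    have h4 : ∑ h : E, pull k (h⁻¹ • · : M → M) f = ν f := by
      rw [hν]
      exact Fintype.sum_equiv (Equiv.inv E) _ _ fun _ => rfl
    rw [Finset.sum_congr rfl fun h _ => h3 h, ← map_sum, ← map_sum, h4]
    exact mem_AF.1 hz _ (cut_mem_IF _ hνf)
  have key : ∀ f ∈ I k S j, cd k M f ∈ T → z f = 0 := by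
    intro f hf hcf
    have h1 : cd k M (ν f) ∈ I k X (j + 1) := by
      rw [← hνd]
      exact hνT hcf
    have hνi : EInv E (ν f) := by
      rw [hν]
      exact EInv.sum f
    obtain ⟨g, hg, hgi, hfg⟩ := hM.exists_inv hX hXi hS (fun x hx => hfree hx) hj hνi
      (hνS _ f hf) h1
    have he : e g ∈ I k S (j - 1) := cut_mem_IF _ hg
    have h2 : g - ν (e g) ∈ I k X (j - 1) := by
      refine sub_mem_I_of_free hfree hg (hνS _ _ he) fun x hx l => ?_
      rw [hν, Finset.sum_apply]
      have h3 : ∀ h : E, pull k (h • · : M → M) (e g) (x :: l) =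
          (if h • x ∈ P then 1 else 0) * g (x :: l) := by
        intro h
        rw [← congrFun (hgi h) (x :: l)]
        simp [e, cut_apply]
      rw [Finset.sum_congr rfl fun h _ => h3 h, ← Finset.sum_mul, hsum x hx, one_mul]
    have hcd : ∀ i u, u ∈ I k i (j - 1) → cd k M u ∈ I k i j := by
      intro i u hu
      have := cd_mem_IF hu
      rwa [show j - 1 + 1 = j by omega] at this
    have h4 : z (f - cd k M (e g)) = 0 := by
      refine hz' _ (sub_mem hf (hcd _ _ he)) ?_
      have := add_mem hfg (hcd _ _ h2)
      rw [map_sub, hνd]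
      convert this using 1
      rw [map_sub]
      abel
    have h5 : z (cd k M (e g)) = 0 := mem_AF.1 hzd _ he
    rwa [map_sub, h5, sub_zero] at h4
  obtain ⟨y, hy⟩ := exists_dual_comp_eq (T.mkQ ∘ₗ cd k M ∘ₗ (I k S j).subtype)
    (z ∘ₗ (I k S j).subtype) (by
      rintro ⟨f, hf⟩ h
      refine key f hf ?_
      rwa [LinearMap.comp_apply, LinearMap.comp_apply, Submodule.mkQ_apply,
        Submodule.Quotient.mk_eq_zero] at h)
  have hyT : ∀ f ∈ T, y (T.mkQ f) = 0 := fun f hf => by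
    rw [Submodule.mkQ_apply, (Submodule.Quotient.mk_eq_zero _).2 hf, map_zero]
  refine ⟨y ∘ₗ T.mkQ, mem_AF.2 fun f hf => hyT f (Submodule.mem_sup_left hf), fun h hh =>
    mem_AF.2 fun f hf => ?_, mem_AF.2 fun f hf => ?_⟩
  · rw [LinearMap.sub_apply, AS_ρ_apply, ← map_sub]
    exact hyT _ (Submodule.mem_sup_right (Submodule.mem_iSup_of_mem ⟨h, hh⟩
      (Submodule.mem_map_of_mem (f := pull k ((⟨h, hh⟩ : E) • · : M → M) - 1) hf)))
  · rw [LinearMap.sub_apply, sub_eq_zero]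
    exact (hy ⟨f, hf⟩).symm

/-- The operator attached to a fundamental domain. -/
theorem exists_freeOp (hp : p.Prime) [T2Space M] [Finite G] (E : Subgroup G) :
    ∀ K ≤ E, ∀ g ∈ E, g ∉ K → ∃ e : Module.End k (Module.Dual k (List M → k)),
      (∀ S j, ∀ x ∈ A k S j, e x ∈ A k S j) ∧
      (∀ h ∈ K, ∀ x, (AS k M hG).ρ h (e x) = e ((AS k M hG).ρ h x)) ∧
      ∀ X S j, SInv E S → X \ S ⊆ freeLocus M E → ∀ x ∈ A k X j,
        ∑ i ∈ Finset.range p, (AS k M hG).ρ (g ^ i) (e ((AS k M hG).ρ (g ^ i)⁻¹ x)) - x ∈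
          A k S j := by
  classical
  intro K hK g hg hgK
  let L := K ⊔ Subgroup.zpowers g
  have hL : L ≤ E := sup_le hK ((Subgroup.zpowers_le).2 hg)
  obtain ⟨P, hP⟩ := exists_reps M L
  let χ : M → k := fun x => if ∃ h ∈ K, h • x ∈ P then 1 else 0
  have hχK : ∀ h ∈ K, ∀ x, χ (h • x) = χ x := by
    intro h hh x
    have : (∃ h' ∈ K, h' • h • x ∈ P) ↔ ∃ h' ∈ K, h' • x ∈ P := by
      constructor
      · rintro ⟨h', hh', hx⟩
        exact ⟨h' * h, mul_mem hh' hh, by rwa [mul_smul]⟩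
      · rintro ⟨h', hh', hx⟩
        exact ⟨h' * h⁻¹, mul_mem hh' (inv_mem hh), by rwa [mul_smul, inv_smul_smul]⟩
    simp only [χ, this]
  have hpow : ∀ m : ℤ, (p : ℤ) ∣ m → g ^ m = 1 := by
    rintro _ ⟨m, rfl⟩
    rw [zpow_mul, zpow_natCast, hG, one_zpow]
  have hgen : ∀ m : ℤ, g ^ m ∈ K → (p : ℤ) ∣ m := fun m => dvd_of_zpow_mem hp hG hgK
  have hχ : ∀ x ∈ freeLocus M E, ∑ i ∈ Finset.range p, χ ((g ^ i)⁻¹ • x) = 1 := by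
    intro x hx
    have hxL : x ∈ freeLocus M L := fun l hl => by
      have := hx ⟨l, hL l.2⟩ hl
      exact Subtype.ext (congrArg (fun e : E => (e : G)) this)
    obtain ⟨⟨l, hl⟩, hlP, hu⟩ := hP x hxL
    obtain ⟨a, ha, b, hb, rfl⟩ := Subgroup.mem_sup.1 hl
    obtain ⟨m, rfl⟩ := Subgroup.mem_zpowers_iff.1 hb
    have hp0 : (0 : ℤ) < p := by exact_mod_cast hp.pos
    have hi0 := Int.emod_nonneg (-m) hp0.ne'
    have hi1 := Int.emod_lt_of_pos (-m) hp0
    obtain ⟨i, hi⟩ := Int.eq_ofNat_of_zero_le hi0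
    have hdvd : (p : ℤ) ∣ m + i := by
      rw [← hi]
      have := Int.dvd_self_sub_emod (x := -m) (m := p)
      have h2 := (Int.dvd_neg).2 this
      convert h2 using 1
      ring
    have hgi : g ^ m = (g ^ i)⁻¹ := by
      rw [eq_inv_iff_mul_eq_one, ← zpow_natCast, ← zpow_add]
      exact hpow _ hdvd
    rw [Finset.sum_eq_single i]
    · refine if_pos ⟨a, ha, ?_⟩
      rw [← mul_smul, ← hgi]
      exact hlP
    · intro i' hi' hne
      refine if_neg ?_
      rintro ⟨h, hh, hhP⟩
      rw [← mul_smul] at hhP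
      have h1 := hu ⟨h * (g ^ i')⁻¹, mul_mem (Subgroup.mem_sup_left hh) (inv_mem
        (Subgroup.mem_sup_right (pow_mem (Subgroup.mem_zpowers g) i')))⟩ hhP
      have h2 : h * (g ^ i')⁻¹ = a * g ^ m := congrArg Subtype.val h1
      have h3 : g ^ (m + i') = a⁻¹ * h := by
        rw [zpow_add, zpow_natCast, eq_inv_mul_iff_mul_eq, ← mul_assoc, ← h2,
          inv_mul_cancel_right]
      have h4 := hgen _ (h3 ▸ mul_mem (inv_mem ha) hh)
      have h5 := dvd_sub h4 hdvd
      rw [add_sub_add_left_eq_sub] at h5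
      have h6 : ((i' : ℤ) - i).natAbs < p := by
        have := Finset.mem_range.1 hi'
        omega
      have h7 := Int.eq_zero_of_dvd_of_natAbs_lt_natAbs h5 (by simpa using h6)
      omega
    · intro h
      rw [Finset.mem_range] at h
      omega
  refine ⟨(cut χ).dualMap, fun S j x hx => mem_AF.2 fun f hf => mem_AF.1 hx _ (cut_mem_IF χ hf),
    fun h hh x => ?_, fun X S j hSi hfree x hx => mem_AF.2 fun f hf => ?_⟩
  · ext f
    rw [AS_ρ_apply, LinearMap.dualMap_apply, LinearMap.dualMap_apply, AS_ρ_apply]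
    congr 1
    ext l
    cases l with
    | nil => simp [cut_apply]
    | cons y l => simp [cut_apply, hχK h hh]
  · let F : List M → k := ∑ i ∈ Finset.range p,
      pull k ((g ^ i)⁻¹ • · : M → M) (cut χ (pull k ((g ^ i) • · : M → M) f))
    have hgE : ∀ i, g ^ i ∈ E := fun i => pow_mem hg i
    have hF : F ∈ I k S j := sum_mem fun i _ => pull_mem_I _
      (hSi (⟨_, inv_mem (hgE i)⟩ : E)) (cut_mem_IF χ (pull_mem_I _ (hSi (⟨_, hgE i⟩ : E)) hf))
    have h1 : F - f ∈ I k X j := by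
      refine sub_mem_I_of_free hfree hF hf fun y hy l => ?_
      rw [← one_mul (f _), ← hχ y hy, Finset.sum_mul]
      refine (Finset.sum_apply _ _ _).trans ?_
      refine Finset.sum_congr rfl fun i _ => ?_
      simp [cut_apply, Function.comp_def]
    have h2 := mem_AF.1 hx _ h1
    rw [LinearMap.sub_apply, LinearMap.sum_apply, sub_eq_zero]
    rw [map_sub, sub_eq_zero, map_sum] at h2
    exact h2

end MannSu

namespace MannSu

open scoped Topology
open Set Filter

universe u v w

theorem SInv.subgroup {M : Type u} {G : Type w} [Group G] [MulAction G M] {S : Set M}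
    (h : SInv G S) (E : Subgroup G) : SInv E S := fun g => h (g : G)

theorem compl_orb_mem {M : Type u} {G : Type w} [Group G] [MulAction G M] [Finite G]
    {𝓕 : Filter M} (h𝓕 : ∀ g : G, Tendsto (g • · : M → M) 𝓕 𝓕) {Z : Set M}
    (hZF : Zᶜ ∈ 𝓕) : (orb G Z)ᶜ ∈ 𝓕 := by
  have : ⋂ g : G, (g • · : M → M) ⁻¹' Zᶜ ∈ 𝓕 := iInter_mem.2 fun g => h𝓕 g hZF
  refine mem_of_superset this fun x hx hxo => ?_
  obtain ⟨g, y, hy, rfl⟩ := mem_iUnion.1 hxo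
  have := mem_iInter.1 hx g⁻¹
  exact this (by simpa using hy)


variable {k : Type v} [Field k] {M : Type u} [TopologicalSpace M]

section Filters

variable {𝓕 : Filter M} {S T X : Set M} {j : ℕ}

variable (k 𝓕) in
/-- Functionals supported away from `𝓕`. -/
def LO (j : ℕ) : Submodule k (Module.Dual k (List M → k)) where
  carrier := {l | ∃ Z, IsClosed Z ∧ Zᶜ ∈ 𝓕 ∧ l ∈ A k Z j}
  zero_mem' := ⟨∅, isClosed_empty, by simp, zero_mem _⟩
  add_mem' := by
    rintro a b ⟨Z, hZ, hZF, ha⟩ ⟨Z', hZ', hZF', hb⟩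
    exact ⟨Z ∪ Z', hZ.union hZ', by rw [compl_union]; exact inter_mem hZF hZF',
      add_mem (AF_mono subset_union_left _ ha) (AF_mono subset_union_right _ hb)⟩
  smul_mem' := by
    rintro c a ⟨Z, hZ, hZF, ha⟩
    exact ⟨Z, hZ, hZF, Submodule.smul_mem _ c ha⟩

theorem mem_LO {l : Module.Dual k (List M → k)} :
    l ∈ LO k 𝓕 j ↔ ∃ Z, IsClosed Z ∧ Zᶜ ∈ 𝓕 ∧ l ∈ A k Z j := Iff.rfl

variable (k 𝓕) in
/-- Functionals supported near `S`, up to functionals supported away from `𝓕`. -/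
def LF (S : Set M) (j : ℕ) : Submodule k (Module.Dual k (List M → k)) := A k S j ⊔ LO k 𝓕 j

theorem mem_LF {l : Module.Dual k (List M → k)} :
    l ∈ LF k 𝓕 S j ↔ ∃ Z, IsClosed Z ∧ Zᶜ ∈ 𝓕 ∧ l ∈ A k (S ∪ Z) j := by
  constructor
  · intro h
    obtain ⟨a, ha, b, ⟨Z, hZ, hZF, hb⟩, rfl⟩ := Submodule.mem_sup.1 h
    exact ⟨Z, hZ, hZF, add_mem (AF_mono subset_union_left _ ha) (AF_mono subset_union_right _ hb)⟩
  · rintro ⟨Z, hZ, hZF, h⟩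
    rw [A_union] at h
    obtain ⟨a, ha, b, hb, rfl⟩ := Submodule.mem_sup.1 h
    exact Submodule.add_mem_sup ha (mem_LO.2 ⟨Z, hZ, hZF, hb⟩)

theorem LF_mono (h : S ⊆ T) : LF k 𝓕 S ≤ LF k 𝓕 T := fun j => sup_le_sup_right (AF_mono h j) _

theorem A_le_LF : A k S ≤ LF k 𝓕 S := fun _ => le_sup_left

theorem LF_empty : LF k 𝓕 ∅ j = LO k 𝓕 j := by
  rw [LF, A, AF_empty, bot_sup_eq]

theorem LO_le_LF : LO k 𝓕 ≤ LF k 𝓕 S := fun _ => le_sup_right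

theorem LF_zero : LF k 𝓕 S 0 = ⊥ := by
  rw [eq_bot_iff]
  intro l hl
  obtain ⟨Z, -, -, h⟩ := mem_LF.1 hl
  rwa [A, AF_zero] at h

theorem LF_union : LF k 𝓕 (S ∪ T) j = LF k 𝓕 S j ⊔ LF k 𝓕 T j := by
  rw [LF, LF, LF, A_union, sup_sup_distrib_right]

theorem LF_inter [NormalSpace M] (hS : IsClosed S) (hT : IsClosed T) :
    LF k 𝓕 (S ∩ T) j = LF k 𝓕 S j ⊓ LF k 𝓕 T j := by
  refine le_antisymm (le_inf (LF_mono inter_subset_left j) (LF_mono inter_subset_right j)) ?_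
  rintro l ⟨h1, h2⟩
  obtain ⟨Z, hZ, hZF, h1⟩ := mem_LF.1 h1
  obtain ⟨Z', hZ', hZF', h2⟩ := mem_LF.1 h2
  refine mem_LF.2 ⟨Z ∪ Z', hZ.union hZ', by rw [compl_union]; exact inter_mem hZF hZF', ?_⟩
  rw [inter_union_distrib_right, A_inter (hS.union (hZ.union hZ')) (hT.union (hZ.union hZ'))]
  exact ⟨AF_mono (union_subset_union_right _ subset_union_left) _ h1,
    AF_mono (union_subset_union_right _ subset_union_right) _ h2⟩

theorem LF_top : LF k ⊤ S = A k S := by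
  funext j
  refine le_antisymm (fun l hl => ?_) (A_le_LF j)
  obtain ⟨Z, -, hZF, h⟩ := mem_LF.1 hl
  rw [mem_top, compl_univ_iff] at hZF
  rwa [hZF, union_empty] at h

end Filters

section Action

variable {p : ℕ} {G : Type w} [CommGroup G] [MulAction G M]
  {n : ℕ} {hG : ∀ g : G, g ^ p = 1} {𝓕 : Filter M} {S T X : Set M}

theorem LF_d_mem {l : Module.Dual k (List M → k)} {j : ℕ} (hl : l ∈ LF k 𝓕 S (j + 1)) :
    (AS k M hG).d l ∈ LF k 𝓕 S j := by
  obtain ⟨Z, hZ, hZF, h⟩ := mem_LF.1 hl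
  exact mem_LF.2 ⟨Z, hZ, hZF, AF_d_mem h⟩

variable [ContinuousConstSMul G M]

theorem LF_ρ_mem {l : Module.Dual k (List M → k)} {j : ℕ} (g : G)
    (h𝓕 : ∀ g : G, Tendsto (g • · : M → M) 𝓕 𝓕) (hS : SInv G S) (hl : l ∈ LF k 𝓕 S j) :
    (AS k M hG).ρ g l ∈ LF k 𝓕 S j := by
  obtain ⟨Z, hZ, hZF, h⟩ := mem_LF.1 hl
  refine mem_LF.2 ⟨(g⁻¹ • · : M → M) ⁻¹' Z, hZ.preimage (continuous_const_smul _),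
    h𝓕 g⁻¹ hZF, AF_ρ_mem g ?_ (mapsTo_univ _ _) h⟩
  rintro x (hx | hx)
  · exact Or.inl (hS g hx)
  · refine Or.inr ?_
    change g⁻¹ • g • x ∈ Z
    rwa [inv_smul_smul]

theorem isSub_LF (h𝓕 : ∀ g : G, Tendsto (g • · : M → M) 𝓕 𝓕) (hS : SInv G S) :
    (AS k M hG).IsSub (LF k 𝓕 S) where
  zero := LF_zero
  d_mem h := LF_d_mem h
  ρ_mem g h := LF_ρ_mem g h𝓕 hS h

theorem mem_LF_inv [Finite G] (h𝓕 : ∀ g : G, Tendsto (g • · : M → M) 𝓕 𝓕)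
    {l : Module.Dual k (List M → k)} {j : ℕ} (hl : l ∈ LF k 𝓕 S j) :
    ∃ Z, IsClosed Z ∧ Zᶜ ∈ 𝓕 ∧ SInv G Z ∧ l ∈ A k (S ∪ Z) j := by
  obtain ⟨Z, hZ, hZF, h⟩ := mem_LF.1 hl
  exact ⟨orb G Z, isClosed_orb hZ, compl_orb_mem h𝓕 hZF, orb_inv Z,
    AF_mono (union_subset_union_right _ (subset_orb Z)) _ h⟩

/-- Iterated equivariant homology of a free pair vanishes in high degrees. -/
theorem HPhi_LF_eq_zero (hp : p.Prime) [T2Space M] [CompactSpace M] [Finite G] (hM : LocEuc n M)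
    (h𝓕 : ∀ g : G, Tendsto (g • · : M → M) 𝓕 𝓕) (hX : IsClosed X) (hXi : SInv G X)
    (hS : IsClosed S) (hSi : SInv G S) (hSX : S ⊆ X) (E : Subgroup G)
    (hfree : X \ S ⊆ freeLocus M E) {l : List G} (hl : ∀ g ∈ l, g ∈ E) (hi : Amb.Indep ⊥ l)
    {j : ℕ} (hj : n + 4 ≤ j) : Amb.HPhi l (AS k M hG) (LF k 𝓕 X) (LF k 𝓕 S) j = 0 := by
  have hfree' : ∀ Z, (X ∪ Z) \ (S ∪ Z) ⊆ freeLocus M E := fun Z x hx =>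
    hfree ⟨hx.1.resolve_right fun h => hx.2 (Or.inr h), fun h => hx.2 (Or.inl h)⟩
  obtain ⟨K, hK, h⟩ := Amb.HPhi_le_fx (D := AS k M hG) (E := E) (H := ⊥) hp.ne_zero l
    (isSub_LF h𝓕 hXi) (isSub_LF h𝓕 hSi) (LF_mono hSX) bot_le hl hi (by
      intro K hK g hg hgK
      obtain ⟨e, he1, he2, he3⟩ := exists_freeOp (k := k) (M := M) (hG := hG) hp E K hK g hg hgK
      have hmem : ∀ {S j x}, x ∈ LF k 𝓕 S j → e x ∈ LF k 𝓕 S j := by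
        intro S j x hx
        obtain ⟨Z, hZ, hZF, h⟩ := mem_LF.1 hx
        exact mem_LF.2 ⟨Z, hZ, hZF, he1 _ _ _ h⟩
      refine ⟨e, ⟨fun _ _ => hmem, fun _ _ => hmem, he2, fun j x hx => ?_⟩⟩
      obtain ⟨Z, hZ, hZF, hZi, h⟩ := mem_LF_inv h𝓕 hx
      exact mem_LF.2 ⟨Z, hZ, hZF, he3 _ (S ∪ Z) j ((hSi.union hZi).subgroup E) (hfree' Z) x h⟩)
  rw [Amb.fx_bot] at h
  refine le_antisymm ((h j).trans_eq ?_) bot_le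
  rw [Amb.H_eq_zero_iff]
  intro z hz hzd
  obtain ⟨hz, hzi⟩ := Amb.mem_fx.1 hz
  obtain ⟨Z₁, hZ₁, hZF₁, hZi₁, h₁⟩ := mem_LF_inv h𝓕 hz
  obtain ⟨Z₂, hZ₂, hZF₂, hZi₂, h₂⟩ := mem_LF_inv h𝓕 hzd
  have h₃ : ∀ g : G, ∃ Z, IsClosed Z ∧ Zᶜ ∈ 𝓕 ∧ SInv G Z ∧
      (g ∈ K → (AS k M hG).ρ g z - z ∈ A k (S ∪ Z) j) := by
    intro g
    by_cases hg : g ∈ K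
    · obtain ⟨Z, h1, h2, h3, h4⟩ := mem_LF_inv h𝓕 (hzi g hg)
      exact ⟨Z, h1, h2, h3, fun _ => h4⟩
    · exact ⟨∅, isClosed_empty, by simp, fun g x hx => hx.elim, fun h => absurd h hg⟩
  choose Z₃ hZ₃ hZF₃ hZi₃ h₃ using h₃
  let Z := Z₁ ∪ (Z₂ ∪ ⋃ g, Z₃ g)
  have hZ : IsClosed Z := hZ₁.union (hZ₂.union (isClosed_iUnion_of_finite hZ₃))
  have hZF : Zᶜ ∈ 𝓕 := by
    simp only [Z, compl_union, compl_iUnion]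
    exact inter_mem hZF₁ (inter_mem hZF₂ (iInter_mem.2 hZF₃))
  have hZi : SInv G Z := hZi₁.union (hZi₂.union fun g x hx => by
    obtain ⟨i, hi⟩ := mem_iUnion.1 hx
    exact mem_iUnion.2 ⟨i, hZi₃ i g hi⟩)
  have m1 : Z₁ ⊆ Z := subset_union_left
  have m2 : Z₂ ⊆ Z := subset_union_left.trans subset_union_right
  have m3 : ∀ g, Z₃ g ⊆ Z := fun g =>
    (subset_iUnion Z₃ g).trans (subset_union_right.trans subset_union_right)
  obtain ⟨y, hy, hyi, hyz⟩ := exists_fx_bounding (k := k) (hG := hG) hM K (hX.union hZ)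
    ((hXi.union hZi).subgroup K)
    (hS.union hZ) ((hSi.union hZi).subgroup K)
    (fun x hx g hg => by
      have := hfree' Z hx ⟨g, hK g.2⟩ hg
      exact Subtype.ext (congrArg (fun e : E => (e : G)) this)) hj
    (AF_mono (union_subset_union_right _ m1) _ h₁)
    (fun g hg => AF_mono (union_subset_union_right _ (m3 g)) _ (h₃ g hg))
    (AF_mono (union_subset_union_right _ m2) _ h₂)
  exact ⟨y, Amb.mem_fx.2 ⟨mem_LF.2 ⟨Z, hZ, hZF, hy⟩,
    fun g hg => mem_LF.2 ⟨Z, hZ, hZF, hyi g hg⟩⟩, mem_LF.2 ⟨Z, hZ, hZF, hyz⟩⟩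

end Action

end MannSu

namespace MannSu

open scoped Topology
open Set Filter

universe u v w

variable {k : Type v} [Field k] {M : Type u}

namespace Amb

variable {p : ℕ} {G : Type w} [CommGroup G] {D : Amb.{u} k p G} {A B C K O : ℕ → Submodule k D.V}

theorem H_phi_add_two (g : G) (ε j : ℕ) :
    (D.phi g (ε + 2)).H (D.fam A) (D.fam B) j = (D.phi g ε).H (D.fam A) (D.fam B) j := by
  have : D.phiD g (ε + 2) = D.phiD g ε := by
    refine LinearMap.ext fun f => funext fun a => ?_
    rw [phiD_apply, phiD_apply, ← add_assoc, th_add_two]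
  change relLen (D.fam A j ⊓ (D.fam B (j - 1)).comap (D.phiD g (ε + 2)))
    (D.fam B j ⊔ (D.fam A (j + 1)).map (D.phiD g (ε + 2))) = _
  rw [this]
  rfl

theorem H_phi_eq_zero_of_le (hA : D.IsSub A) (hB : D.IsSub B) {g : G} {N : ℕ}
    (h : ∀ j ≥ N, D.H A B j = 0) (h0 : ∀ j ≥ N, (D.phi g 0).H (D.fam A) (D.fam B) j = 0) :
    ∀ ε, ∀ j ≥ N + 1, (D.phi g ε).H (D.fam A) (D.fam B) j = 0
  | 0, j, hj => h0 j (by omega)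
  | 1, j, hj => by
    obtain ⟨j, rfl⟩ : ∃ i, j = i + 1 := ⟨j - 1, by omega⟩
    refine le_antisymm ((H_phi_le D A B hA hB g 1 j).trans_eq ?_) bot_le
    rw [h _ (by omega), H_phi_add_two, h0 _ (by omega), add_zero]
  | ε + 2, j, hj => by
    rw [H_phi_add_two]
    exact H_phi_eq_zero_of_le hA hB h h0 ε j hj

theorem H_phi_eq_zero (hA : D.IsSub A) (hB : D.IsSub B) {g : G}
    (h : ∀ j, D.H A B j = 0) (ε j : ℕ) : (D.phi g ε).H (D.fam A) (D.fam B) j = 0 := by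
  refine le_antisymm ((H_phi_le_psum A B hA hB g ε j).trans_eq ?_) bot_le
  exact Finset.sum_eq_zero fun i _ => h i

end Amb

section Retract

variable [TopologicalSpace M]

theorem exists_retract [CompactSpace M] [TopologicalSpace.MetrizableSpace M] {F : Set M}
    (hF : IsClosed F) (hne : F.Nonempty) :
    ∃ r : M → M, (∀ x, r x ∈ F) ∧ ∀ x ∈ F, Tendsto r (𝓝 x) (𝓝 x) := by
  let _ := TopologicalSpace.metrizableSpaceMetric M
  have h : ∀ x, ∃ y ∈ F, Metric.infDist x F = dist x y := fun x =>
    hF.isCompact.exists_infDist_eq_dist hne x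
  choose r hr h using h
  refine ⟨r, hr, fun x hx => ?_⟩
  rw [tendsto_iff_dist_tendsto_zero]
  have h2 : Tendsto (fun y => 2 * dist y x) (𝓝 x) (𝓝 0) := by
    have : Continuous fun y => 2 * dist y x := by fun_prop
    simpa using this.tendsto x
  refine squeeze_zero (fun _ => dist_nonneg) (fun y => ?_) h2
  have h3 := dist_triangle_left (r y) x y
  have h4 := Metric.infDist_le_dist_of_mem (x := y) hx
  rw [h y] at h4
  linarith

variable {p : ℕ} {G : Type w} [CommGroup G] [MulAction G M]
  {n : ℕ} {hG : ∀ g : G, g ^ p = 1} {𝓕 : Filter M} {F X : Set M} {j : ℕ}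

variable (k 𝓕) in
/-- Functionals on cochains on `F`, up to functionals supported away from `𝓕`. -/
def KF (F : Set M) (j : ℕ) : Submodule k (Module.Dual k (List M → k)) := AF k F F j ⊔ LO k 𝓕 j

theorem LO_le_KF : LO k 𝓕 ≤ KF k 𝓕 F := fun _ => le_sup_right

theorem KF_le_LF : KF k 𝓕 F ≤ LF k 𝓕 F := fun j => sup_le_sup_right (AF_le_A j) _

theorem isSub_KF [ContinuousConstSMul G M] (h𝓕 : ∀ g : G, Tendsto (g • · : M → M) 𝓕 𝓕)
    (hF : SInv G F) : (AS k M hG).IsSub (KF k 𝓕 F) := by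
  have hO := isSub_LF (k := k) (hG := hG) (S := ∅) h𝓕 fun g x hx => hx.elim
  rw [show LF k 𝓕 ∅ = LO k 𝓕 from funext fun _ => LF_empty] at hO
  refine ⟨?_, fun {j x} h => ?_, fun {j x} g h => ?_⟩
  · rw [KF, AF_zero, bot_sup_eq]
    exact hO.zero
  · obtain ⟨a, ha, b, hb, rfl⟩ := Submodule.mem_sup.1 h
    rw [map_add]
    exact Submodule.add_mem_sup (AF_d_mem ha) (hO.d_mem hb)
  · obtain ⟨a, ha, b, hb, rfl⟩ := Submodule.mem_sup.1 h
    rw [map_add]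
    exact Submodule.add_mem_sup (AF_ρ_mem g (hF g) (hF g) ha) (hO.ρ_mem g hb)

/-- Tautness of closed subsets. -/
theorem H_LF_KF [CompactSpace M] [TopologicalSpace.MetrizableSpace M] (hF : IsClosed F) (j : ℕ) :
    (AS k M hG).H (LF k 𝓕 F) (KF k 𝓕 F) j = 0 := by
  rw [Amb.H_eq_zero_iff]
  intro z hz hdz
  obtain rfl | ⟨i, rfl⟩ : j = 0 ∨ ∃ i, j = i + 1 :=
    (Nat.eq_zero_or_pos j).imp_right fun h => ⟨j - 1, by omega⟩
  · rw [LF_zero, Submodule.mem_bot] at hz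
    exact ⟨0, zero_mem _, by rw [hz, map_zero, sub_zero]; exact zero_mem _⟩
  rcases F.eq_empty_or_nonempty with rfl | hne
  · refine ⟨0, zero_mem _, ?_⟩
    rw [LF_empty] at hz
    rw [map_zero, sub_zero]
    exact LO_le_KF _ hz
  obtain ⟨r, hrF, hr⟩ := exists_retract hF hne
  let h := (prismL k r).dualMap
  have hh : ∀ l : Module.Dual k (List M → k), (AS k M hG).d (h l) =
      l - (pull k r).dualMap l - h ((AS k M hG).d l) := by
    intro l
    ext f
    simp only [LinearMap.sub_apply, h, LinearMap.dualMap_apply]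
    rw [eq_sub_iff_add_eq, ← map_sub, ← cd_prism, map_add]
    exact add_comm _ _
  have hA : ∀ {S i l}, S ⊆ F → l ∈ A k S i → h l ∈ A k S (i + 1) := fun hS hl =>
    mem_AF.2 fun f hf =>
      mem_AF.1 hl _ (prism_mem_IF (fun s hs => hr s (hS hs)) (mapsTo_univ _ _) hf)
  have hAF : ∀ {i l}, l ∈ AF k F F i → h l ∈ AF k F F (i + 1) := fun hl =>
    mem_AF.2 fun f hf => mem_AF.1 hl _ (prism_mem_IF hr (fun x _ => hrF x) hf)
  obtain ⟨a, ha, o, ho, rfl⟩ := Submodule.mem_sup.1 hz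
  have hda : (AS k M hG).d a ∈ KF k 𝓕 F i := by
    have h1 : (AS k M hG).d o ∈ LO k 𝓕 i := by
      rw [← LF_empty] at ho ⊢
      exact LF_d_mem ho
    have h2 := sub_mem hdz (LO_le_KF (F := F) _ h1)
    rwa [map_add, add_sub_cancel_right] at h2
  obtain ⟨b, hb, o', ho', hbo⟩ := Submodule.mem_sup.1 hda
  have ho'F : o' ∈ A k F i := by
    rw [← eq_sub_iff_add_eq'] at hbo
    rw [hbo]
    exact sub_mem (AF_d_mem ha) (AF_le_A _ hb)
  obtain ⟨Z, hZ, hZF, hoZ⟩ := mem_LO.1 ho'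
  have ho'' : h o' ∈ LO k 𝓕 (i + 1) := by
    refine mem_LO.2 ⟨Z, hZ, hZF, AF_mono inter_subset_right _ (hA (inter_subset_left (s := F)) ?_)⟩
    rw [A_inter hF hZ]
    exact ⟨ho'F, hoZ⟩
  refine ⟨h a, A_le_LF _ (hA subset_rfl ha), ?_⟩
  have e : a + o - (AS k M hG).d (h a) = ((pull k r).dualMap a + h b) + (h o' + o) := by
    rw [hh, ← hbo, map_add]
    abel
  rw [e]
  refine Submodule.add_mem_sup (add_mem (mem_AF.2 fun f hf => mem_AF.1 ha _ ?_) (hAF hb))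
    (add_mem ho'' ho)
  exact pull_mem_IF (φ := r)
    (fun s hs => (congrArg (Tendsto r (𝓝 s)) (congrArg 𝓝 (eq_of_tendsto_nhds (hr s hs)))).mpr
      (hr s hs)) (fun x _ => hrF x) (fun x _ => hrF x) hf

theorem ρ_eq_of_mem_AF {g : G} (hg : ∀ x ∈ F, g • x = x) {l : Module.Dual k (List M → k)}
    (hl : l ∈ AF k F F j) : (AS k M hG).ρ g l = l := by
  ext f
  rw [AS_ρ_apply, ← sub_eq_zero, ← map_sub]
  refine mem_AF.1 hl _ fun _ x _ => ⟨univ, univ_mem, fun l _ hlF => ?_⟩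
  rw [Pi.sub_apply, pull_apply, sub_eq_zero]
  congr 1
  exact (List.map_congr_left fun x hx => hg x (hlF x hx).2).trans (List.map_id' l)

theorem th_mem_LO [ContinuousConstSMul G M] (hk : (p : k) = 0)
    (h𝓕 : ∀ g : G, Tendsto (g • · : M → M) 𝓕 𝓕) {g : G} (hg : ∀ x ∈ F, g • x = x) (n j : ℕ)
    {l : Module.Dual k (List M → k)} (hl : l ∈ KF k 𝓕 F j) :
    (AS k M hG).th g n l ∈ LO k 𝓕 j := by
  have hO := isSub_LF (k := k) (hG := hG) (S := ∅) h𝓕 fun g x hx => hx.elim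
  rw [show LF k 𝓕 ∅ = LO k 𝓕 from funext fun _ => LF_empty] at hO
  obtain ⟨a, ha, b, hb, rfl⟩ := Submodule.mem_sup.1 hl
  have h0 : (AS k M hG).th g n a = 0 := by
    rw [Amb.th]
    split_ifs
    · rw [Amb.nm_apply, Finset.sum_congr rfl fun i _ => ρ_eq_of_mem_AF (g := g ^ i) (fun x hx => ?_)
        ha, Finset.sum_const, Finset.card_range, ← Nat.cast_smul_eq_nsmul k, hk, zero_smul]
      exact MulAction.mem_stabilizer_iff.1 (pow_mem (MulAction.mem_stabilizer_iff.2 (hg x hx)) i)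
    · rw [LinearMap.sub_apply, ρ_eq_of_mem_AF hg ha, Module.End.one_apply, sub_self]
  rw [map_add, h0, zero_add]
  exact hO.th_mem g n hb

end Retract

section Smith

variable {p : ℕ} {G : Type w} [CommGroup G] [MulAction G M]
  {n : ℕ} {hG : ∀ g : G, g ^ p = 1} {𝓕 : Filter M} {X : Set M}

theorem sdiff_fixedBy_subset_freeLocus (hp : p.Prime) (hG : ∀ g : G, g ^ p = 1) (g : G) :
    X \ (X ∩ MulAction.fixedBy M g) ⊆ freeLocus M (Subgroup.zpowers g) := by
  rintro x ⟨hx, hxg⟩ ⟨h, hh⟩ hhx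
  obtain ⟨m, rfl⟩ := Subgroup.mem_zpowers_iff.1 hh
  obtain ⟨m, rfl⟩ := dvd_of_zpow_mem (K := MulAction.stabilizer G x) hp hG
    (fun h => hxg ⟨hx, h⟩) (MulAction.mem_stabilizer_iff.2 hhx)
  refine Subtype.ext ?_
  change g ^ ((p : ℤ) * m) = 1
  rw [zpow_mul, zpow_natCast, hG, one_zpow]

theorem SInv.fixedBy (g : G) : SInv G (MulAction.fixedBy M g) := fun h x hx => by
  rw [MulAction.mem_fixedBy] at hx ⊢
  rw [smul_comm, hx]

variable [TopologicalSpace M] [ContinuousConstSMul G M] [T2Space M]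

theorem isClosed_fixedBy (g : G) :
    IsClosed (MulAction.fixedBy M g) :=
  isClosed_eq (continuous_const_smul g) continuous_id

variable [CompactSpace M]
  [TopologicalSpace.MetrizableSpace M] [Finite G]

theorem H_phi_LF_KF (hp : p.Prime) (hM : LocEuc n M)
    (h𝓕 : ∀ g : G, Tendsto (g • · : M → M) 𝓕 𝓕) (hX : IsClosed X) (hXi : SInv G X)
    {g : G} (hg : g ≠ 1) (ε : ℕ) {j : ℕ} (hj : n + 5 ≤ j) :
    ((AS k M hG).phi g ε).H ((AS k M hG).fam (LF k 𝓕 X))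
      ((AS k M hG).fam (KF k 𝓕 (X ∩ MulAction.fixedBy M g))) j = 0 := by
  set F := X ∩ MulAction.fixedBy M g
  have hF : IsClosed F := hX.inter (isClosed_fixedBy g)
  have hFi : SInv G F := hXi.inter (SInv.fixedBy g)
  have hv : ∀ l : List G, (∀ h ∈ l, h ∈ Subgroup.zpowers g) → Amb.Indep ⊥ l → ∀ j ≥ n + 4,
      Amb.HPhi l (AS k M hG) (LF k 𝓕 X) (LF k 𝓕 F) j = 0 := fun l hl hi j hj =>
    HPhi_LF_eq_zero hp hM h𝓕 hX hXi hF hFi inter_subset_left (Subgroup.zpowers g)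
      (sdiff_fixedBy_subset_freeLocus hp hG g) hl hi hj
  have h1 := Amb.H_phi_eq_zero_of_le (g := g) (isSub_LF (hG := hG) h𝓕 hXi) (isSub_LF h𝓕 hFi)
    (hv [] (by simp) trivial) (hv [g] (by simp) ⟨by simpa using hg, trivial⟩) ε j hj
  have h2 := Amb.H_phi_eq_zero (g := g) (isSub_LF h𝓕 hFi) (isSub_KF h𝓕 hFi)
    (H_LF_KF (k := k) (hG := hG) (𝓕 := 𝓕) hF) ε j
  refine le_antisymm ((Amb.H_triple_mid (D := (AS k M hG).phi g ε)
    (Amb.fam_mono (LF_mono inter_subset_left)) (Amb.fam_mono KF_le_LF) j).trans_eq ?_) bot_le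
  rw [h1, h2, add_zero]

theorem smith_wt_LF (hp : p.Prime) (hk : (p : k) = 0) (hM : LocEuc n M)
    (h𝓕 : ∀ g : G, Tendsto (g • · : M → M) 𝓕 𝓕) (hX : IsClosed X) (hXi : SInv G X)
    {g : G} (hg : g ≠ 1) :
    (AS k M hG).wt (n + 5) (LF k 𝓕 (X ∩ MulAction.fixedBy M g)) (LO k 𝓕) ≤
      (AS k M hG).wt (n + 5) (LF k 𝓕 X) (LO k 𝓕) ∧
    ((AS k M hG).wt (n + 5) (LF k 𝓕 X) (LO k 𝓕) ≠ ⊤ →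
      (AS k M hG).wt (n + 5) (LF k 𝓕 X) (LO k 𝓕) ≤
        (AS k M hG).wt (n + 5) (LF k 𝓕 (X ∩ MulAction.fixedBy M g)) (LO k 𝓕) →
      ∀ j, (AS k M hG).H (LF k 𝓕 X) (LF k 𝓕 (X ∩ MulAction.fixedBy M g)) j = 0) := by
  set F := X ∩ MulAction.fixedBy M g
  have hF : IsClosed F := hX.inter (isClosed_fixedBy g)
  have hFi : SInv G F := hXi.inter (SInv.fixedBy g)
  have hwt : (AS k M hG).wt (n + 5) (LF k 𝓕 F) (LO k 𝓕) ≤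
      (AS k M hG).wt (n + 5) (KF k 𝓕 F) (LO k 𝓕) := by
    refine Finset.sum_le_sum fun j _ => Finset.sum_le_sum fun i _ => ?_
    refine (Amb.H_triple_mid KF_le_LF LO_le_KF _).trans_eq ?_
    rw [H_LF_KF hF, zero_add]
  have hth : ∀ n j, ∀ x ∈ KF k 𝓕 F j, (AS k M hG).th g n x ∈ LO k 𝓕 j := fun n j x hx =>
    th_mem_LO hk h𝓕 (fun x hx => hx.2) n j hx
  have hKC : KF k 𝓕 F ≤ LF k 𝓕 X := KF_le_LF.trans (LF_mono inter_subset_left)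
  have hv : ∀ ε, ∀ j ≥ n + 5, ((AS k M hG).phi g ε).H ((AS k M hG).fam (LF k 𝓕 X))
      ((AS k M hG).fam (KF k 𝓕 F)) j = 0 := fun ε j hj => H_phi_LF_KF hp hM h𝓕 hX hXi hg ε hj
  refine ⟨hwt.trans (Amb.smith_wt_le (isSub_LF h𝓕 hXi) hth LO_le_KF hKC hv),
    fun hfin hle j => ?_⟩
  have h0 := Amb.H_eq_zero_of_smith_wt_eq (isSub_LF h𝓕 hXi) (isSub_KF h𝓕 hFi) hth LO_le_KF hKC hv
    hfin (hle.trans hwt)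
  rcases j with - | j
  · exact Amb.H_zero (isSub_LF h𝓕 hXi)
  · refine le_antisymm ((Amb.H_triple_quot (LF_mono inter_subset_left) KF_le_LF j).trans_eq ?_)
      bot_le
    rw [h0, H_LF_KF hF, zero_add]

end Smith

end MannSu

namespace MannSu

open scoped Topology
open Set Filter

universe u v w

variable {k : Type v} [Field k] {M : Type u}

section Groups

variable {G : Type w} [CommGroup G]

theorem exists_finset_closure (E : Subgroup G) (m : ℕ) (H : Subgroup G)
    (h : ∀ l : List G, (∀ g ∈ l, g ∈ E) → Amb.Indep H l → l.length ≤ m) :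
    ∃ s : Finset G, s.card ≤ m ∧ E ≤ H ⊔ Subgroup.closure s := by
  classical
  induction m generalizing H with
  | zero =>
    refine ⟨∅, le_rfl, le_sup_of_le_left fun g hg => ?_⟩
    by_contra hgH
    have := h [g] (by simpa using hg) ⟨hgH, trivial⟩
    simp at this
  | succ m ih =>
    by_cases hE : E ≤ H
    · exact ⟨∅, by simp, le_sup_of_le_left hE⟩
    obtain ⟨g, hg, hgH⟩ := SetLike.not_le_iff_exists.1 hE
    obtain ⟨s, hs, hE⟩ := ih (H ⊔ Subgroup.zpowers g) fun l hl hi => by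
      have := h (g :: l) (by simpa using ⟨hg, hl⟩) ⟨hgH, hi⟩
      simpa using this
    refine ⟨insert g s, (Finset.card_insert_le g s).trans (by omega), hE.trans_eq ?_⟩
    rw [Finset.coe_insert, Set.insert_eq, Subgroup.closure_union, ← Subgroup.zpowers_eq_closure,
      sup_assoc]

theorem exists_compl {p : ℕ} (hp : p.Prime) (hG : ∀ g : G, g ^ p = 1) [Finite G]
    {L Γ : Subgroup G} (hL : L ≤ Γ) : ∃ E ≤ Γ, E ⊓ L = ⊥ ∧ Γ = L ⊔ E := by
  obtain ⟨E, hE⟩ := (Set.toFinite {E : Subgroup G | E ≤ Γ ∧ E ⊓ L = ⊥}).exists_maximal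
    ⟨⊥, bot_le, bot_inf_eq L⟩
  refine ⟨E, hE.prop.1, hE.prop.2, le_antisymm (fun g hg => ?_) (sup_le hL hE.prop.1)⟩
  by_contra hgn
  have h1 : E ⊔ Subgroup.zpowers g ≤ E := hE.le_of_ge
    ⟨sup_le hE.prop.1 ((Subgroup.zpowers_le).2 hg), ?_⟩ le_sup_left
  · exact hgn (Subgroup.mem_sup_right (h1 (Subgroup.mem_sup_right (Subgroup.mem_zpowers g))))
  rw [eq_bot_iff]
  rintro x ⟨hx, hxL⟩
  obtain ⟨a, ha, b, hb, rfl⟩ := Subgroup.mem_sup.1 hx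
  obtain ⟨m, rfl⟩ := Subgroup.mem_zpowers_iff.1 hb
  obtain ⟨m, rfl⟩ := dvd_of_zpow_mem (K := L ⊔ E) hp hG hgn (m := m) (by
    have := mul_mem (Subgroup.mem_sup_right (S := L) (inv_mem ha))
      (Subgroup.mem_sup_left (T := E) hxL)
    simpa using this)
  rw [zpow_mul, zpow_natCast, hG, one_zpow, mul_one] at hxL ⊢
  rw [← hE.prop.2]
  exact ⟨ha, hxL⟩

end Groups

namespace Amb

variable {p : ℕ} {G : Type w} [CommGroup G] {D : Amb.{u} k p G} {A B C K O : ℕ → Submodule k D.V}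

theorem H_excision (hA : ∀ j, ∀ x ∈ A j, D.d x ∈ A (j - 1))
    (hB : ∀ j, ∀ x ∈ B j, D.d x ∈ B (j - 1)) (j : ℕ) :
    D.H (A ⊔ B) B j = D.H A (A ⊓ B) j := by
  refine le_antisymm ?_ ?_
  · have h1 : D.Z (A ⊔ B) B j ≤ D.Z A (A ⊓ B) j ⊔ B j := by
      rintro x ⟨hx, hdx⟩
      obtain ⟨a, ha, b, hb, rfl⟩ := Submodule.mem_sup.1 hx
      refine Submodule.add_mem_sup ⟨ha, hA _ _ ha, ?_⟩ hb
      have := sub_mem (show D.d (a + b) ∈ B (j - 1) from hdx) (hB _ _ hb)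
      rwa [map_add, add_sub_cancel_right] at this
    have h2 : D.Bd A (A ⊓ B) j ≤ D.Bd (A ⊔ B) B j :=
      sup_le_sup inf_le_right (Submodule.map_mono le_sup_left)
    refine (relLen_mono _ h1).trans ?_
    rw [relLen_sup_right le_sup_left]
    exact relLen_anti _ h2
  · have h1 : D.Z A (A ⊓ B) j ≤ D.Z (A ⊔ B) B j := fun x hx =>
      ⟨Submodule.mem_sup_left hx.1, hx.2.2⟩
    refine (relLen_le_of_inf_le ?_).trans (relLen_mono _ h1)
    rintro x ⟨⟨hx, _⟩, hx'⟩
    obtain ⟨y, hy, hxy⟩ := mem_Bd.1 hx'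
    obtain ⟨a, ha, b, hb, rfl⟩ := Submodule.mem_sup.1 hy
    refine mem_Bd.2 ⟨a, ha, sub_mem hx (hA (j + 1) _ ha), ?_⟩
    have := add_mem hxy (hB (j + 1) _ hb)
    have e : x - D.d a = x - D.d (a + b) + D.d b := by rw [map_add]; abel
    rwa [e]

end Amb

section Fixed

variable {p : ℕ} {G : Type w} [CommGroup G] [MulAction G M]

variable (M) in
/-- Points fixed by a subgroup. -/
def fixd (E : Subgroup G) : Set M := {x | ∀ g ∈ E, g • x = x}

theorem mem_fixd {E : Subgroup G} {x : M} : x ∈ fixd M E ↔ E ≤ MulAction.stabilizer G x := Iff.rfl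

theorem fixd_anti {E E' : Subgroup G} (h : E ≤ E') : fixd M E' ⊆ fixd M E := fun _ hx g hg =>
  hx g (h hg)

theorem fixd_bot : fixd M (⊥ : Subgroup G) = univ :=
  eq_univ_of_forall fun _ => mem_fixd.2 bot_le

theorem fixd_sup (E E' : Subgroup G) : fixd M (E ⊔ E') = fixd M E ∩ fixd M E' := by
  ext x
  simp only [mem_inter_iff, mem_fixd, sup_le_iff]

theorem fixd_zpowers (g : G) : fixd M (Subgroup.zpowers g) = MulAction.fixedBy M g := by
  ext x
  rw [mem_fixd, Subgroup.zpowers_le]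
  rfl

theorem SInv.fixd (E : Subgroup G) : SInv G (fixd M E) := fun g x hx h hh => by
  rw [smul_comm, hx h hh]

variable [TopologicalSpace M] {n : ℕ} {hG : ∀ g : G, g ^ p = 1} {𝓕 : Filter M} {S T X : Set M}

variable (k hG 𝓕) in
/-- The inclusion of a subset induces isomorphisms in homology. -/
def Acy (S T : Set M) : Prop := ∀ j, (AS k M hG).H (LF k 𝓕 S) (LF k 𝓕 T) j = 0

theorem Acy.refl (S : Set M) : Acy k hG 𝓕 S S := fun j => Amb.H_self j

theorem LF_d_mem' {l : Module.Dual k (List M → k)} {j : ℕ} (hl : l ∈ LF k 𝓕 S j) :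
    (AS k M hG).d l ∈ LF k 𝓕 S (j - 1) := by
  cases j with
  | zero =>
    rw [LF_zero, Submodule.mem_bot] at hl
    rw [hl, map_zero]
    exact zero_mem _
  | succ j => exact LF_d_mem hl

variable [T2Space M]

theorem H_LF_excision [CompactSpace M] (hS : IsClosed S) (hT : IsClosed T) (j : ℕ) :
    (AS k M hG).H (LF k 𝓕 (S ∪ T)) (LF k 𝓕 T) j =
      (AS k M hG).H (LF k 𝓕 S) (LF k 𝓕 (S ∩ T)) j := by
  have h1 : LF k 𝓕 (S ∪ T) = LF k 𝓕 S ⊔ LF k 𝓕 T := funext fun j => LF_union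
  have h2 : LF k 𝓕 (S ∩ T) = LF k 𝓕 S ⊓ LF k 𝓕 T := funext fun j => LF_inter hS hT
  rw [h1, h2]
  exact Amb.H_excision (fun _ _ h => LF_d_mem' h) (fun _ _ h => LF_d_mem' h) j

variable [ContinuousConstSMul G M]

theorem isClosed_fixd (E : Subgroup G) : IsClosed (fixd M E) := by
  have : fixd M E = ⋂ g ∈ E, MulAction.fixedBy M g := by
    ext x
    simp [MannSu.fixd]
  rw [this]
  exact isClosed_biInter fun g _ => isClosed_fixedBy g

end Fixed

end MannSu

namespace MannSu

open scoped Topology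
open Set Filter

universe u v w

variable {k : Type v} [Field k] {M : Type u} [TopologicalSpace M]
  {p : ℕ} {G : Type w} [CommGroup G] [MulAction G M]
  {n : ℕ} {hG : ∀ g : G, g ^ p = 1} {𝓕 : Filter M} {S T X : Set M}

theorem LF_zero_H (j : ℕ) (hj : j = 0) : (AS k M hG).H (LF k 𝓕 S) (LF k 𝓕 T) j = 0 := by
  rw [hj, Amb.H_eq_zero_iff]
  intro z hz _
  rw [LF_zero, Submodule.mem_bot] at hz
  exact ⟨0, zero_mem _, by rw [hz, map_zero, sub_zero]; exact zero_mem _⟩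

theorem Acy.trans (h : Acy k hG 𝓕 X S) (h' : Acy k hG 𝓕 S T) (hSX : S ⊆ X) (hTS : T ⊆ S) :
    Acy k hG 𝓕 X T := fun j =>
  le_antisymm ((Amb.H_triple_mid (LF_mono hSX) (LF_mono hTS) j).trans_eq
    (by rw [h, h', add_zero])) bot_le

theorem Acy.of_right (h : Acy k hG 𝓕 X T) (h' : Acy k hG 𝓕 S T) (hSX : S ⊆ X) (hTS : T ⊆ S) :
    Acy k hG 𝓕 X S := fun j => by
  rcases j with - | j
  · exact LF_zero_H 0 rfl
  · exact le_antisymm ((Amb.H_triple_quot (LF_mono hSX) (LF_mono hTS) j).trans_eq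
      (by rw [h, h', add_zero])) bot_le

variable [T2Space M] [CompactSpace M]

theorem Acy.union (hS : IsClosed S) (hT : IsClosed T) (h : Acy k hG 𝓕 S (S ∩ T)) :
    Acy k hG 𝓕 (S ∪ T) T := fun j => (H_LF_excision hS hT j).trans (h j)

variable [ContinuousConstSMul G M]

theorem acy_biUnion {L Γ : Subgroup G}
    (hmax : ∀ E, L < E → E ≤ Γ → Acy k hG 𝓕 (fixd M E) (fixd M Γ)) (s : Finset G)
    (hs : ∀ g ∈ s, g ∈ Γ ∧ g ∉ L) : ∀ E, L ≤ E → E ≤ Γ →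
      Acy k hG 𝓕 (fixd M Γ ∪ ⋃ g ∈ s, fixd M (E ⊔ Subgroup.zpowers g)) (fixd M Γ) := by
  classical
  induction s using Finset.induction_on with
  | empty =>
    intro E _ _
    simpa using Acy.refl _
  | insert g s _ ih =>
    intro E hL hΓ
    have hs' : ∀ g ∈ s, g ∈ Γ ∧ g ∉ L := fun h hh => hs h (Finset.mem_insert_of_mem hh)
    have hg := hs g (Finset.mem_insert_self g s)
    set U : Subgroup G → Set M := fun E => fixd M Γ ∪ ⋃ g ∈ s, fixd M (E ⊔ Subgroup.zpowers g)
    have hU : ∀ E, IsClosed (U E) := fun E => (isClosed_fixd Γ).union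
      (isClosed_biUnion_finset fun g _ => isClosed_fixd _)
    have hEg : E ⊔ Subgroup.zpowers g ≤ Γ := sup_le hΓ (Subgroup.zpowers_le.2 hg.1)
    have hLg : L < E ⊔ Subgroup.zpowers g := (hL.trans le_sup_left).lt_of_ne fun h =>
      hg.2 (h ▸ Subgroup.mem_sup_right (Subgroup.mem_zpowers g))
    have e : fixd M Γ ∪ ⋃ h ∈ insert g s, fixd M (E ⊔ Subgroup.zpowers h) =
        fixd M (E ⊔ Subgroup.zpowers g) ∪ U E := by
      rw [Finset.set_biUnion_insert]
      exact union_left_comm _ _ _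
    have e' : fixd M (E ⊔ Subgroup.zpowers g) ∩ U E = U (E ⊔ Subgroup.zpowers g) := by
      simp only [U]
      rw [inter_union_distrib_left, inter_eq_self_of_subset_right (fixd_anti hEg),
        inter_iUnion₂]
      simp only [← fixd_sup, ← sup_sup_distrib_left]
      simp only [sup_assoc]
    rw [e]
    have h1 := ih hs' E hL hΓ
    have h2 := ih hs' (E ⊔ Subgroup.zpowers g) hLg.le hEg
    refine Acy.trans (Acy.union (isClosed_fixd _) (hU E) ?_) h1
      subset_union_right subset_union_left
    rw [e']
    exact Acy.of_right (hmax _ hLg hEg) h2 (e' ▸ inter_subset_left) subset_union_left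

variable [Finite G]

theorem H_LF_eq_zero_of_le (hp : p.Prime) (hM : LocEuc n M)
    (h𝓕 : ∀ g : G, Tendsto (g • · : M → M) 𝓕 𝓕) (hX : IsClosed X) (hXi : SInv G X)
    (hS : IsClosed S) (hSi : SInv G S) (hSX : S ⊆ X) {j : ℕ} (hj : n + 4 ≤ j) :
    (AS k M hG).H (LF k 𝓕 X) (LF k 𝓕 S) j = 0 :=
  HPhi_LF_eq_zero (l := []) hp hM h𝓕 hX hXi hS hSi hSX ⊥
    (fun _ _ g _ => Subtype.ext (Subgroup.mem_bot.1 g.2)) (by simp) trivial hj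

variable (k hG 𝓕 n) in
/-- The weight of the fixed point set of a subgroup. -/
noncomputable def fwt (E : Subgroup G) : ℕ∞ :=
  (AS k M hG).wt (n + 5) (LF k 𝓕 (fixd M E)) (LO k 𝓕)

theorem H_le_fwt (hp : p.Prime) (hM : LocEuc n M) (h𝓕 : ∀ g : G, Tendsto (g • · : M → M) 𝓕 𝓕)
    (E : Subgroup G) (j : ℕ) :
    (AS k M hG).H (LF k 𝓕 (fixd M E)) (LO k 𝓕) j ≤ fwt k n hG 𝓕 E := by
  rcases lt_or_ge j (n + 4) with h | h
  · have h1 : (AS k M hG).H (LF k 𝓕 (fixd M E)) (LO k 𝓕) (j + 0) ≤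
        ∑ i ∈ Finset.range (n + 5), (AS k M hG).H (LF k 𝓕 (fixd M E)) (LO k 𝓕) (j + i) :=
      Finset.single_le_sum (f := fun i => (AS k M hG).H (LF k 𝓕 (fixd M E)) (LO k 𝓕) (j + i))
        (fun _ _ => bot_le) (Finset.mem_range.2 (by omega))
    exact h1.trans (Finset.single_le_sum (f := fun j => ∑ i ∈ Finset.range (n + 5),
      (AS k M hG).H (LF k 𝓕 (fixd M E)) (LO k 𝓕) (j + i)) (fun _ _ => bot_le)
      (Finset.mem_range.2 (by omega)))
  · rw [← show LF k 𝓕 ∅ = LO k 𝓕 from funext fun _ => LF_empty,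
      H_LF_eq_zero_of_le hp hM h𝓕 (isClosed_fixd E) (SInv.fixd E) isClosed_empty
        (fun _ _ h => h.elim) (empty_subset _) h]
    exact bot_le

theorem fwt_sup_closure [TopologicalSpace.MetrizableSpace M] (hp : p.Prime) (hk : (p : k) = 0)
    (hM : LocEuc n M) (h𝓕 : ∀ g : G, Tendsto (g • · : M → M) 𝓕 𝓕) (s : Finset G) :
    ∀ L : Subgroup G, fwt k n hG 𝓕 (L ⊔ Subgroup.closure s) ≤ fwt k n hG 𝓕 L ∧
      (fwt k n hG 𝓕 L ≠ ⊤ → fwt k n hG 𝓕 L ≤ fwt k n hG 𝓕 (L ⊔ Subgroup.closure s) →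
        Acy k hG 𝓕 (fixd M L) (fixd M (L ⊔ Subgroup.closure s))) := by
  classical
  induction s using Finset.induction_on with
  | empty =>
    intro L
    simp only [Finset.coe_empty, Subgroup.closure_empty, sup_bot_eq]
    exact ⟨le_rfl, fun _ _ => Acy.refl _⟩
  | insert g s _ ih =>
    intro L
    have e : L ⊔ Subgroup.closure (insert g s : Finset G) =
        (L ⊔ Subgroup.zpowers g) ⊔ Subgroup.closure s := by
      rw [Finset.coe_insert, Set.insert_eq, Subgroup.closure_union, ← Subgroup.zpowers_eq_closure,
        sup_assoc]
    rw [e]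
    by_cases hg : g = 1
    · have : L ⊔ Subgroup.zpowers g = L := by simp [hg]
      rw [this]
      exact ih L
    obtain ⟨h1, h2⟩ := ih (L ⊔ Subgroup.zpowers g)
    obtain ⟨h3, h4⟩ := smith_wt_LF (k := k) (hG := hG) hp hk hM h𝓕 (isClosed_fixd L)
      (SInv.fixd L) hg
    rw [← fixd_zpowers, ← fixd_sup] at h3 h4
    refine ⟨h1.trans h3, fun hfin hle => ?_⟩
    exact Acy.trans (h4 hfin (hle.trans h1)) (h2 (ne_top_of_le_ne_top hfin h3) (h3.trans hle))
      (fixd_anti le_sup_left) (fixd_anti le_sup_left)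

theorem fwt_anti [TopologicalSpace.MetrizableSpace M] (hp : p.Prime) (hk : (p : k) = 0)
    (hM : LocEuc n M) (h𝓕 : ∀ g : G, Tendsto (g • · : M → M) 𝓕 𝓕) {L E : Subgroup G} (h : L ≤ E) :
    fwt k n hG 𝓕 E ≤ fwt k n hG 𝓕 L ∧ (fwt k n hG 𝓕 L ≠ ⊤ → fwt k n hG 𝓕 L ≤ fwt k n hG 𝓕 E →
        Acy k hG 𝓕 (fixd M L) (fixd M E)) := by
  have h1 := fwt_sup_closure (k := k) (hG := hG) hp hk hM h𝓕 (Set.toFinite (E : Set G)).toFinset L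
  rwa [Set.Finite.coe_toFinset, Subgroup.closure_eq, sup_eq_right.2 h] at h1

theorem exists_lt_of_not_acy (hp : p.Prime) (hk : (p : k) = 0)
    (hM : LocEuc n M) (h𝓕 : ∀ g : G, Tendsto (g • · : M → M) 𝓕 𝓕) {w : ℕ}
    (hw : ∀ E : Subgroup G, fwt k n hG 𝓕 E ≤ w) {Γ : Subgroup G}
    (h : ¬ Acy k hG 𝓕 univ (fixd M Γ)) : ∃ L ≤ Γ, ¬ Acy k hG 𝓕 (fixd M L) (fixd M Γ) ∧
      ∃ s : Finset G, s.card ≤ 2 * w * (n + 5) ∧ Γ ≤ L ⊔ Subgroup.closure s := by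
  classical
  obtain ⟨L, hLm⟩ := (Set.toFinite {L : Subgroup G | L ≤ Γ ∧
    ¬ Acy k hG 𝓕 (fixd M L) (fixd M Γ)}).exists_maximal
    ⟨⊥, bot_le, by rwa [fixd_bot]⟩
  obtain ⟨hL, hLn⟩ := hLm.prop
  have hmax : ∀ E, L < E → E ≤ Γ → Acy k hG 𝓕 (fixd M E) (fixd M Γ) := by
    intro E hLE hE
    by_contra hn
    exact absurd (hLm.le_of_ge ⟨hE, hn⟩ hLE.le) hLE.not_ge
  refine ⟨L, hL, hLn, ?_⟩
  obtain ⟨E, hE, hEL, rfl⟩ := exists_compl hp hG hL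
  set Γ := L ⊔ E
  let t : Finset G := (Set.toFinite ((Γ : Set G) \ L)).toFinset
  have ht : ∀ g, g ∈ t ↔ g ∈ Γ ∧ g ∉ L := fun g => by simp [t]
  set S := fixd M Γ ∪ ⋃ g ∈ t, fixd M (L ⊔ Subgroup.zpowers g)
  have hSL : S ⊆ fixd M L := union_subset (fixd_anti hL)
    (iUnion₂_subset fun g _ => fixd_anti le_sup_left)
  have hΓS : fixd M Γ ⊆ S := subset_union_left
  have hS : IsClosed S := (isClosed_fixd Γ).union
    (isClosed_biUnion_finset fun g _ => isClosed_fixd _)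
  have hSi : SInv G S := (SInv.fixd Γ).union fun h x hx => by
    obtain ⟨g, hg, hx⟩ := mem_iUnion₂.1 hx
    exact mem_iUnion₂.2 ⟨g, hg, SInv.fixd _ h hx⟩
  have hSa : Acy k hG 𝓕 S (fixd M Γ) :=
    acy_biUnion hmax t (fun g hg => (ht g).1 hg) L le_rfl hL
  have hfree : fixd M L \ S ⊆ freeLocus M E := by
    rintro x ⟨hx, hxS⟩ ⟨g, hg⟩ hgx
    by_cases hgL : g ∈ L
    · refine Subtype.ext (Subgroup.mem_bot.1 (hEL ▸ ⟨hg, hgL⟩ : g ∈ (⊥ : Subgroup G)))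
    · refine absurd (Or.inr (mem_iUnion₂.2 ⟨g, (ht g).2 ⟨hE hg, hgL⟩, ?_⟩)) hxS
      rw [fixd_sup, fixd_zpowers]
      exact ⟨hx, hgx⟩
  have hO : (LF k 𝓕 ∅ : ℕ → _) = LO k 𝓕 := funext fun _ => LF_empty
  have hH : ∀ j, (AS k M hG).H (LF k 𝓕 (fixd M L)) (LF k 𝓕 S) j ≤ ((2 * w : ℕ) : ℕ∞) := by
    intro j
    rcases j with - | j
    · rw [LF_zero_H 0 rfl]
      exact bot_le
    refine (Amb.H_triple_quot (LF_mono hSL) (LF_mono hΓS) j).trans ?_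
    rw [hSa, add_zero]
    refine (Amb.H_triple_quot (LF_mono (fixd_anti hL)) LO_le_LF j).trans ?_
    refine (add_le_add ((H_le_fwt hp hM h𝓕 L _).trans (hw L))
      ((H_le_fwt hp hM h𝓕 Γ _).trans (hw Γ))).trans_eq ?_
    rw [two_mul, Nat.cast_add]
  have hne : ∃ j, (AS k M hG).H (LF k 𝓕 (fixd M L)) (LF k 𝓕 S) j ≠ 0 := by
    by_contra! hn
    exact hLn (Acy.trans hn hSa hSL hΓS)
  obtain ⟨s, hs, hEs⟩ := exists_finset_closure E (2 * w * (n + 5)) ⊥ fun l hl hi =>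
    Amb.length_le_of_HPhi_vanish hp hk l (isSub_LF h𝓕 (SInv.fixd L)) (isSub_LF h𝓕 hSi)
      (LF_mono hSL) (fun j hj => HPhi_LF_eq_zero hp hM h𝓕 (isClosed_fixd L) (SInv.fixd L) hS hSi
        hSL E hfree hl hi (by omega)) hH hne
  rw [bot_sup_eq] at hEs
  exact ⟨s, hs, sup_le_sup_left hEs L⟩

/-- A subgroup of bounded corank has homologically trivial fixed point set. -/
theorem exists_acy_fixd [TopologicalSpace.MetrizableSpace M] (hp : p.Prime) (hk : (p : k) = 0)
    (hM : LocEuc n M) (h𝓕 : ∀ g : G, Tendsto (g • · : M → M) 𝓕 𝓕) {w : ℕ}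
    (hw : (AS k M hG).wt (n + 5) (LF k 𝓕 univ) (LO k 𝓕) ≤ w) :
    ∃ (K : Subgroup G) (s : Finset G), s.card ≤ w * (2 * w * (n + 5)) ∧
      K ⊔ Subgroup.closure s = ⊤ ∧ Acy k hG 𝓕 univ (fixd M K) := by
  classical
  have hbot : fwt k n hG 𝓕 (⊥ : Subgroup G) ≤ w := by rwa [fwt, fixd_bot]
  have hwE : ∀ E : Subgroup G, fwt k n hG 𝓕 E ≤ w := fun E =>
    (fwt_anti hp hk hM h𝓕 bot_le).1.trans hbot
  have hfin : ∀ E : Subgroup G, fwt k n hG 𝓕 E ≠ ⊤ := fun E =>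
    ne_top_of_le_ne_top (ENat.natCast_ne_top w) (hwE E)
  have key : ∀ m : ℕ, ∀ Γ : Subgroup G, fwt k n hG 𝓕 (⊥ : Subgroup G) ≤ fwt k n hG 𝓕 Γ + m →
      ∃ (K : Subgroup G) (s : Finset G), s.card ≤ m * (2 * w * (n + 5)) ∧
        Γ ≤ K ⊔ Subgroup.closure s ∧ Acy k hG 𝓕 univ (fixd M K) := by
    intro m
    induction m with
    | zero =>
      intro Γ h
      have := (fwt_anti (k := k) (hG := hG) hp hk hM h𝓕 (bot_le (a := Γ))).2 (hfin _)
        (by simpa using h)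
      rw [fixd_bot] at this
      exact ⟨Γ, ∅, by simp, le_sup_left, this⟩
    | succ m ih =>
      intro Γ h
      by_cases hΓ : Acy k hG 𝓕 univ (fixd M Γ)
      · exact ⟨Γ, ∅, by simp, le_sup_left, hΓ⟩
      obtain ⟨L, hL, hLn, s, hs, hΓs⟩ := exists_lt_of_not_acy hp hk hM h𝓕 hwE hΓ
      have h1 : fwt k n hG 𝓕 Γ + 1 ≤ fwt k n hG 𝓕 L := by
        rw [ENat.add_one_le_iff (hfin Γ)]
        by_contra! hn
        exact hLn ((fwt_anti hp hk hM h𝓕 hL).2 (hfin L) hn)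
      obtain ⟨K, s', hs', hLs, hK⟩ := ih L (h.trans (by
        rw [Nat.cast_succ, add_comm (m : ℕ∞), ← add_assoc]
        gcongr))
      refine ⟨K, s' ∪ s, (Finset.card_union_le _ _).trans ?_, hΓs.trans ?_, hK⟩
      · rw [add_mul, one_mul]
        exact add_le_add hs' hs
      · rw [Finset.coe_union, Subgroup.closure_union, ← sup_assoc]
        exact sup_le_sup_right hLs _
  obtain ⟨K, s, hs, hK, h⟩ := key w ⊤ (hbot.trans le_add_self)
  exact ⟨K, s, hs, top_le_iff.1 hK, h⟩

end MannSu

namespace MannSu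

open scoped Topology
open Set Filter

universe u v w

variable {k : Type v} [Field k] {M : Type u} [TopologicalSpace M]
  {p : ℕ} {G : Type w} [CommGroup G] [MulAction G M] {hG : ∀ g : G, g ^ p = 1}

theorem Triv.H_empty {S : Set M} (hS : Triv k S) (hne : S.Nonempty) (j : ℕ) :
    (AS k M hG).H (LF k ⊤ S) (LF k ⊤ ∅) j = if j = 1 then 1 else 0 := by
  rw [LF_top, LF_top]
  match j with
  | 0 =>
    rw [← LF_top, ← LF_top]
    exact LF_zero_H 0 rfl
  | j + 2 =>
    rw [if_neg (by omega)]
    exact H_eq_zero_of_CAcy (cAcy_empty_iff.2 (hS.van _ (by omega)))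
  | 1 =>
    rw [if_pos rfl]
    let ev : Module.Dual k (List M → k) →ₗ[k] k := Module.Dual.eval k _ fun _ => 1
    refine le_antisymm ?_ (Order.one_le_iff_ne_zero.2 fun h => ?_)
    · refine (relLen_le_of_inf_le (R := LinearMap.ker ev) ?_).trans ?_
      · rintro z ⟨⟨hz, _⟩, hev⟩
        obtain ⟨y, hy, h⟩ := exists_sub_d_mem (hG := hG) (z := z) (S := S) (T := ∅) (j := 1) (by
          intro f _ hf
          obtain ⟨c, hc⟩ := exists_sub_const_mem hS.conn hf
          have h1 := mem_AF.1 hz _ hc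
          rw [map_sub, sub_eq_zero] at h1
          have h2 : (fun _ : List M => c) = c • fun _ => 1 := by
            ext
            simp
          rw [h1, h2, map_smul]
          exact (congrArg (c • ·) hev).trans (smul_zero c))
        exact Amb.mem_Bd.2 ⟨y, hy, h⟩
      · rw [← length_map_eq_relLen_ker]
        exact (Module.length_le_of_injective (Submodule.subtype _)
          (Submodule.subtype_injective _)).trans_eq (by simp)
    · obtain ⟨x, hx⟩ := hne
      obtain ⟨y, hy, h⟩ := Amb.H_eq_zero_iff.1 h (LinearMap.proj [x])
        (mem_AF.2 fun f hf => by
          obtain ⟨U, hU, h⟩ := hf (by omega) hx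
          exact h [x] rfl (by simpa using mem_of_mem_nhds hU))
        (by
          rw [show 1 - 1 = 0 from rfl, A, AF_zero, Submodule.mem_bot]
          refine LinearMap.ext fun f => ?_
          change cd k M f [x] = 0
          rw [cd_apply, if_pos (by simp)])
      have h1 := mem_AF.1 h (fun _ => 1) (by rw [IF_empty]; trivial)
      rw [LinearMap.sub_apply, AS_d_apply, mem_AF.1 hy _ (cd_const_mem S 1)] at h1
      simp at h1

section Chart

variable {n : ℕ} {φ : OpenPartialHomeomorph M (Fin n → ℝ)} {S T : Set (Fin n → ℝ)}

theorem isClosed_symm_image [T2Space M] (hS : IsCompact S) (h : S ⊆ φ.target) :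
    IsClosed (φ.symm '' S) :=
  (hS.image_of_continuousOn (φ.continuousOn_symm.mono h)).isClosed

theorem symm_image_inter (hS : S ⊆ φ.target) (hT : T ⊆ φ.target) :
    φ.symm '' (S ∩ T) = φ.symm '' S ∩ φ.symm '' T :=
  InjOn.image_inter φ.symm.injOn hS hT

theorem triv_symm_image {a b : Fin n → ℝ} (h : Icc a b ⊆ φ.target) :
    Triv k (φ.symm '' Icc a b) where
  conn := (isPreconnected_box a b).image _ (φ.continuousOn_symm.mono h)
  van j hj := by
    have := CAcy.chart (k := k) φ h (empty_subset _) (cAcy_empty_iff.2 ((triv_box a b).van j hj))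
    rwa [image_empty, cAcy_empty_iff] at this

theorem acy_box {a b c d : Fin n → ℝ} (h : Icc a b ⊆ φ.target) (hcd : Icc c d ⊆ Icc a b)
    (hne : c ≤ d) : Acy k hG ⊤ (φ.symm '' Icc a b) (φ.symm '' Icc c d) := fun j => by
  rw [LF_top, LF_top]
  exact H_eq_zero_of_CAcy (Triv.cAcy (triv_symm_image h) (triv_symm_image (hcd.trans h))
    (image_mono hcd) ((nonempty_Icc.2 hne).image _) j)

/-- A finite union of coordinate hyperplanes. -/
def hyp (s : Finset (Fin n × ℝ)) : Set (Fin n → ℝ) := {x | ∃ q ∈ s, x q.1 = q.2}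

theorem mem_hyp {s : Finset (Fin n × ℝ)} {x : Fin n → ℝ} :
    x ∈ hyp s ↔ ∃ q ∈ s, x q.1 = q.2 := Iff.rfl

theorem isClosed_hyp (s : Finset (Fin n × ℝ)) : IsClosed (hyp s) := by
  have : hyp s = ⋃ q ∈ s, {x : Fin n → ℝ | x q.1 = q.2} := by
    ext
    simp [hyp]
  rw [this]
  exact isClosed_biUnion_finset fun q _ => isClosed_eq (continuous_apply _) continuous_const

theorem isClosed_slice (i : Fin n) (t : ℝ) : IsClosed {x : Fin n → ℝ | x i = t} :=
  isClosed_eq (continuous_apply _) continuous_const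

variable [T2Space M] [CompactSpace M]

theorem acy_box_hyp {a b : Fin n → ℝ} (h : Icc a b ⊆ φ.target) (hab : a ≤ b) {i : Fin n} {t : ℝ}
    (h1 : a i ≤ t) (h2 : t ≤ b i) (s : Finset (Fin n × ℝ)) (hs : ∀ q ∈ s, q.1 ≠ i) :
    Acy k hG ⊤ (φ.symm '' Icc a b) (φ.symm '' (Icc a b ∩ ({x | x i = t} ∪ hyp s))) := by
  classical
  induction s using Finset.induction_on generalizing a b with
  | empty =>
    have : hyp (∅ : Finset (Fin n × ℝ)) = ∅ := by simp [hyp]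
    rw [this, union_empty, Icc_inter_slice a b i h1 h2]
    refine acy_box h ?_ ?_
    · rw [← Icc_inter_slice a b i h1 h2]
      exact inter_subset_left
    · exact update_le_update_iff.2 ⟨le_rfl, fun j _ => hab j⟩
  | insert q s _ ih =>
    have hs' : ∀ q ∈ s, q.1 ≠ i := fun q hq => hs q (Finset.mem_insert_of_mem hq)
    have hq := hs q (Finset.mem_insert_self q s)
    set W : Set (Fin n → ℝ) := {x | x i = t} ∪ hyp s
    have hW : IsClosed W := (isClosed_slice i t).union (isClosed_hyp s)
    have e : Icc a b ∩ ({x | x i = t} ∪ hyp (insert q s)) =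
        (Icc a b ∩ {x | x q.1 = q.2}) ∪ (Icc a b ∩ W) := by
      ext x
      simp only [W, mem_inter_iff, mem_union, mem_hyp, Finset.mem_insert, exists_eq_or_imp,
        mem_ofPred_eq]
      tauto
    have h3 := ih h hab h1 h2 hs'
    rw [e]
    by_cases hc : a q.1 ≤ q.2 ∧ q.2 ≤ b q.1
    · have hsub : Icc a b ∩ {x | x q.1 = q.2} ⊆ φ.target := inter_subset_left.trans h
      have h4 := ih (a := Function.update a q.1 q.2) (b := Function.update b q.1 q.2)
        (by rwa [← Icc_inter_slice a b q.1 hc.1 hc.2])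
        (update_le_update_iff.2 ⟨le_rfl, fun j _ => hab j⟩)
        (by rwa [Function.update_of_ne hq.symm]) (by rwa [Function.update_of_ne hq.symm]) hs'
      rw [← Icc_inter_slice a b q.1 hc.1 hc.2] at h4
      refine Acy.of_right h3 ?_ (image_mono (union_subset inter_subset_left inter_subset_left))
        (image_mono subset_union_right)
      rw [image_union]
      refine Acy.union (isClosed_symm_image (isCompact_Icc.inter_right (isClosed_slice _ _)) hsub)
        (isClosed_symm_image (isCompact_Icc.inter_right hW) (inter_subset_left.trans h)) ?_
      rw [← symm_image_inter hsub (inter_subset_left.trans h)]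
      convert h4 using 2
      ext x
      simp only [mem_inter_iff]
      tauto
    · rwa [Icc_inter_slice_eq_empty hc, empty_union]

/-- The faces of a box in given directions. -/
def faces (I : Finset (Fin n)) (a b : Fin n → ℝ) : Set (Fin n → ℝ) :=
  hyp ((I.image fun i => (i, a i)) ∪ I.image fun i => (i, b i))

theorem mem_faces {I : Finset (Fin n)} {a b x : Fin n → ℝ} :
    x ∈ faces I a b ↔ ∃ i ∈ I, x i = a i ∨ x i = b i := by
  simp only [faces, mem_hyp, Finset.mem_union, Finset.mem_image]
  constructor
  · rintro ⟨q, ⟨i, hi, rfl⟩ | ⟨i, hi, rfl⟩, h⟩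
    exacts [⟨i, hi, Or.inl h⟩, ⟨i, hi, Or.inr h⟩]
  · rintro ⟨i, hi, h | h⟩
    exacts [⟨_, Or.inl ⟨i, hi, rfl⟩, h⟩, ⟨_, Or.inr ⟨i, hi, rfl⟩, h⟩]

theorem acy_box_faces {a b c d : Fin n → ℝ} (h : Icc a b ⊆ φ.target) (hab : a ≤ b) {i : Fin n}
    {t : ℝ} (h1 : a i ≤ t) (h2 : t ≤ b i) (I : Finset (Fin n)) (hI : i ∉ I) :
    Acy k hG ⊤ (φ.symm '' Icc a b) (φ.symm '' (Icc a b ∩ ({x | x i = t} ∪ faces I c d))) := by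
  refine acy_box_hyp h hab h1 h2 _ ?_
  simp only [Finset.mem_union, Finset.mem_image]
  rintro _ (⟨j, hj, rfl⟩ | ⟨j, hj, rfl⟩) rfl
  exacts [hI hj, hI hj]

theorem H_box_faces {a b : Fin n → ℝ} (h : Icc a b ⊆ φ.target) (hab : a ≤ b)
    (I : Finset (Fin n)) (hI : ∀ i ∈ I, a i < b i) (j : ℕ) :
    (AS k M hG).H (LF k ⊤ (φ.symm '' Icc a b)) (LF k ⊤ (φ.symm '' (Icc a b ∩ faces I a b))) j =
      if j = I.card + 1 then 1 else 0 := by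
  classical
  induction I using Finset.induction_on generalizing a b j with
  | empty =>
    have : faces ∅ a b = ∅ := by
      ext
      simp [mem_faces]
    rw [this, inter_empty, image_empty]
    exact (triv_symm_image h).H_empty ((nonempty_Icc.2 hab).image _) j
  | insert i I hi ih =>
    rcases j with - | j
    · exact LF_zero_H 0 rfl
    have hlt := hI i (Finset.mem_insert_self i I)
    set W : Set (Fin n → ℝ) := {x | x i = a i} ∪ faces I a b
    have hW : IsClosed W := (isClosed_slice i _).union (isClosed_hyp _)
    have hJ : Acy k hG ⊤ (φ.symm '' Icc a b) (φ.symm '' (Icc a b ∩ W)) :=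
      acy_box_faces h hab le_rfl hlt.le I hi
    have e : Icc a b ∩ faces (insert i I) a b = (Icc a b ∩ {x | x i = b i}) ∪ (Icc a b ∩ W) := by
      ext x
      simp only [W, mem_inter_iff, mem_union, mem_faces, Finset.mem_insert, exists_eq_or_imp,
        mem_ofPred_eq]
      rw [← and_or_left, or_comm (a := x i = a i), or_assoc]
    have hsub : Icc a b ∩ {x | x i = b i} ⊆ φ.target := inter_subset_left.trans h
    have hD := LF_mono (k := k) (𝓕 := ⊤) (image_mono (f := φ.symm)
      (show Icc a b ∩ faces (insert i I) a b ⊆ Icc a b from inter_subset_left))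
    have hD' := LF_mono (k := k) (𝓕 := ⊤) (image_mono (f := φ.symm)
      (show Icc a b ∩ W ⊆ Icc a b ∩ faces (insert i I) a b from e ▸ subset_union_right))
    have h3 := Amb.H_triple_quot (D := AS k M hG) hD hD' j
    have h4 := Amb.H_triple_sub (D := AS k M hG) hD hD' j
    rw [hJ, zero_add] at h3 h4
    rw [le_antisymm h3 h4, e, image_union, H_LF_excision
      (isClosed_symm_image (isCompact_Icc.inter_right (isClosed_slice _ _)) hsub)
      (isClosed_symm_image (isCompact_Icc.inter_right hW) (inter_subset_left.trans h)),
      ← symm_image_inter hsub (inter_subset_left.trans h)]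
    have e' : Icc a b ∩ {x | x i = b i} ∩ (Icc a b ∩ W) = Icc a b ∩ {x | x i = b i} ∩
        faces I (Function.update a i (b i)) (Function.update b i (b i)) := by
      ext x
      simp only [W, mem_inter_iff, mem_union, mem_faces, mem_ofPred_eq]
      have h5 : ∀ l ∈ I, Function.update a i (b i) l = a l ∧ Function.update b i (b i) l = b l :=
        fun l hl => by
          have : l ≠ i := fun h => hi (h ▸ hl)
          rw [Function.update_of_ne this, Function.update_of_ne this]
          exact ⟨rfl, rfl⟩
      constructor
      · rintro ⟨⟨hx, hxi⟩, -, hxa | ⟨l, hl, hxl⟩⟩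
        · exact absurd (hxa.symm.trans hxi) hlt.ne
        · exact ⟨⟨hx, hxi⟩, l, hl, by rwa [(h5 l hl).1, (h5 l hl).2]⟩
      · rintro ⟨⟨hx, hxi⟩, l, hl, hxl⟩
        rw [(h5 l hl).1, (h5 l hl).2] at hxl
        exact ⟨⟨hx, hxi⟩, hx, Or.inr ⟨l, hl, hxl⟩⟩
    rw [e', Icc_inter_slice a b i hlt.le le_rfl,
      ih (by rwa [← Icc_inter_slice a b i hlt.le le_rfl])
        (update_le_update_iff.2 ⟨le_rfl, fun j _ => hab j⟩), Finset.card_insert_of_notMem hi]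
    · simp
    · intro l hl
      have : l ≠ i := fun h => hi (h ▸ hl)
      rw [Function.update_of_ne this, Function.update_of_ne this]
      exact hI l (Finset.mem_insert_of_mem hl)

end Chart

end MannSu

namespace MannSu

open scoped Topology
open Set Filter

universe u v w

variable {k : Type v} [Field k] {M : Type u} [TopologicalSpace M]
  {p : ℕ} {G : Type w} [CommGroup G] [MulAction G M] {hG : ∀ g : G, g ^ p = 1}
  {n : ℕ} {φ : OpenPartialHomeomorph M (Fin n → ℝ)} {S O O' : Set (Fin n → ℝ)}

/-- An open box. -/
def ob (c d : Fin n → ℝ) : Set (Fin n → ℝ) := {x | ∀ i, c i < x i ∧ x i < d i}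

theorem mem_ob {c d x : Fin n → ℝ} : x ∈ ob c d ↔ ∀ i, c i < x i ∧ x i < d i := Iff.rfl

theorem isOpen_ob (c d : Fin n → ℝ) : IsOpen (ob c d) := by
  have : ob c d = pi univ fun i => Ioo (c i) (d i) := by
    ext
    simp [ob]
  rw [this]
  exact isOpen_set_pi finite_univ fun i _ => isOpen_Ioo

theorem ob_subset (c d : Fin n → ℝ) : ob c d ⊆ Icc c d := fun _ hx =>
  ⟨fun i => (hx i).1.le, fun i => (hx i).2.le⟩

theorem isOpen_symm_image (hO : IsOpen O) (h : O ⊆ φ.target) : IsOpen (φ.symm '' O) :=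
  φ.symm.isOpen_image_of_subset_source hO h

theorem symm_image_sdiff (hS : S ⊆ φ.target) (hO : O ⊆ φ.target) :
    φ.symm '' S ∩ (φ.symm '' O)ᶜ = φ.symm '' (S \ O) := by
  rw [InjOn.image_sdiff (φ.symm.injOn.mono hS), ← sdiff_eq, symm_image_inter hS hO,
    sdiff_self_inter]

theorem compl_symm_image_eq (hS : S ⊆ φ.target) (hO : O ⊆ φ.target) (h : O' ⊆ O)
    (h1 : O \ O' ⊆ S) (h2 : Disjoint S O') :
    (φ.symm '' O')ᶜ = φ.symm '' S ∪ (φ.symm '' O)ᶜ := by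
  ext x
  constructor
  · intro hx
    by_cases hxO : x ∈ φ.symm '' O
    · obtain ⟨y, hy, rfl⟩ := hxO
      exact Or.inl ⟨y, h1 ⟨hy, fun hy' => hx ⟨y, hy', rfl⟩⟩, rfl⟩
    · exact Or.inr hxO
  · rintro (⟨y, hy, rfl⟩ | hx) ⟨z, hz, hzx⟩
    · rw [φ.symm.injOn (hO (h hz)) (hS hy) hzx] at hz
      exact h2.le_bot ⟨hy, hz⟩
    · exact hx ⟨z, h hz, hzx⟩

theorem ob_mono {c d c' d' : Fin n → ℝ} (hc : c ≤ c') (hd : d' ≤ d) : ob c' d' ⊆ ob c d :=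
  fun _ hx i => ⟨(hc i).trans_lt (hx i).1, (hx i).2.trans_le (hd i)⟩

theorem compl_ob_mono {c d c' d' : Fin n → ℝ} (hc : c ≤ c') (hd : d' ≤ d) :
    (φ.symm '' ob c d)ᶜ ⊆ (φ.symm '' ob c' d')ᶜ :=
  compl_subset_compl.2 (image_mono (ob_mono hc hd))

variable [T2Space M] [CompactSpace M]

theorem acy_compl_symm_image {e f c d : Fin n → ℝ} (h : Icc e f ⊆ φ.target) (hef : e ≤ f)
    (hO : IsOpen O) (hOt : O ⊆ φ.target) (hO' : O' ⊆ O) (h1 : O \ O' ⊆ Icc e f)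
    (h2 : Disjoint (Icc e f) O') {i : Fin n} {t : ℝ} (h3 : e i ≤ t) (h4 : t ≤ f i)
    (hS : Icc e f \ O = Icc e f ∩ ({x | x i = t} ∪ faces (Finset.univ.erase i) c d)) :
    Acy k hG ⊤ (φ.symm '' O')ᶜ (φ.symm '' O)ᶜ := by
  rw [compl_symm_image_eq h hOt hO' h1 h2]
  refine Acy.union (isClosed_symm_image isCompact_Icc h) (isOpen_symm_image hO hOt).isClosed_compl
    ?_
  rw [symm_image_sdiff h hOt, hS]
  exact acy_box_faces h hef h3 h4 _ (Finset.notMem_erase _ _)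

theorem acy_update_left {c d : Fin n → ℝ} (h : Icc c d ⊆ φ.target) (hcd : c ≤ d) {i : Fin n}
    {t : ℝ} (h1 : c i ≤ t) (h2 : t < d i) :
    Acy k hG ⊤ (φ.symm '' ob (Function.update c i t) d)ᶜ (φ.symm '' ob c d)ᶜ := by
  have hd : Function.update d i t ≤ d := update_le_iff.2 ⟨h2.le, fun _ _ => le_rfl⟩
  have hsub : Icc c (Function.update d i t) ⊆ Icc c d := Icc_subset_Icc_right hd
  refine acy_compl_symm_image (e := c) (f := Function.update d i t) (i := i) (t := c i) (c := c)
    (d := d) (hsub.trans h) (le_update_iff.2 ⟨h1, fun j _ => hcd j⟩) (isOpen_ob c d)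
    ((ob_subset c d).trans h) ?_ ?_ ?_ le_rfl (by simpa using h1) ?_
  · intro x hx j
    rcases eq_or_ne j i with rfl | hj
    · have := hx j
      rw [Function.update_self] at this
      exact ⟨h1.trans_lt this.1, this.2⟩
    · simpa [hj] using hx j
  · rintro x ⟨hx, hx'⟩
    refine ⟨fun j => (hx j).1.le, le_update_iff.2 ⟨?_, fun j _ => (hx j).2.le⟩⟩
    by_contra! hxi
    refine hx' fun j => ?_
    rcases eq_or_ne j i with rfl | hj
    · simpa using ⟨hxi, (hx j).2⟩
    · simpa [hj] using hx j
  · refine Set.disjoint_left.2 fun x hx hx' => ?_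
    have h3 := hx.2 i
    have h4 := (hx' i).1
    rw [Function.update_self] at h3 h4
    exact h3.not_gt h4
  · ext x
    refine and_congr_right fun hx => ?_
    simp only [mem_ob, not_forall, mem_union, mem_faces, mem_ofPred_eq, Finset.mem_erase,
      Finset.mem_univ, and_true]
    have hx1 := hx.1
    have hx2 := (hsub hx).2
    constructor
    · rintro ⟨j, hj⟩
      have hj' : x j = c j ∨ x j = d j := by
        by_contra! hn
        exact hj ⟨(hx1 j).lt_of_ne hn.1.symm, (hx2 j).lt_of_ne hn.2⟩
      by_cases hji : j = i
      · subst hji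
        have h3 := hx.2 j
        rw [Function.update_self] at h3
        exact Or.inl (hj'.resolve_right (h3.trans_lt h2).ne)
      · exact Or.inr ⟨j, hji, hj'⟩
    · rintro (hi | ⟨j, -, hj | hj⟩)
      exacts [⟨i, fun h => h.1.ne' hi⟩, ⟨j, fun h => h.1.ne' hj⟩, ⟨j, fun h => h.2.ne hj⟩]

theorem acy_update_right {c d : Fin n → ℝ} (h : Icc c d ⊆ φ.target) (hcd : c ≤ d) {i : Fin n}
    {t : ℝ} (h1 : c i < t) (h2 : t ≤ d i) :
    Acy k hG ⊤ (φ.symm '' ob c (Function.update d i t))ᶜ (φ.symm '' ob c d)ᶜ := by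
  have hc : c ≤ Function.update c i t := le_update_iff.2 ⟨h1.le, fun _ _ => le_rfl⟩
  have hsub : Icc (Function.update c i t) d ⊆ Icc c d := Icc_subset_Icc_left hc
  refine acy_compl_symm_image (e := Function.update c i t) (f := d) (i := i) (t := d i) (c := c)
    (d := d) (hsub.trans h) (update_le_iff.2 ⟨h2, fun j _ => hcd j⟩) (isOpen_ob c d)
    ((ob_subset c d).trans h) ?_ ?_ ?_ (by simpa using h2) le_rfl ?_
  · intro x hx j
    rcases eq_or_ne j i with rfl | hj
    · have := hx j
      rw [Function.update_self] at this
      exact ⟨this.1, this.2.trans_le h2⟩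
    · simpa [hj] using hx j
  · rintro x ⟨hx, hx'⟩
    refine ⟨update_le_iff.2 ⟨?_, fun j _ => (hx j).1.le⟩, fun j => (hx j).2.le⟩
    by_contra! hxi
    refine hx' fun j => ?_
    rcases eq_or_ne j i with rfl | hj
    · simpa using ⟨(hx j).1, hxi⟩
    · simpa [hj] using hx j
  · refine Set.disjoint_left.2 fun x hx hx' => ?_
    have h3 := hx.1 i
    have h4 := (hx' i).2
    rw [Function.update_self] at h3 h4
    exact h3.not_gt h4
  · ext x
    refine and_congr_right fun hx => ?_
    simp only [mem_ob, not_forall, mem_union, mem_faces, mem_ofPred_eq, Finset.mem_erase,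
      Finset.mem_univ, and_true]
    have hx1 := (hsub hx).1
    have hx2 := hx.2
    constructor
    · rintro ⟨j, hj⟩
      have hj' : x j = c j ∨ x j = d j := by
        by_contra! hn
        exact hj ⟨(hx1 j).lt_of_ne hn.1.symm, (hx2 j).lt_of_ne hn.2⟩
      by_cases hji : j = i
      · subst hji
        have h3 := hx.1 j
        rw [Function.update_self] at h3
        exact Or.inl (hj'.resolve_left (h1.trans_le h3).ne')
      · exact Or.inr ⟨j, hji, hj'⟩
    · rintro (hi | ⟨j, -, hj | hj⟩)
      exacts [⟨i, fun h => h.2.ne hi⟩, ⟨j, fun h => h.1.ne' hj⟩, ⟨j, fun h => h.2.ne hj⟩]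

theorem acy_piecewise_left {c d c' : Fin n → ℝ} (h : Icc c d ⊆ φ.target) (hc : c ≤ c')
    (hcd : ∀ i, c' i < d i) (s : Finset (Fin n)) :
    Acy k hG ⊤ (φ.symm '' ob (s.piecewise c' c) d)ᶜ (φ.symm '' ob c d)ᶜ := by
  classical
  induction s using Finset.induction_on with
  | empty =>
    rw [Finset.piecewise_empty]
    exact Acy.refl _
  | insert i s hi ih =>
    have h0 : c ≤ s.piecewise c' c := Finset.le_piecewise_of_le_of_le s hc le_rfl
    have h1 : s.piecewise c' c ≤ c' := Finset.piecewise_le_of_le_of_le s le_rfl hc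
    rw [Finset.piecewise_insert]
    exact Acy.trans (acy_update_left ((Icc_subset_Icc_left h0).trans h)
      (h1.trans fun i => (hcd i).le) (h1 i) (hcd i)) ih
      (compl_ob_mono (le_update_iff.2 ⟨h1 i, fun _ _ => le_rfl⟩) le_rfl) (compl_ob_mono h0 le_rfl)

theorem acy_piecewise_right {c d d' : Fin n → ℝ} (h : Icc c d ⊆ φ.target) (hd : d' ≤ d)
    (hcd : ∀ i, c i < d' i) (s : Finset (Fin n)) :
    Acy k hG ⊤ (φ.symm '' ob c (s.piecewise d' d))ᶜ (φ.symm '' ob c d)ᶜ := by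
  classical
  induction s using Finset.induction_on with
  | empty =>
    rw [Finset.piecewise_empty]
    exact Acy.refl _
  | insert i s hi ih =>
    have h0 : s.piecewise d' d ≤ d := Finset.piecewise_le_of_le_of_le s hd le_rfl
    have h1 : d' ≤ s.piecewise d' d := Finset.le_piecewise_of_le_of_le s le_rfl hd
    rw [Finset.piecewise_insert]
    exact Acy.trans (acy_update_right ((Icc_subset_Icc_right h0).trans h)
      (fun i => (hcd i).le.trans (h1 i)) (hcd i) (h1 i)) ih
      (compl_ob_mono le_rfl (update_le_iff.2 ⟨h1 i, fun _ _ => le_rfl⟩)) (compl_ob_mono le_rfl h0)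

theorem acy_shell {c d c' d' : Fin n → ℝ} (h : Icc c d ⊆ φ.target) (hc : c ≤ c') (hd : d' ≤ d)
    (hcd : ∀ i, c' i < d' i) :
    Acy k hG ⊤ (φ.symm '' ob c' d')ᶜ (φ.symm '' ob c d)ᶜ := by
  have h1 := acy_piecewise_left (k := k) (hG := hG) h hc (fun i => (hcd i).trans_le (hd i))
    Finset.univ
  have h2 := acy_piecewise_right (k := k) (hG := hG) (φ := φ) (c := c') (d := d)
    ((Icc_subset_Icc_left hc).trans h) hd hcd Finset.univ
  rw [Finset.piecewise_univ] at h1 h2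
  exact Acy.trans h2 h1 (compl_ob_mono le_rfl hd) (compl_ob_mono hc le_rfl)

theorem H_compl_ob {c d : Fin n → ℝ} (h : Icc c d ⊆ φ.target) (hcd : ∀ i, c i < d i) (j : ℕ) :
    (AS k M hG).H (LF k ⊤ univ) (LF k ⊤ (φ.symm '' ob c d)ᶜ) j = if j = n + 1 then 1 else 0 := by
  have hO := (ob_subset c d).trans h
  have e : (univ : Set M) = φ.symm '' Icc c d ∪ (φ.symm '' ob c d)ᶜ := by
    rw [← compl_symm_image_eq (O' := ∅) h hO (empty_subset _) _ (disjoint_empty _), image_empty,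
      compl_empty]
    rw [sdiff_empty]
    exact ob_subset c d
  rw [e, H_LF_excision (isClosed_symm_image isCompact_Icc h)
    (isOpen_symm_image (isOpen_ob c d) hO).isClosed_compl, symm_image_sdiff h hO]
  have e' : Icc c d \ ob c d = Icc c d ∩ faces Finset.univ c d := by
    ext x
    refine and_congr_right fun hx => ?_
    simp only [mem_ob, not_forall, mem_faces, Finset.mem_univ, true_and]
    refine exists_congr fun j => ?_
    have h1 := hx.1 j
    have h2 := hx.2 j
    rw [not_and_or, not_lt, not_lt]
    exact or_congr ⟨fun h => le_antisymm h h1, fun h => h.le⟩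
      ⟨fun h => le_antisymm h2 h, fun h => h.ge⟩
  rw [e', H_box_faces h (fun i => (hcd i).le) _ (fun i _ => hcd i)]
  simp

end MannSu

namespace MannSu

open scoped Topology
open Set Filter

universe u v w

variable {k : Type v} [Field k] {M : Type u} [TopologicalSpace M]
  {p : ℕ} {G : Type w} [CommGroup G] [MulAction G M] {hG : ∀ g : G, g ^ p = 1}
  {n : ℕ} {φ : OpenPartialHomeomorph M (Fin n → ℝ)} {y : M}

theorem Amb.wt_le_mul {D : Amb.{u} k p G} {A B : ℕ → Submodule k D.V} {b : ℕ}
    (h : ∀ j, D.H A B j ≤ b) (N : ℕ) : D.wt N A B ≤ (N * (N * b) : ℕ) := by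
  rw [wt]
  exact (Finset.sum_le_sum (g := fun _ => N * (b : ℕ∞)) fun j _ =>
    (Finset.sum_le_sum fun i _ => h _).trans_eq (by simp)).trans_eq (by simp)

theorem LF_univ (𝓕 : Filter M) : LF k 𝓕 univ = A k univ := by
  funext j
  refine le_antisymm (fun l hl => ?_) (A_le_LF j)
  obtain ⟨Z, -, -, h⟩ := mem_LF.1 hl
  rwa [univ_union] at h

theorem exists_ob (hy : y ∈ φ.source) {U : Set M} (hU : U ∈ 𝓝 y) :
    ∃ c d : Fin n → ℝ, (∀ i, c i < d i) ∧ Icc c d ⊆ φ.target ∧ φ y ∈ ob c d ∧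
      φ.symm '' Icc c d ⊆ U := by
  have hV : φ.target ∩ φ.symm ⁻¹' U ∈ 𝓝 (φ y) := by
    refine inter_mem (φ.open_target.mem_nhds (φ.map_source hy)) ?_
    refine (φ.continuousAt_symm (φ.map_source hy)).preimage_mem_nhds ?_
    rwa [φ.left_inv hy]
  obtain ⟨ε, hε, h⟩ := Metric.nhds_basis_closedBall.mem_iff.1 hV
  have h' : Icc (fun i => φ y i - ε) (fun i => φ y i + ε) ⊆ Metric.closedBall (φ y) ε := by
    intro x hx
    rw [Metric.mem_closedBall, dist_pi_le_iff hε.le]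
    intro i
    rw [Real.dist_eq, abs_le]
    have h1 := hx.1 i
    have h2 := hx.2 i
    dsimp only at h1 h2
    constructor <;> linarith
  refine ⟨_, _, fun i => ?_, fun x hx => (h (h' hx)).1, fun i =>
    ⟨sub_lt_self _ hε, lt_add_of_pos_right _ hε⟩, image_subset_iff.2 fun x hx => (h (h' hx)).2⟩
  linarith

theorem symm_image_ob_mem (hy : y ∈ φ.source) {c d : Fin n → ℝ} (h : Icc c d ⊆ φ.target)
    (hyc : φ y ∈ ob c d) : φ.symm '' ob c d ∈ 𝓝 y :=
  (isOpen_symm_image (isOpen_ob c d) ((ob_subset c d).trans h)).mem_nhds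
    ⟨φ y, hyc, φ.left_inv hy⟩

theorem exists_ob_subset {c d : Fin n → ℝ} (h : Icc c d ⊆ φ.target) {y : M} {W : Set M}
    (hW : W ∈ 𝓝 y) (hWc : W ⊆ φ.symm '' ob c d) :
    ∃ c' d' : Fin n → ℝ, (∀ i, c' i < d' i) ∧ c ≤ c' ∧ d' ≤ d ∧ y ∈ φ.symm '' ob c' d' ∧
      φ.symm '' ob c' d' ⊆ W := by
  have hO := (ob_subset c d).trans h
  obtain ⟨x, hx, hxy⟩ := hWc (mem_of_mem_nhds hW)
  have hy : y ∈ φ.source := hxy ▸ φ.map_target (hO hx)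
  obtain ⟨c', d', hcd, ht, hyc, hsub⟩ := exists_ob hy hW
  have hle : c' ≤ d' := fun i => (hcd i).le
  have key : Icc c' d' ⊆ Icc c d := by
    intro z hz
    obtain ⟨z', hz', e⟩ := hWc (hsub ⟨z, hz, rfl⟩)
    rw [← φ.symm.injOn (hO hz') (ht hz) e]
    exact ob_subset c d hz'
  exact ⟨c', d', hcd, (key (left_mem_Icc.2 hle)).1, (key (right_mem_Icc.2 hle)).2,
    ⟨φ y, hyc, φ.left_inv hy⟩, (image_mono (ob_subset c' d')).trans hsub⟩

theorem LF_top_le_LO {Z : Set M} (hZ : IsClosed Z) (hZy : Zᶜ ∈ 𝓝 y) :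
    LF k ⊤ Z ≤ LO k (𝓝 y) := fun _ _ hl => mem_LO.2 ⟨Z, hZ, hZy, by rwa [LF_top] at hl⟩

theorem compl_ob_le_LO (hy : y ∈ φ.source) {c d : Fin n → ℝ} (h : Icc c d ⊆ φ.target)
    (hyc : φ y ∈ ob c d) : LF k ⊤ (φ.symm '' ob c d)ᶜ ≤ LO k (𝓝 y) :=
  LF_top_le_LO (isOpen_symm_image (isOpen_ob c d) ((ob_subset c d).trans h)).isClosed_compl
    (by rw [compl_compl]; exact symm_image_ob_mem hy h hyc)

theorem mem_compl_image_ob {c d : Fin n → ℝ} {W : Set M} (hW : φ.symm '' ob c d ⊆ W) {j : ℕ}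
    {l : Module.Dual k (List M → k)} (hl : l ∈ A k Wᶜ j) :
    l ∈ LF k ⊤ (φ.symm '' ob c d)ᶜ j := by
  rw [LF_top]
  exact AF_mono (compl_subset_compl.2 hW) j hl

theorem th_mem_A_compl [ContinuousConstSMul G M] (hk : (p : k) = 0) {g : G}
    (hfix : ∀ (h : G) (x : M), g • x = x → h • x = x) {S : Set M}
    (hS : S ⊆ interior (MulAction.fixedBy M g)) {j : ℕ} (m : ℕ)
    {q : Module.Dual k (List M → k)} (hq : q ∈ A k univ j) :
    (AS k M hG).th g m q ∈ A k (interior S)ᶜ j := by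
  have hu : univ = S ∪ (interior S)ᶜ := by
    refine (compl_subset_iff_union.1 ?_).symm
    exact compl_subset_compl.2 interior_subset
  rw [hu, A_union] at hq
  obtain ⟨a, ha, b, hb, rfl⟩ := Submodule.mem_sup.1 hq
  have ha' : a ∈ AF k (MulAction.fixedBy M g) (MulAction.fixedBy M g) j := by
    rw [mem_AF] at ha ⊢
    refine fun f hf => ha f fun hj x hx => ?_
    have hxF := hS hx
    obtain ⟨U, hU, h⟩ := hf hj (interior_subset hxF)
    exact ⟨U ∩ MulAction.fixedBy M g, inter_mem hU (mem_interior_iff_mem_nhds.1 hxF),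
      fun l hl hlU => h l hl fun z hz => (hlU z hz).1⟩
  have h0 := th_mem_LO (k := k) (hG := hG) (𝓕 := (⊤ : Filter M)) hk (fun _ => tendsto_top)
    (F := MulAction.fixedBy M g) (g := g) (fun x hx => hx) m j (Submodule.mem_sup_left ha')
  rw [← LF_empty, LF_top, A, AF_empty, Submodule.mem_bot] at h0
  rw [map_add, h0, zero_add]
  refine (isSub_A (S := (interior S)ᶜ) fun h x hx hx' => hx ?_).th_mem g m hb
  replace hx' : h • x ∈ interior S := hx'
  have h1 : h • x ∈ MulAction.fixedBy M g := interior_subset (hS (interior_subset hx'))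
  have h2 := hfix h⁻¹ _ h1
  rw [inv_smul_smul] at h2
  rwa [← h2] at hx'

variable [T2Space M] [CompactSpace M]

theorem H_LO_compl_ob (hy : y ∈ φ.source) {c d : Fin n → ℝ} (h : Icc c d ⊆ φ.target)
    (hyc : φ y ∈ ob c d) (j : ℕ) :
    (AS k M hG).H (LO k (𝓝 y)) (LF k ⊤ (φ.symm '' ob c d)ᶜ) j = 0 := by
  rw [Amb.H_eq_zero_iff]
  intro z hz hdz
  obtain ⟨Z, -, hZy, hzZ⟩ := mem_LO.1 hz
  obtain ⟨c', d', hcd, hc, hd, hyc', hsub⟩ :=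
    exists_ob_subset h (inter_mem hZy (symm_image_ob_mem hy h hyc)) inter_subset_right
  have hs := acy_shell (k := k) (hG := hG) h hc hd hcd
  obtain ⟨q, hq, hzq⟩ := Amb.H_eq_zero_iff.1 (hs j) z
    (mem_compl_image_ob (hsub.trans inter_subset_left) (by rwa [compl_compl])) hdz
  refine ⟨q, LF_top_le_LO ?_ ?_ _ hq, hzq⟩
  · have ht : ob c' d' ⊆ φ.target := (ob_mono hc hd).trans ((ob_subset c d).trans h)
    exact (isOpen_symm_image (isOpen_ob c' d') ht).isClosed_compl
  · rw [compl_compl]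
    have ht : ob c' d' ⊆ φ.target := (ob_mono hc hd).trans ((ob_subset c d).trans h)
    exact (isOpen_symm_image (isOpen_ob c' d') ht).mem_nhds hyc'

theorem H_nhds_ne_zero (hy : y ∈ φ.source) :
    (AS k M hG).H (LF k (𝓝 y) univ) (LO k (𝓝 y)) (n + 1) ≠ 0 := by
  intro h0
  obtain ⟨c, d, hcd, h, hyc, -⟩ := exists_ob hy univ_mem
  have h1 := H_compl_ob (k := k) (hG := hG) h hcd (n + 1)
  rw [if_pos rfl] at h1
  have h2 := Amb.H_triple_mid (D := AS k M hG) (LO_le_LF (k := k) (𝓕 := 𝓝 y) (S := univ))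
    (compl_ob_le_LO hy h hyc) (n + 1)
  rw [h0, H_LO_compl_ob hy h hyc, add_zero, LF_univ, ← LF_univ ⊤, h1] at h2
  exact absurd h2 (by simp)

theorem H_nhds_le (hy : y ∈ φ.source) (j : ℕ) :
    (AS k M hG).H (LF k (𝓝 y) univ) (LO k (𝓝 y)) j ≤ 1 := by
  obtain ⟨c, d, hcd, h, hyc, -⟩ := exists_ob hy univ_mem
  cases j with
  | zero =>
    have h0 := LF_zero_H (k := k) (hG := hG) (𝓕 := 𝓝 y) (S := univ) (T := ∅) 0 rfl
    rw [show LF k (𝓝 y) ∅ = LO k (𝓝 y) from funext fun _ => LF_empty] at h0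
    rw [h0]
    exact bot_le
  | succ j =>
    have h2 := Amb.H_triple_quot (D := AS k M hG) (LO_le_LF (k := k) (𝓕 := 𝓝 y) (S := univ))
      (compl_ob_le_LO hy h hyc) j
    rw [H_LO_compl_ob hy h hyc, add_zero] at h2
    refine h2.trans ?_
    rw [LF_univ, ← LF_univ ⊤, H_compl_ob h hcd]
    split_ifs <;> simp

theorem wt_nhds_le (hy : y ∈ φ.source) (N : ℕ) :
    (AS k M hG).wt N (LF k (𝓝 y) univ) (LO k (𝓝 y)) ≤ (N * (N * 1) : ℕ) :=
  Amb.wt_le_mul (by simpa using H_nhds_le hy) N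

/-- A local cycle that can be pushed off points arbitrarily near `y` bounds. -/
theorem mem_Bd_of_push (hy : y ∈ φ.source) {j : ℕ} {z : Module.Dual k (List M → k)}
    (hz : z ∈ (AS k M hG).Z (LF k (𝓝 y) univ) (LO k (𝓝 y)) j)
    (h : ∀ U ∈ 𝓝 y, ∃ W, IsOpen W ∧ W.Nonempty ∧ W ⊆ U ∧ ∃ q ∈ A k univ (j + 1),
      z - (AS k M hG).d q ∈ A k Wᶜ j) :
    z ∈ (AS k M hG).Bd (LF k (𝓝 y) univ) (LO k (𝓝 y)) j := by
  obtain ⟨Z, -, hZy, hdz⟩ := mem_LO.1 (Amb.mem_Z.1 hz).2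
  obtain ⟨c, d, -, ht, hyc, hsub⟩ := exists_ob hy hZy
  obtain ⟨W, hW, ⟨x, hx⟩, hWU, q, hq, hzq⟩ := h _ (symm_image_ob_mem hy ht hyc)
  obtain ⟨c', d', hcd, hc, hd, -, hsub'⟩ := exists_ob_subset ht (hW.mem_nhds hx) hWU
  have hs := acy_shell (k := k) (hG := hG) ht hc hd hcd
  obtain ⟨q', hq', hzq'⟩ := Amb.H_eq_zero_iff.1 (hs j) _ (mem_compl_image_ob hsub' hzq) (by
    rw [map_sub, (AS k M hG).dd, sub_zero]
    refine mem_compl_image_ob (W := Zᶜ) ((image_mono (ob_subset c d)).trans hsub) ?_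
    rwa [compl_compl])
  rw [LF_top] at hq'
  refine Amb.mem_Bd.2 ⟨q + q', ?_, ?_⟩
  · rw [LF_univ]
    exact add_mem hq (AF_mono (subset_univ _) _ hq')
  · rw [map_add, ← sub_sub]
    exact compl_ob_le_LO hy ht hyc _ hzq'

/-- A closed set carrying the local homology at `y` is a neighbourhood of `y`. -/
theorem Acy.mem_nhds (hy : y ∈ φ.source) {X : Set M} (hX : Acy k hG (𝓝 y) univ X)
    (hXc : IsClosed X) : X ∈ 𝓝 y := by
  by_contra hXy
  refine H_nhds_ne_zero (k := k) (hG := hG) hy ?_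
  rw [Amb.H, relLen_eq_zero_iff]
  intro z hz
  obtain ⟨q, hq, hzq⟩ := Amb.H_eq_zero_iff.1 (hX (n + 1)) z hz.1 (LO_le_LF _ hz.2)
  obtain ⟨Z, hZ, hZy, hzq⟩ := mem_LF.1 hzq
  refine mem_Bd_of_push hy hz fun U hU => ⟨interior (U ∩ Zᶜ) ∩ Xᶜ,
    isOpen_interior.inter hXc.isOpen_compl, ?_, fun x hx => (interior_subset hx.1).1, q,
    by rwa [LF_univ] at hq, AF_mono ?_ _ hzq⟩
  · by_contra! he
    refine hXy (mem_of_superset (interior_mem_nhds.2 (inter_mem hU hZy)) fun x hx => ?_)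
    by_contra hxX
    exact he.subset ⟨hx, hxX⟩
  · rintro x (hx | hx) hx'
    exacts [hx'.2 hx, (interior_subset hx'.1).2 hx]

variable [ContinuousConstSMul G M] [TopologicalSpace.MetrizableSpace M] [Finite G]

/-- Newman's theorem. -/
theorem fixedBy_mem_nhds (hp : p.Prime) (hk : (p : k) = 0) (hG : ∀ g : G, g ^ p = 1)
    (hM : LocEuc n M) {g : G} (hg : g ≠ 1) (hfix : ∀ (h : G) (x : M), g • x = x → h • x = x)
    (hy : y ∈ closure (interior (MulAction.fixedBy M g))) : MulAction.fixedBy M g ∈ 𝓝 y := by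
  by_contra hF
  obtain ⟨φ, hyφ⟩ := hM y
  set F := MulAction.fixedBy M g with hFdef
  have hFc : IsClosed F := isClosed_fixedBy g
  have hyF : g • y = y := closure_minimal interior_subset hFc hy
  have h𝓕 : ∀ h : G, Tendsto (h • · : M → M) (𝓝 y) (𝓝 y) := fun h => by
    have := (continuous_const_smul h).tendsto y
    rwa [hfix h y hyF] at this
  have hth := th_mem_LO (k := k) (hG := hG) (𝓕 := 𝓝 y) hk h𝓕 (F := F) (g := g) fun x hx => hx
  have hOK : LO k (𝓝 y) ≤ KF k (𝓝 y) F := LO_le_KF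
  have hC : (AS k M hG).IsSub (LF k (𝓝 y) univ) := isSub_LF h𝓕 fun _ => mapsTo_univ _ _
  have hKC : KF k (𝓝 y) F ≤ LF k (𝓝 y) univ := KF_le_LF.trans (LF_mono (subset_univ F))
  have hth' : ∀ n j, ∀ x ∈ KF k (𝓝 y) F j, (AS k M hG).th g n x ∈ LO k (𝓝 y) j :=
    fun n j x hx => hth n j hx
  refine H_nhds_ne_zero (k := k) (hG := hG) hyφ
    (Amb.newman_vanish (g := g) (K := KF k (𝓝 y) F) hth' hOK (N := n + 4) (fun ε j hj => ?_) ?_ _)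
  · have := H_phi_LF_KF (k := k) (hG := hG) hp hM h𝓕 isClosed_univ
      (fun h => mapsTo_univ (h • ·) _) hg ε
      (Nat.succ_le_of_lt hj)
    rwa [univ_inter] at this
  intro ε j
  have hle := Amb.smithP_le (D := AS k M hG) hC hKC hth' ε j
  rintro _ ⟨⟨q, κ⟩, ⟨hq, hκ⟩, rfl⟩
  refine add_mem (mem_Bd_of_push hyφ ?_ fun U hU => ?_) (mem_Bd_of_push hyφ ?_ fun U hU => ?_)
  · have := hle ⟨⟨q, 0⟩, ⟨hq, zero_mem _⟩, rfl⟩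
    simpa using this
  · obtain ⟨x, hx⟩ := mem_closure_iff_nhds.1 hy _ (interior_mem_nhds.2 hU)
    obtain ⟨S, hSx, -, hS⟩ :=
      exists_mem_nhds_isClosed_subset ((isOpen_interior.inter isOpen_interior).mem_nhds hx)
    refine ⟨interior S, isOpen_interior, ⟨x, mem_interior_iff_mem_nhds.2 hSx⟩,
      fun z hz => interior_subset (hS (interior_subset hz)).1, 0, zero_mem _, ?_⟩
    rw [map_zero, sub_zero]
    refine th_mem_A_compl hk hfix (fun z hz => (hS hz).2) _ ?_
    have := Amb.mem_fam.1 hq.1 0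
    rwa [LF_univ] at this
  · exact ⟨hKC _ hκ.1, hκ.2⟩
  · obtain ⟨Z, hZ, hZy, h⟩ := mem_LF.1 (KF_le_LF _ hκ.1)
    refine ⟨interior (U ∩ Zᶜ) ∩ Fᶜ, isOpen_interior.inter hFc.isOpen_compl, ?_,
      fun x hx => (interior_subset hx.1).1, 0, zero_mem _, ?_⟩
    · by_contra! he
      refine hF (mem_of_superset (interior_mem_nhds.2 (inter_mem hU hZy)) fun x hx => ?_)
      by_contra hxX
      exact he.subset ⟨hx, hxX⟩
    · rw [map_zero, sub_zero]
      refine AF_mono ?_ _ h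
      rintro x (hx | hx) hx'
      exacts [hx'.2 hx, (interior_subset hx'.1).2 hx]

end MannSu

namespace MannSu

open scoped Topology
open Set Filter

universe u v w

variable {M : Type u} [TopologicalSpace M] {n : ℕ}

section Boxes

variable {k : Type v} [Field k] {p : ℕ} {G : Type w} [CommGroup G] [MulAction G M]
  {hG : ∀ g : G, g ^ p = 1} {φ : OpenPartialHomeomorph M (Fin n → ℝ)}

theorem H_box_le {a b : Fin n → ℝ} (h : Icc a b ⊆ φ.target) (j : ℕ) :
    (AS k M hG).H (LF k ⊤ (φ.symm '' Icc a b)) (LF k ⊤ ∅) j ≤ 1 := by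
  rcases (Icc a b).eq_empty_or_nonempty with he | hne
  · rw [he, image_empty, Amb.H_self]
    exact bot_le
  · rw [(triv_symm_image h).H_empty (hne.image _)]
    split_ifs <;> simp

theorem H_boxes_le [T2Space M] [CompactSpace M] {ι : Type*} (s : Finset ι) (a b : ι → Fin n → ℝ)
    (h : ∀ i ∈ s, Icc (a i) (b i) ⊆ φ.target) (j : ℕ) :
    (AS k M hG).H (LF k ⊤ (⋃ i ∈ s, φ.symm '' Icc (a i) (b i))) (LF k ⊤ ∅) j ≤
      (3 ^ s.card : ℕ) := by
  classical
  induction s using Finset.induction_on generalizing a b j with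
  | empty =>
    simp only [Finset.notMem_empty, iUnion_of_empty, iUnion_empty, Amb.H_self]
    exact bot_le
  | insert i s hi ih =>
    have hs : ∀ i ∈ s, Icc (a i) (b i) ⊆ φ.target := fun i hi => h i (Finset.mem_insert_of_mem hi)
    have ht := h i (Finset.mem_insert_self i s)
    set B := φ.symm '' Icc (a i) (b i) with hB
    set U := ⋃ i ∈ s, φ.symm '' Icc (a i) (b i) with hU
    have hBc : IsClosed B := isClosed_symm_image isCompact_Icc ht
    have hUc : IsClosed U :=
      s.finite_toSet.isClosed_biUnion fun i hi => isClosed_symm_image isCompact_Icc (hs i hi)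
    rw [Finset.set_biUnion_insert, Finset.card_insert_of_notMem hi]
    refine (Amb.H_triple_mid (LF_mono subset_union_right) (LF_mono (empty_subset U)) j).trans ?_
    rw [H_LF_excision hBc hUc]
    have h1 : (AS k M hG).H (LF k ⊤ B) (LF k ⊤ (B ∩ U)) j ≤ 1 + (3 ^ s.card : ℕ) := by
      cases j with
      | zero =>
        rw [LF_zero_H 0 rfl]
        exact bot_le
      | succ j =>
        refine (Amb.H_triple_quot (LF_mono inter_subset_left)
          (LF_mono (empty_subset (B ∩ U))) j).trans (add_le_add (H_box_le ht _) ?_)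
        have hBU : B ∩ U = ⋃ i' ∈ s, φ.symm '' Icc (a i ⊔ a i') (b i ⊓ b i') := by
          rw [hU, inter_iUnion₂]
          refine iUnion₂_congr fun i' hi' => ?_
          rw [← Icc_inter_Icc, symm_image_inter ht (hs i' hi')]
        rw [hBU]
        exact ih _ _ (fun i' _ => (Icc_subset_Icc le_sup_left inf_le_left).trans ht) j
    refine (add_le_add h1 (ih a b hs j)).trans ?_
    have : 1 + 3 ^ s.card + 3 ^ s.card ≤ 3 ^ (s.card + 1) := by
      have := Nat.one_le_pow s.card 3 (by norm_num)
      omega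
    exact_mod_cast this

end Boxes

/-- The image in `L` of the homology of `K` is finite, uniformly in the coefficients. -/
def Bdd (K L : Set M) : Prop :=
  ∃ b : ℕ, ∀ (k : Type) [Field k] (p : ℕ) (G : Type) [CommGroup G] [MulAction G M]
    (hG : ∀ g : G, g ^ p = 1) (j : ℕ),
    relLen (A k K j ⊓ LinearMap.ker (AS k M hG).d) ((A k L (j + 1)).map (AS k M hG).d) ≤ b

theorem Bdd.union [NormalSpace M] {K₁ K₂ L₁ L₂ L : Set M} (h₁ : IsClosed K₁) (h₂ : IsClosed K₂)
    (hK₁ : K₁ ⊆ L₁) (hK₂ : K₂ ⊆ L₂) (h : Bdd (K₁ ∩ K₂) (L₁ ∩ L₂)) (hL₁ : Bdd L₁ L)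
    (hL₂ : Bdd L₂ L) : Bdd (K₁ ∪ K₂) L := by
  obtain ⟨b, hb⟩ := h
  obtain ⟨b₁, hb₁⟩ := hL₁
  obtain ⟨b₂, hb₂⟩ := hL₂
  refine ⟨b + (b₁ + b₂), fun k _ p G _ _ hG j => ?_⟩
  cases j with
  | zero =>
    rw [A, AF_zero, bot_inf_eq, relLen_eq_zero bot_le]
    exact bot_le
  | succ j =>
    set δ := (AS k M hG).d with hδ
    let σ : (AS k M hG).V × (AS k M hG).V →ₗ[k] (AS k M hG).V :=
      LinearMap.coprod LinearMap.id LinearMap.id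
    let T := (A k K₁ (j + 1)).prod (A k K₂ (j + 1)) ⊓ LinearMap.ker (δ ∘ₗ σ)
    have hT : A k (K₁ ∪ K₂) (j + 1) ⊓ LinearMap.ker δ ≤ T.map σ := by
      rintro z ⟨hz, hdz⟩
      replace hz : z ∈ A k (K₁ ∪ K₂) (j + 1) := hz
      rw [A_union] at hz
      obtain ⟨z₁, hz₁, z₂, hz₂, rfl⟩ := Submodule.mem_sup.1 hz
      exact ⟨(z₁, z₂), ⟨⟨hz₁, hz₂⟩, hdz⟩, rfl⟩
    let R := ((A k (L₁ ∩ L₂) (j + 1)).map δ).comap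
      (δ ∘ₗ LinearMap.fst k (AS k M hG).V (AS k M hG).V)
    refine (relLen_mono _ hT).trans ?_
    rw [relLen_map]
    refine (relLen_le_add _ _ R).trans ?_
    rw [← relLen_map, ← relLen_map, Nat.cast_add, Nat.cast_add]
    refine add_le_add ((relLen_mono _ ?_).trans (hb k p G hG j)) ((relLen_mono _ ?_).trans
      ((relLen_sup_le _ _ _).trans (add_le_add (hb₁ k p G hG (j + 1)) (hb₂ k p G hG (j + 1)))))
    · rintro _ ⟨⟨z₁, z₂⟩, ⟨⟨hz₁, hz₂⟩, hz⟩, rfl⟩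
      replace hz : δ (z₁ + z₂) = 0 := hz
      rw [map_add] at hz
      refine ⟨?_, (AS k M hG).dd _⟩
      change δ z₁ ∈ A k (K₁ ∩ K₂) j
      rw [A_inter h₁ h₂]
      refine ⟨AF_d_mem (hG := hG) hz₁, ?_⟩
      change δ z₁ ∈ A k K₂ j
      rw [eq_neg_of_add_eq_zero_left hz]
      exact neg_mem (AF_d_mem (hG := hG) hz₂)
    · rintro _ ⟨⟨z₁, z₂⟩, ⟨⟨⟨hz₁, hz₂⟩, hz⟩, y, hy, hyz⟩, rfl⟩
      replace hz : δ (z₁ + z₂) = 0 := hz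
      replace hyz : δ y = δ z₁ := hyz
      refine Submodule.mem_sup.2 ⟨z₁ - y, ⟨sub_mem (AF_mono hK₁ _ hz₁)
        (AF_mono inter_subset_left _ hy), ?_⟩, z₂ + y, ⟨add_mem (AF_mono hK₂ _ hz₂)
        (AF_mono inter_subset_right _ hy), ?_⟩, ?_⟩
      · exact LinearMap.mem_ker.2 (by rw [map_sub, hyz, sub_self])
      · exact LinearMap.mem_ker.2 (by rw [map_add, hyz, add_comm, ← map_add, hz])
      · change z₁ - y + (z₂ + y) = z₁ + z₂
        abel

theorem relLen_le_of_H_le {k : Type v} [Field k] {p : ℕ} {G : Type w} [CommGroup G] [MulAction G M]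
    {hG : ∀ g : G, g ^ p = 1} {K S L : Set M} (hKS : K ⊆ S) (hSL : S ⊆ L) (j : ℕ) :
    relLen (A k K j ⊓ LinearMap.ker (AS k M hG).d) ((A k L (j + 1)).map (AS k M hG).d) ≤
      (AS k M hG).H (LF k ⊤ S) (LF k ⊤ ∅) j := by
  refine (relLen_mono _ ?_).trans (relLen_anti _ ?_)
  · rintro z ⟨hz, hdz⟩
    refine ⟨A_le_LF _ (AF_mono hKS _ hz), ?_⟩
    change (AS k M hG).d z ∈ LF k ⊤ ∅ (j - 1)
    rw [LinearMap.mem_ker.1 hdz]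
    exact zero_mem _
  · rw [Amb.Bd, LF_top, LF_top, A, AF_empty, bot_sup_eq]
    exact Submodule.map_mono (AF_mono hSL _)

variable [T2Space M] [CompactSpace M]

theorem Bdd.of_chart {φ : OpenPartialHomeomorph M (Fin n → ℝ)} {K L : Set M} (hK : IsClosed K)
    (hKφ : K ⊆ φ.source) (hKL : K ⊆ interior L) : Bdd K L := by
  classical
  choose! a b _ ht hm hsub using fun (y : M) (hy : y ∈ K) =>
    exists_ob (hKφ hy) (isOpen_interior.mem_nhds (hKL hy))
  obtain ⟨s, hs, hsK⟩ := hK.isCompact.elim_nhds_subcover (fun y => φ.symm '' ob (a y) (b y))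
    fun y hy => symm_image_ob_mem (hKφ hy) (ht y hy) (hm y hy)
  refine ⟨3 ^ s.card, fun k _ p G _ _ hG j => ?_⟩
  refine (relLen_le_of_H_le (S := ⋃ y ∈ s, φ.symm '' Icc (a y) (b y)) ?_ ?_ j).trans
    (H_boxes_le s a b (fun y hy => ht y (hs y hy)) j)
  · exact hsK.trans (iUnion₂_mono fun y _ => image_mono (ob_subset _ _))
  · exact iUnion₂_subset fun y hy => (hsub y (hs y hy)).trans interior_subset

theorem Bdd.of_charts {ι : Type*} (s : Finset ι) (φ : ι → OpenPartialHomeomorph M (Fin n → ℝ))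
    {K L : Set M} (hK : IsClosed K) (hKφ : K ⊆ ⋃ i ∈ s, (φ i).source) (hKL : K ⊆ interior L) :
    Bdd K L := by
  classical
  induction s using Finset.induction_on generalizing K with
  | empty =>
    have : K = ∅ := by simpa using hKφ
    refine ⟨0, fun k _ p G _ _ hG j => ?_⟩
    rw [this, A, AF_empty, bot_inf_eq, relLen_eq_zero bot_le]
    exact bot_le
  | insert i s hi ih =>
    rw [Finset.set_biUnion_insert] at hKφ
    have hO : IsOpen (⋃ i ∈ s, (φ i).source) := isOpen_biUnion fun i _ => (φ i).open_source
    obtain ⟨K₁, K₂, h₁, h₂, hs₁, hs₂, rfl⟩ :=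
      hK.isCompact.binary_compact_cover (φ i).open_source hO hKφ
    obtain ⟨U₁, hU₁, hKU₁, hUL₁⟩ := normal_exists_closure_subset h₁.isClosed
      ((φ i).open_source.inter isOpen_interior)
      (subset_inter hs₁ (subset_union_left.trans hKL))
    obtain ⟨U₂, hU₂, hKU₂, hUL₂⟩ := normal_exists_closure_subset h₂.isClosed
      (hO.inter isOpen_interior) (subset_inter hs₂ (subset_union_right.trans hKL))
    refine Bdd.union h₁.isClosed h₂.isClosed (hKU₁.trans subset_closure)
      (hKU₂.trans subset_closure)
      (Bdd.of_chart (h₁.isClosed.inter h₂.isClosed) (inter_subset_left.trans hs₁) ?_)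
      (Bdd.of_chart isClosed_closure (hUL₁.trans inter_subset_left)
        (hUL₁.trans inter_subset_right))
      (ih isClosed_closure (hUL₂.trans inter_subset_left) (hUL₂.trans inter_subset_right))
    exact (inter_subset_inter hKU₁ hKU₂).trans (interior_maximal
      (inter_subset_inter subset_closure subset_closure) (hU₁.inter hU₂))

/-- The homology of a compact manifold is finite, uniformly in the coefficients. -/
theorem LocEuc.exists_wt_le (hM : LocEuc n M) : ∃ w : ℕ, ∀ (k : Type) [Field k] (p : ℕ) (G : Type)
    [CommGroup G] [MulAction G M] (hG : ∀ g : G, g ^ p = 1),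
    (AS k M hG).wt (n + 5) (LF k ⊤ univ) (LO k ⊤) ≤ w := by
  choose φ hφ using hM
  obtain ⟨s, hs⟩ := isCompact_univ.elim_nhds_subcover (fun y => (φ y).source)
    fun y _ => (φ y).open_source.mem_nhds (hφ y)
  obtain ⟨b, hb⟩ := Bdd.of_charts s φ isClosed_univ hs.2 (interior_univ (X := M)).ge
  refine ⟨(n + 5) * ((n + 5) * b), fun k _ p G _ _ hG => ?_⟩
  refine Amb.wt_le_mul (fun j => ?_) _
  refine le_trans ?_ (hb k p G hG j)
  rw [LF_top, ← show LF k ⊤ (∅ : Set M) = LO k ⊤ from funext fun _ => LF_empty, LF_top]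
  refine (relLen_mono _ ?_).trans (relLen_anti _ le_sup_right)
  rintro z ⟨hz, hdz⟩
  refine ⟨hz, ?_⟩
  replace hdz : (AS k M hG).d z ∈ A k ∅ (j - 1) := hdz
  rwa [A, AF_empty] at hdz

end MannSu

namespace MannSu

open scoped Topology
open Set Filter

universe u v w

section Clopen

variable {k : Type v} [Field k] {M : Type u} [TopologicalSpace M]
  {p : ℕ} {G : Type w} [CommGroup G] [MulAction G M] {hG : ∀ g : G, g ^ p = 1}

/-- A set carrying the homology of `M` meets every component of `M`. -/
theorem Acy.inter_nonempty {X C : Set M} (h : Acy k hG ⊤ univ X) (hC : IsClopen C)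
    (hne : C.Nonempty) : (X ∩ C).Nonempty := by
  classical
  by_contra! he
  obtain ⟨x, hx⟩ := hne
  let z : Module.Dual k (List M → k) := LinearMap.proj [x]
  have hz : z ∈ A k univ 1 := by
    rw [mem_AF]
    intro f hf
    obtain ⟨U, hU, h⟩ := hf one_ne_zero (mem_univ x)
    exact h [x] rfl fun y hy => ⟨by rw [List.mem_singleton.1 hy]; exact mem_of_mem_nhds hU, trivial⟩
  obtain ⟨q, hq, hzq⟩ := Amb.H_eq_zero_iff.1 (h 1) z (by rwa [LF_univ]) (by
    have := AF_d_mem (hG := hG) hz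
    rw [AF_zero, Submodule.mem_bot] at this
    rw [this]
    exact zero_mem _)
  rw [LF_top] at hq hzq
  let f : List M → k := fun l => if ∀ y ∈ l, y ∈ C then 1 else 0
  have hf : f ∈ I k X 1 := fun _ s hs => by
    have hsC : s ∈ Cᶜ := fun hsC => he.subset ⟨hs, hsC⟩
    refine ⟨Cᶜ, hC.compl.isOpen.mem_nhds hsC, fun l hl hlU => ?_⟩
    match l, hl with
    | [y], _ =>
      refine if_neg fun hy => (hlU y (by simp)).1 (hy y (by simp))
  have hdf : cd k M f ∈ I k univ 2 := fun _ s _ => by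
    by_cases hs : s ∈ C
    · refine ⟨C, hC.isOpen.mem_nhds hs, fun l hl hlU => ?_⟩
      match l, hl with
      | [y, y'], _ =>
        have h1 := (hlU y (by simp)).1
        have h2 := (hlU y' (by simp)).1
        simp [cd_apply, del_cons, f, h1, h2]
    · refine ⟨Cᶜ, hC.compl.isOpen.mem_nhds hs, fun l hl hlU => ?_⟩
      match l, hl with
      | [y, y'], _ =>
        have h1 := (hlU y (by simp)).1
        have h2 := (hlU y' (by simp)).1
        rw [mem_compl_iff] at h1 h2
        simp [cd_apply, del_cons, f, h1, h2]
  have h1 := mem_AF.1 hzq f hf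
  have h2 : f [x] - q (cd k M f) = 0 := h1
  rw [mem_AF.1 hq _ hdf, sub_zero] at h2
  simp [f, hx] at h2

end Clopen

section Corank

variable {G : Type*} [CommGroup G]

/-- The quotient of `G` by `L` is generated by `m` elements. -/
def Cork (L : Subgroup G) (m : ℕ) : Prop :=
  ∃ s : Finset G, s.card ≤ m ∧ L ⊔ Subgroup.closure s = ⊤

theorem Cork.trans {L : Subgroup G} {K : Subgroup L} {a b : ℕ} (hL : Cork L a) (hK : Cork K b) :
    Cork (K.map L.subtype) (a + b) := by
  classical
  obtain ⟨s, hs, hsL⟩ := hL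
  obtain ⟨t, ht, htK⟩ := hK
  refine ⟨s ∪ t.image L.subtype, (Finset.card_union_le _ _).trans
    (add_le_add hs (Finset.card_image_le.trans ht)), ?_⟩
  have h := congrArg (Subgroup.map L.subtype) htK
  rw [Subgroup.map_sup, MonoidHom.map_closure, ← MonoidHom.range_eq_map,
    Subgroup.range_subtype] at h
  rw [Finset.coe_union, Finset.coe_image, Subgroup.closure_union, sup_comm (Subgroup.closure _),
    ← sup_assoc, h, hsL]

end Corank

section Manifold

variable {M : Type u} [TopologicalSpace M] [T2Space M] [CompactSpace M]
  [TopologicalSpace.MetrizableSpace M] {n p : ℕ}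

/-- A homeomorphism of prime order fixing a neighbourhood of a point fixes its component. -/
theorem connectedComponent_subset_fixedBy {G : Type w} [CommGroup G] [MulAction G M]
    [ContinuousConstSMul G M] (hp : p.Prime) (hG : ∀ g : G, g ^ p = 1)
    (hM : LocEuc n M) (g : G) {y : M} (hy : MulAction.fixedBy M g ∈ 𝓝 y) :
    connectedComponent y ⊆ MulAction.fixedBy M g := by
  rcases eq_or_ne g 1 with rfl | hg
  · simp
  have hcl : IsClosed (interior (MulAction.fixedBy M g)) := by
    refine closure_subset_iff_isClosed.1 fun x hx => mem_interior_iff_mem_nhds.2 ?_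
    have : Fact p.Prime := ⟨hp⟩
    have hfin : Finite (Subgroup.zpowers g) :=
      (isOfFinOrder_iff_pow_eq_one.2 ⟨p, hp.pos, hG g⟩).finite_zpowers
    exact fixedBy_mem_nhds (k := ZMod p) (G := Subgroup.zpowers g) hp (CharP.cast_eq_zero _ p)
      (fun h => Subtype.ext (hG h)) hM (g := ⟨g, Subgroup.mem_zpowers g⟩)
      (fun h => hg (congrArg Subtype.val h))
      (fun h x hx => by
        have : Subgroup.zpowers g ≤ MulAction.stabilizer G x :=
          (Subgroup.zpowers_le).2 hx
        exact this h.2) hx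
  exact (isPreconnected_connectedComponent.subset_isClopen ⟨hcl, isOpen_interior⟩
    ⟨y, mem_connectedComponent, mem_interior_iff_mem_nhds.2 hy⟩).trans interior_subset

theorem exists_cork_fixd_nhds {G : Type w} [CommGroup G] [Finite G] [MulAction G M]
    [ContinuousConstSMul G M] (hp : p.Prime) (hG : ∀ g : G, g ^ p = 1) (hM : LocEuc n M) {y : M}
    (hy : ∀ g : G, g • y = y) {w : ℕ} (hw : (n + 5) * ((n + 5) * 1) = w) :
    ∃ K : Subgroup G, Cork K (w * (2 * w * (n + 5))) ∧ connectedComponent y ⊆ fixd M K := by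
  have : Fact p.Prime := ⟨hp⟩
  have h𝓕 : ∀ g : G, Tendsto (g • · : M → M) (𝓝 y) (𝓝 y) := fun g => by
    have := (continuous_const_smul g).tendsto y
    rwa [hy g] at this
  obtain ⟨φ, hφ⟩ := hM y
  obtain ⟨K, s, hs, hK, hacy⟩ := exists_acy_fixd (k := ZMod p) (hG := hG) hp
    (CharP.cast_eq_zero _ p) hM h𝓕 (hw ▸ wt_nhds_le hφ (n + 5))
  have hKy := hacy.mem_nhds hφ (isClosed_fixd K)
  exact ⟨K, ⟨s, hs, hK⟩, fun x hx g hg => connectedComponent_subset_fixedBy hp hG hM g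
    (mem_of_superset hKy fun z hz => hz g hg) hx⟩

theorem exists_cork_fixd {G : Type w} [CommGroup G] [Finite G] [MulAction G M]
    [ContinuousConstSMul G M] (hp : p.Prime) (hG : ∀ g : G, g ^ p = 1) (hM : LocEuc n M)
    {K : Subgroup G} {a w : ℕ} (hw : (n + 5) * ((n + 5) * 1) = w) (hK : Cork K a)
    (hKM : ∀ x, (fixd M K ∩ connectedComponent x).Nonempty) (t : Finset M) :
    ∃ L ≤ K, Cork L (a + t.card * (w * (2 * w * (n + 5)))) ∧
      ∀ x ∈ t, connectedComponent x ⊆ fixd M L := by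
  classical
  induction t using Finset.induction_on with
  | empty => exact ⟨K, le_rfl, by simpa using hK, by simp⟩
  | insert x t hx ih =>
    obtain ⟨L, hLK, hL, hLt⟩ := ih
    obtain ⟨y, hyK, hyx⟩ := hKM x
    obtain ⟨E, hE, hEy⟩ := exists_cork_fixd_nhds (G := L) hp (fun g => Subtype.ext (hG g)) hM
      (y := y) (fun g => hyK g (hLK g.2)) hw
    have hEL : E.map L.subtype ≤ L := Subgroup.map_subtype_le E
    refine ⟨E.map L.subtype, hEL.trans hLK, ?_, ?_⟩
    · rw [Finset.card_insert_of_notMem hx, add_mul, one_mul, ← add_assoc]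
      exact hL.trans hE
    · intro z hz
      rcases Finset.mem_insert.1 hz with rfl | hz
      · rw [connectedComponent_eq hyx]
        rintro v hv _ ⟨g, hg, rfl⟩
        exact hEy hv g hg
      · exact (hLt z hz).trans (fixd_anti hEL)

end Manifold

theorem locEuc_of_chartedSpace (n : ℕ) (M : Type u) [TopologicalSpace M]
    [ChartedSpace (EuclideanSpace ℝ (Fin n)) M] : LocEuc n M := fun x =>
  ⟨(chartAt (EuclideanSpace ℝ (Fin n)) x).transHomeomorph
    (EuclideanSpace.equiv (Fin n) ℝ).toHomeomorph, mem_chart_source _ x⟩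

end MannSu

/-- **Mann–Su theorem** (elementary abelian case): for a compact topological
`n`-manifold `M` there is a constant `r` such that for every prime `p`, every
elementary abelian `p`-group acting continuously and effectively on `M` has rank
(= minimal number of generators = dimension over `𝔽_p`) at most `r`. -/
theorem rank_bound_of_effective_elementary_abelian_action_on_compact_manifold
    (n : ℕ) (M : Type*) [TopologicalSpace M] [T2Space M]
    [SecondCountableTopology M] [ChartedSpace (EuclideanSpace ℝ (Fin n)) M]
    [CompactSpace M] :
    ∃ r : ℕ, ∀ (p : ℕ), p.Prime →
      ∀ (G : Type) [CommGroup G] [Finite G] [MulAction G M],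
        (∀ g : G, g ^ p = 1) →
        (∀ g : G, Continuous fun x : M => g • x) →
        (∀ g : G, (∀ x : M, g • x = x) → g = 1) →
        Group.rank G ≤ r := by
  have hM := MannSu.locEuc_of_chartedSpace n M
  have := TopologicalSpace.metrizableSpace_of_t3_secondCountable M
  have := ChartedSpace.locallyConnectedSpace (EuclideanSpace ℝ (Fin n)) M
  obtain ⟨w₀, hw₀⟩ := hM.exists_wt_le
  obtain ⟨t, -, ht⟩ := isCompact_univ.elim_nhds_subcover (fun x : M => connectedComponent x)
    fun x _ => isOpen_connectedComponent.mem_nhds mem_connectedComponent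
  obtain ⟨w, hw⟩ : ∃ w, (n + 5) * ((n + 5) * 1) = w := ⟨_, rfl⟩
  refine ⟨w₀ * (2 * w₀ * (n + 5)) + t.card * (w * (2 * w * (n + 5))), ?_⟩
  intro p hp G _ _ _ hG hcont heff
  have : Fact p.Prime := ⟨hp⟩
  have : ContinuousConstSMul G M := ⟨hcont⟩
  obtain ⟨K, s, hs, hK, hacy⟩ := MannSu.exists_acy_fixd (k := ZMod p) (hG := hG) hp
    (CharP.cast_eq_zero _ p) hM (𝓕 := ⊤) (fun _ => Filter.tendsto_top) (hw₀ (ZMod p) p G hG)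
  obtain ⟨L, -, ⟨s', hs', hL⟩, hLt⟩ := MannSu.exists_cork_fixd hp hG hM hw ⟨s, hs, hK⟩
    (fun x => hacy.inter_nonempty ⟨isClosed_connectedComponent, isOpen_connectedComponent⟩
      ⟨x, mem_connectedComponent⟩) t
  have hL0 : L = ⊥ := (Subgroup.eq_bot_iff_forall L).2 fun g hg => heff g fun x => by
    obtain ⟨y, hy, hxy⟩ := Set.mem_iUnion₂.1 (ht (Set.mem_univ x))
    exact hLt y hy hxy g hg
  rw [hL0, bot_sup_eq] at hL
  exact (Group.rank_le hL).trans hs'
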